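/- Let M be a closed oriented connected manifold of even dimension 2m that has a non-zero even Betti number β_{2i}(M) ≠ 0 in some even degree 2i with 2i ∉ {0, m, 2m}. Then M does not have the strong stability property for its unordered configuration spaces. -/

import Mathlib

open CategoryTheory

/-- The singular chain complex of a topological space with rational coefficients:
the alternating face map complex of the free simplicial `ℚ`-module on the singular
simplicial set. -/
noncomputable def singularChainComplexQ (X : Type) [TopologicalSpace X] :
    ChainComplex (ModuleCat ℚ) ℕ :=
  (AlgebraicTopology.alternatingFaceMapComplex (ModuleCat ℚ)).obj
    (((CategoryTheory.SimplicialObject.whiskering _ _).obj (ModuleCat.free ℚ)).obj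
      (TopCat.toSSet.obj (TopCat.of X)))

/-- Singular homology with rational coefficients. -/
noncomputable def singularHomologyQ (X : Type) [TopologicalSpace X] (n : ℕ) : ModuleCat ℚ :=
  (singularChainComplexQ X).homology n

/-- Singular cohomology with rational coefficients.  Since `ℚ` is a field, by the universal
coefficient theorem `H^n(X;ℚ)` is naturally isomorphic to the linear dual of `H_n(X;ℚ)`,
which we take as the definition. -/
noncomputable def singularCohomologyQ (X : Type) [TopologicalSpace X] (n : ℕ) : Type :=
  Module.Dual ℚ (singularHomologyQ X n)

noncomputable instance (X : Type) [TopologicalSpace X] (n : ℕ) :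
    AddCommGroup (singularCohomologyQ X n) :=
  inferInstanceAs (AddCommGroup (Module.Dual ℚ (singularHomologyQ X n)))

noncomputable instance (X : Type) [TopologicalSpace X] (n : ℕ) :
    Module ℚ (singularCohomologyQ X n) :=
  inferInstanceAs (Module ℚ (Module.Dual ℚ (singularHomologyQ X n)))

/-- The `i`-th rational Betti number `β_i(X) = dim_ℚ H^i(X;ℚ)`. -/
noncomputable def bettiQ (X : Type) [TopologicalSpace X] (i : ℕ) : ℕ :=
  Module.finrank ℚ (singularCohomologyQ X i)

/-- The ordered configuration space `F_k(X)` of `k` distinct points of `X`,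
with the subspace topology from `X^k`. -/
def orderedConfig (X : Type) [TopologicalSpace X] (k : ℕ) : Type :=
  {f : Fin k → X // Function.Injective f}

instance (X : Type) [TopologicalSpace X] (k : ℕ) : TopologicalSpace (orderedConfig X k) :=
  inferInstanceAs (TopologicalSpace {f : Fin k → X // Function.Injective f})

/-- The unordered configuration space `C_k(X) = F_k(X)/S_k`, the quotient of the ordered
configuration space by the permutation action of the symmetric group, with the quotient
topology. -/
def unorderedConfig (X : Type) [TopologicalSpace X] (k : ℕ) : Type :=
  Quot (fun f g : orderedConfig X k => ∃ σ : Equiv.Perm (Fin k), g.1 = f.1 ∘ σ)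

instance (X : Type) [TopologicalSpace X] (k : ℕ) : TopologicalSpace (unorderedConfig X k) :=
  inferInstanceAs (TopologicalSpace (Quot _))

/-- `M` has the strong stability property with range `r`:
`H^i(C_k(M);ℚ) ≅ H^i(C_{k+1}(M);ℚ)` for all `i ≥ 0` and all `k ≥ r`. -/
def StrongStabilityRange (M : Type) [TopologicalSpace M] (r : ℕ) : Prop :=
  ∀ k : ℕ, r ≤ k → ∀ i : ℕ,
    Nonempty (singularCohomologyQ (unorderedConfig M k) i ≃ₗ[ℚ]
      singularCohomologyQ (unorderedConfig M (k + 1)) i)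

/-- `M` has the strong stability property: for some `r ≥ 1`, the rational cohomology of its
unordered configuration spaces is constant from `C_r(M)` on. -/
def StrongStability (M : Type) [TopologicalSpace M] : Prop :=
  ∃ r : ℕ, 1 ≤ r ∧ StrongStabilityRange M r

/-- `X` has finite-dimensional total rational cohomology: each `H^i(X;ℚ)` is
finite-dimensional and all but finitely many vanish. -/
def FiniteTotalCohomologyQ (X : Type) [TopologicalSpace X] : Prop :=
  (∀ i : ℕ, FiniteDimensional ℚ (singularCohomologyQ X i)) ∧
  ∃ N : ℕ, ∀ i : ℕ, N ≤ i → Subsingleton (singularCohomologyQ X i)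

/-- `M` is a rational homology `n`-sphere: `H^*(M;ℚ) ≅ H^*(S^n;ℚ)`, i.e.
`H^i(M;ℚ)` is one-dimensional for `i ∈ {0, n}` and vanishes otherwise (`n ≥ 1`). -/
def RatHomologySphere (M : Type) [TopologicalSpace M] (n : ℕ) : Prop :=
  ∀ i : ℕ, Module.rank ℚ (singularCohomologyQ M i) = if i = 0 ∨ i = n then 1 else 0

/-- `M` (of dimension `4m`) is a homology projective plane:
`β_0 = β_{2m} = β_{4m} = 1` and all other Betti numbers vanish. -/
def HomologyProjPlane (M : Type) [TopologicalSpace M] (m : ℕ) : Prop :=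
  ∀ i : ℕ, bettiQ M i = if i = 0 ∨ i = 2 * m ∨ i = 4 * m then 1 else 0

/-- The rational cohomological dimension: the largest `i` with `H^i(X;ℚ) ≠ 0`. -/
noncomputable def cohomDimQ (X : Type) [TopologicalSpace X] : ℕ :=
  sSup {i : ℕ | bettiQ X i ≠ 0}

/-- The `q`-truncated Poincaré polynomial
`P^{[q]}_X(t) = β_{τ-q+1} t^{τ-q+1} + ⋯ + β_τ t^τ` where `τ = cd(X)`. -/
noncomputable def truncPoincareQ (X : Type) [TopologicalSpace X] (q : ℕ) : Polynomial ℕ :=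
  ∑ j ∈ Finset.range q,
    if j ≤ cohomDimQ X then
      Polynomial.monomial (cohomDimQ X - j) (bettiQ X (cohomDimQ X - j))
    else 0

/-- The Poincaré polynomial `P_X(t) = ∑ᵢ β_i(X) tⁱ` (of a space with finite-dimensional
total cohomology). -/
noncomputable def poincarePolyQ (X : Type) [TopologicalSpace X] : Polynomial ℕ :=
  ∑ i ∈ Finset.range (cohomDimQ X + 1), Polynomial.monomial i (bettiQ X i)

/-- `M` satisfies the shifted stability condition with range `r`, shift `σ` and length `q`:
`P^{[q]}_{C_{k+1}(M)}(t) = t^σ P^{[q]}_{C_k(M)}(t)` for all `k ≥ r`. -/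
def ShiftedStabilityQ (M : Type) [TopologicalSpace M] (r σ q : ℕ) : Prop :=
  ∀ k : ℕ, r ≤ k →
    truncPoincareQ (unorderedConfig M (k + 1)) q =
      Polynomial.X ^ σ * truncPoincareQ (unorderedConfig M k) q

/-- `M` satisfies the Poincaré-polynomial shifted stability condition with range `r`,
shift `σ` and ratio `R`:  `P_{C_{k+1}(M)}(t) = P_{C_k(M)}(t) + t^{(k+1-r)σ} R(t)` for all
`k ≥ r`. -/
def PoincarePolyShiftedStability (M : Type) [TopologicalSpace M] (r σ : ℕ)
    (R : Polynomial ℕ) : Prop :=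
  ∀ k : ℕ, r ≤ k →
    poincarePolyQ (unorderedConfig M (k + 1)) =
      poincarePolyQ (unorderedConfig M k) + Polynomial.X ^ ((k + 1 - r) * σ) * R

/-- `M` satisfies the extended shifted stability condition with range `r` and shift `σ`:
`P^{[(k-r+1)σ]}_{C_{k+1}(M)}(t) = t^σ P^{[(k-r+1)σ]}_{C_k(M)}(t)` for all `k ≥ r`. -/
def ExtendedShiftedStability (M : Type) [TopologicalSpace M] (r σ : ℕ) : Prop :=
  ∀ k : ℕ, r ≤ k →
    truncPoincareQ (unorderedConfig M (k + 1)) ((k - r + 1) * σ) =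
      Polynomial.X ^ σ * truncPoincareQ (unorderedConfig M k) ((k - r + 1) * σ)

namespace ConfStab

noncomputable section

set_option linter.unusedSectionVars false

section

/-! ### Chains of lists -/

/-- The free `ℚ`-module on lists. -/
abbrev LCh (D : Type) := List D →₀ ℚ

/-- A list as a chain. -/
def ls {D : Type} (l : List D) : LCh D := Finsupp.single l 1

/-- Linear extension of a function on a basis. -/
abbrev lin {α N : Type} [AddCommGroup N] [Module ℚ N] (g : α → N) : (α →₀ ℚ) →ₗ[ℚ] N :=
  Finsupp.linearCombination ℚ g

section lists
variable {D D' E E' N : Type} [AddCommGroup N] [Module ℚ N]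

@[simp] lemma lin_ls (g : List D → N) (l : List D) : lin g (ls l) = g l := by
  simp [ls]

lemma lin_ext {α : Type} {F G : (α →₀ ℚ) →ₗ[ℚ] N}
    (h : ∀ a, F (Finsupp.single a 1) = G (Finsupp.single a 1)) : F = G :=
  Finsupp.lhom_ext' fun a => LinearMap.ext_ring (h a)

lemma lin_ext_apply {α : Type} {F G : (α →₀ ℚ) →ₗ[ℚ] N}
    (h : ∀ a, F (Finsupp.single a 1) = G (Finsupp.single a 1)) (c : α →₀ ℚ) : F c = G c := by
  rw [lin_ext h]

/-- Coning off with a new first vertex. -/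
def cone (a : D) : LCh D →ₗ[ℚ] LCh D := lin fun l => ls (a :: l)

@[simp] lemma cone_ls (a : D) (l : List D) : cone a (ls l) = ls (a :: l) := by simp [cone]

/-- Augmented boundary of a list. -/
def bdl : List D → LCh D
  | [] => 0
  | a :: l => ls l - cone a (bdl l)

/-- Augmented boundary. -/
def bd : LCh D →ₗ[ℚ] LCh D := lin bdl

@[simp] lemma bd_nil : bd (ls ([] : List D)) = 0 := by simp [bd, bdl]

lemma bd_cons (a : D) (l : List D) : bd (ls (a :: l)) = ls l - cone a (bd (ls l)) := by
  simp [bd, bdl]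

lemma bd_cone (a : D) (c : LCh D) : bd (cone a c) = c - cone a (bd c) := by
  have : bd ∘ₗ cone a = LinearMap.id - cone a ∘ₗ bd := lin_ext fun l => by
    change bd (cone a (ls l)) = ls l - cone a (bd (ls l))
    rw [cone_ls, bd_cons]
  simpa using LinearMap.congr_fun this c

@[simp] lemma bd_bd (c : LCh D) : bd (bd c) = 0 := by
  have : bd ∘ₗ bd = (0 : LCh D →ₗ[ℚ] LCh D) := lin_ext fun l => by
    change bd (bd (ls l)) = 0
    induction l with
    | nil => simp
    | cons a l ih => rw [bd_cons, map_sub, bd_cone, ih]; simp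
  simpa using LinearMap.congr_fun this c

/-- The map induced on list chains. -/
def lmap (φ : D → E) : LCh D →ₗ[ℚ] LCh E := lin fun l => ls (l.map φ)

@[simp] lemma lmap_ls (φ : D → E) (l : List D) : lmap φ (ls l) = ls (l.map φ) := by simp [lmap]

lemma lmap_cone (φ : D → E) (a : D) (c : LCh D) :
    lmap φ (cone a c) = cone (φ a) (lmap φ c) :=
  lin_ext_apply (F := lmap φ ∘ₗ cone a) (G := cone (φ a) ∘ₗ lmap φ) (fun l => by
    change lmap φ (cone a (ls l)) = cone (φ a) (lmap φ (ls l)); simp) c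

lemma lmap_bd (φ : D → E) (c : LCh D) : lmap φ (bd c) = bd (lmap φ c) :=
  lin_ext_apply (F := lmap φ ∘ₗ bd) (G := bd ∘ₗ lmap φ) (fun l => by
    change lmap φ (bd (ls l)) = bd (lmap φ (ls l))
    induction l with
    | nil => simp
    | cons a l ih =>
      rw [bd_cons, map_sub, lmap_cone, ih]
      simp [bd_cons]) c

/-- List chains of length `n`. -/
def LDeg (D : Type) (n : ℕ) : Submodule ℚ (LCh D) := Finsupp.supported ℚ ℚ {l | l.length = n}

lemma ls_mem_LDeg (l : List D) : ls l ∈ LDeg D l.length :=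
  Finsupp.single_mem_supported _ _ rfl

lemma lin_mem_of_supported {α : Type} {g : α → N} {s : Set α} {P : Submodule ℚ N}
    (h : ∀ a ∈ s, g a ∈ P) {c : α →₀ ℚ} (hc : c ∈ Finsupp.supported ℚ ℚ s) : lin g c ∈ P := by
  rw [lin, Finsupp.linearCombination_apply]
  exact P.sum_mem fun a ha => P.smul_mem _ (h a (hc ha))

lemma map_mem_of_supported {α : Type} {F : (α →₀ ℚ) →ₗ[ℚ] N} {s : Set α} {P : Submodule ℚ N}
    (h : ∀ a ∈ s, F (Finsupp.single a 1) ∈ P) {c : α →₀ ℚ} (hc : c ∈ Finsupp.supported ℚ ℚ s) :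
    F c ∈ P := by
  have : F = lin fun a => F (Finsupp.single a 1) := lin_ext fun a => by simp
  rw [this]
  exact lin_mem_of_supported h hc

lemma lin_congr_supported {α : Type} {g g' : α → N} {s : Set α}
    (h : ∀ a ∈ s, g a = g' a) {c : α →₀ ℚ} (hc : c ∈ Finsupp.supported ℚ ℚ s) :
    lin g c = lin g' c := by
  simp only [lin, Finsupp.linearCombination_apply]
  exact Finsupp.sum_congr fun a ha => by rw [h a (hc ha)]

lemma cone_mem (a : D) {n : ℕ} {c : LCh D} (hc : c ∈ LDeg D n) : cone a c ∈ LDeg D (n + 1) :=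
  lin_mem_of_supported (fun l hl => Finsupp.single_mem_supported _ _ (by
    simpa using hl)) hc

lemma bd_mem {n : ℕ} {c : LCh D} (hc : c ∈ LDeg D (n + 1)) : bd c ∈ LDeg D n := by
  refine lin_mem_of_supported (fun l hl => ?_) hc
  induction l generalizing n c with
  | nil => simp at hl
  | cons a l ih =>
    simp only [Set.mem_ofPred_eq, List.length_cons, Nat.add_right_cancel_iff] at hl
    subst hl
    refine Submodule.sub_mem _ (ls_mem_LDeg l) ?_
    cases l with
    | nil => simp [bdl]
    | cons b l => exact cone_mem a (ih (c := ls (b :: l)) (ls_mem_LDeg (b :: l)) rfl)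

/-- The cone recursion `G l = b l * (Φ l - G ∂l)`, with fuel. -/
def coneRecAux (Φ : List D → LCh D') (b : D → List D → D') : ℕ → List D → LCh D'
  | _, [] => 0
  | 0, _ :: _ => 0
  | n + 1, a :: l => cone (b a l) (Φ (a :: l) - lin (coneRecAux Φ b n) (bd (ls (a :: l))))

/-- The operator with `G l = b l * (Φ l - G ∂l)`. -/
def coneRec (Φ : List D → LCh D') (b : D → List D → D') : LCh D →ₗ[ℚ] LCh D' :=
  lin fun l => coneRecAux Φ b l.length l

variable (Φ : List D → LCh D') (b : D → List D → D')

@[simp] lemma coneRec_nil : coneRec Φ b (ls []) = 0 := by simp [coneRec, coneRecAux]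

lemma coneRec_cons (a : D) (l : List D) : coneRec Φ b (ls (a :: l)) =
    cone (b a l) (Φ (a :: l) - coneRec Φ b (bd (ls (a :: l)))) := by
  simp only [coneRec, lin_ls, List.length_cons, coneRecAux]
  congr 2
  exact lin_congr_supported (fun l' hl' => by rw [show l'.length = l.length from hl'])
    (bd_mem (ls_mem_LDeg (a :: l)))

variable {Φ}

lemma bd_coneRec (hΦ : ∀ c, bd (lin Φ c) = lin Φ (bd c)) (hΦ0 : Φ [] = 0) (c : LCh D) :
    bd (coneRec Φ b c) = lin Φ c - coneRec Φ b (bd c) := by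
  have key : ∀ n, ∀ l : List D, l.length ≤ n →
      bd (coneRec Φ b (ls l)) = lin Φ (ls l) - coneRec Φ b (bd (ls l)) := by
    intro n
    induction n with
    | zero =>
      intro l hl
      obtain rfl : l = [] := by simpa using hl
      simp [hΦ0]
    | succ n ih =>
      intro l hl
      cases l with
      | nil => simp [hΦ0]
      | cons a l =>
        rw [coneRec_cons, bd_cone, map_sub]
        have h1 : bd (coneRec Φ b (bd (ls (a :: l)))) =
            lin Φ (bd (ls (a :: l))) - coneRec Φ b (bd (bd (ls (a :: l)))) := by
          have h2 : bd (ls (a :: l)) ∈ LDeg D l.length := bd_mem (ls_mem_LDeg (a :: l))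
          have h3 := map_mem_of_supported (F := bd ∘ₗ coneRec Φ b - lin Φ + coneRec Φ b ∘ₗ bd)
            (P := ⊥) (fun l' hl' => by
              have := ih l' (by have : l'.length = l.length := hl'; simp at hl; omega)
              change bd (coneRec Φ b (ls l')) - lin Φ (ls l') + coneRec Φ b (bd (ls l')) ∈ _
              rw [this]; simp) h2
          simp only [Submodule.mem_bot, LinearMap.add_apply, LinearMap.sub_apply,
            LinearMap.comp_apply] at h3
          rw [bd_bd, map_zero] at h3 ⊢
          rw [add_zero] at h3
          rw [sub_zero]
          exact sub_eq_zero.1 h3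
        have h4 := hΦ (ls (a :: l))
        rw [lin_ls] at h4
        rw [h1, h4, lin_ls]
        simp
  exact lin_ext_apply (F := bd ∘ₗ coneRec Φ b) (G := lin Φ - coneRec Φ b ∘ₗ bd)
    (fun l => key _ l le_rfl) c

lemma coneRec_natural {Ψ : List E → LCh E'} {b' : E → List E → E'} (φ : D → E) (φ' : D' → E')
    (hΦ : ∀ l, lmap φ' (Φ l) = Ψ (l.map φ)) (hb : ∀ a l, φ' (b a l) = b' (φ a) (l.map φ))
    (c : LCh D) : lmap φ' (coneRec Φ b c) = coneRec Ψ b' (lmap φ c) := by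
  have key : ∀ n, ∀ l : List D, l.length ≤ n →
      lmap φ' (coneRec Φ b (ls l)) = coneRec Ψ b' (lmap φ (ls l)) := by
    intro n
    induction n with
    | zero =>
      intro l hl
      obtain rfl : l = [] := by simpa using hl
      simp
    | succ n ih =>
      intro l hl
      cases l with
      | nil => simp
      | cons a l =>
        rw [coneRec_cons, lmap_cone, map_sub, lmap_ls, List.map_cons, coneRec_cons, ← hb, hΦ,
          List.map_cons, ← List.map_cons, ← lmap_ls, ← lmap_bd]
        congr 2
        have h2 : bd (ls (a :: l)) ∈ LDeg D l.length := bd_mem (ls_mem_LDeg (a :: l))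
        have h3 := map_mem_of_supported (F := lmap φ' ∘ₗ coneRec Φ b - coneRec Ψ b' ∘ₗ lmap φ)
            (P := ⊥) (fun l' hl' => by
              have := ih l' (by have : l'.length = l.length := hl'; simp at hl; omega)
              change lmap φ' (coneRec Φ b (ls l')) - coneRec Ψ b' (lmap φ (ls l')) ∈ _
              rw [this]; simp) h2
        exact sub_eq_zero.1 (by simpa using h3)
  exact lin_ext_apply (F := lmap φ' ∘ₗ coneRec Φ b) (G := coneRec Ψ b' ∘ₗ lmap φ)
    (fun l => key _ l le_rfl) c

lemma coneRec_mem (hΦ : ∀ l, Φ l ∈ LDeg D' l.length) {n : ℕ} {c : LCh D} (hc : c ∈ LDeg D n) :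
    coneRec Φ b c ∈ LDeg D' (n + 1) := by
  induction n generalizing c with
  | zero =>
    refine map_mem_of_supported (fun l hl => ?_) hc
    obtain rfl : l = [] := by simpa using hl
    change coneRec Φ b (ls []) ∈ _
    simp
  | succ n ih =>
    refine map_mem_of_supported (fun l hl => ?_) hc
    cases l with
    | nil => simp at hl
    | cons a l =>
      change coneRec Φ b (ls (a :: l)) ∈ _
      have hl' : l.length = n := by simpa using hl
      rw [coneRec_cons]
      refine cone_mem _ (Submodule.sub_mem _ ?_ (ih (bd_mem ?_)))
      · simpa [hl'] using hΦ (a :: l)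
      · simpa [hl'] using ls_mem_LDeg (a :: l)

end lists

end

section

/-! ### Convex combinations -/

/-- The standard topological simplex. -/
abbrev Dl (n : ℕ) : Type := stdSimplex ℝ (Fin (n + 1))

/-- Convex combination of points in a convex set. -/
def convComb {V : Type} [AddCommGroup V] [Module ℝ V] [TopologicalSpace V] [ContinuousAdd V]
    [ContinuousSMul ℝ V] {s : Set V} (hs : Convex ℝ s) {n : ℕ} (v : Fin (n + 1) → s) :
    C(Dl n, s) where
  toFun t := ⟨∑ i, t i • (v i : V),
    hs.sum_mem (fun i _ => t.2.1 i) t.2.2 (fun i _ => (v i).2)⟩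
  continuous_toFun := by
    refine Continuous.subtype_mk ?_ _
    refine continuous_finsetSum _ fun i _ => Continuous.smul ?_ continuous_const
    exact (continuous_apply i).comp continuous_subtype_val

/-- Spaces with continuous convex combinations. -/
class Cvx (D : Type) [TopologicalSpace D] where
  comb {n : ℕ} (v : Fin (n + 1) → D) : C(Dl n, D)
  comb_vertex {n : ℕ} (v : Fin (n + 1) → D) (i : Fin (n + 1)) :
    comb v (stdSimplex.vertex i) = v i
  comb_comb {n m : ℕ} (v : Fin (n + 1) → D) (w : Fin (m + 1) → Dl n) (t : Dl m) :
    comb v (convComb (convex_stdSimplex ℝ _) w t) = comb (fun i => comb v (w i)) t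

open Cvx

/-- A convex subset of a topological vector space has convex combinations. -/
abbrev Cvx.ofConvex {V : Type} [AddCommGroup V] [Module ℝ V] [TopologicalSpace V]
    [ContinuousAdd V] [ContinuousSMul ℝ V] {s : Set V} (hs : Convex ℝ s) : Cvx s where
  comb v := convComb hs v
  comb_vertex v i := by
    ext
    simp [convComb, stdSimplex.vertex_coe]
  comb_comb v w t := by
    ext
    simp only [convComb, ContinuousMap.coe_mk]
    change ∑ i, (∑ j, t j • (w j : Fin _ → ℝ)) i • (v i : V) =
      ∑ j, t j • ∑ i, (w j) i • (v i : V)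
    simp only [Finset.sum_apply, Finset.sum_smul, Finset.smul_sum, Pi.smul_apply, smul_eq_mul,
      mul_smul]
    rw [Finset.sum_comm]

instance (n : ℕ) : Cvx (Dl n) := Cvx.ofConvex (convex_stdSimplex ℝ _)

instance : Cvx unitInterval := Cvx.ofConvex (convex_Icc 0 1)

instance {D D' : Type} [TopologicalSpace D] [TopologicalSpace D'] [Cvx D] [Cvx D'] :
    Cvx (D × D') where
  comb v := (comb fun i => (v i).1).prodMk (comb fun i => (v i).2)
  comb_vertex v i := by simp [comb_vertex]
  comb_comb v w t := by simp [comb_comb]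

/-- Maps preserving convex combinations. -/
def IsAff {D D' : Type} [TopologicalSpace D] [TopologicalSpace D'] [Cvx D] [Cvx D']
    (φ : C(D, D')) : Prop :=
  ∀ {n : ℕ} (v : Fin (n + 1) → D) (t : Dl n), φ (comb v t) = comb (fun i => φ (v i)) t

lemma isAff_comb {D : Type} [TopologicalSpace D] [Cvx D] {n : ℕ} (v : Fin (n + 1) → D) :
    IsAff (comb v) := fun w t => comb_comb v w t

/-- Barycenter of a nonempty list. -/
def bary {D : Type} [TopologicalSpace D] [Cvx D] (a : D) (l : List D) : D :=
  comb (a :: l).get (stdSimplex.barycenter : Dl l.length)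

/-- The list of vertices of the standard simplex. -/
def iot (n : ℕ) : List (Dl n) := List.ofFn stdSimplex.vertex

/-! ### Singular chains -/

/-- Singular simplices of all dimensions. -/
abbrev Sx (X : Type) [TopologicalSpace X] : Type := Σ n : ℕ, C(Dl n, X)

/-- Singular chains of all dimensions. -/
abbrev Ch (X : Type) [TopologicalSpace X] : Type := Sx X →₀ ℚ

/-- A simplex as a chain. -/
def sx {X : Type} [TopologicalSpace X] {n : ℕ} (σ : C(Dl n, X)) : Ch X :=
  Finsupp.single ⟨n, σ⟩ 1

section
variable {D D' : Type} [TopologicalSpace D] [Cvx D] [TopologicalSpace D'] [Cvx D']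
  {X Y Z : Type} [TopologicalSpace X] [TopologicalSpace Y] [TopologicalSpace Z]

/-- Realisation of a list as a singular simplex. -/
def Rl (f : C(D, X)) : List D → Ch X
  | [] => 0
  | a :: l => sx (f.comp (comb (a :: l).get))

/-- Realisation of list chains as singular chains. -/
def R (f : C(D, X)) : LCh D →ₗ[ℚ] Ch X := lin (Rl f)

@[simp] lemma R_nil (f : C(D, X)) : R f (ls []) = 0 := by simp [R, Rl]

lemma exists_ofFn {l : List D} (h : l ≠ []) : ∃ (n : ℕ) (v : Fin (n + 1) → D),
    l = List.ofFn v := by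
  cases l with
  | nil => exact absurd rfl h
  | cons a l => exact ⟨l.length, (a :: l).get, (List.ofFn_get (a :: l)).symm⟩

lemma ofFn_cases {a : D} {l : List D} {n : ℕ} {v : Fin (n + 1) → D} (h : a :: l = List.ofFn v)
    {P : ∀ m : ℕ, (Fin (m + 1) → D) → Prop} (hP : P n v) : P l.length (a :: l).get := by
  have hn : l.length = n := by simpa using congrArg List.length h
  subst hn
  have : (a :: l).get = v := by
    apply List.ofFn_injective
    rw [← h]
    exact List.ofFn_get (a :: l)
  rwa [this]

lemma R_ofFn (f : C(D, X)) {n : ℕ} (v : Fin (n + 1) → D) :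
    R f (ls (List.ofFn v)) = sx (f.comp (comb v)) := by
  simp only [R, lin_ls]
  obtain ⟨a, l, h⟩ : ∃ a l, List.ofFn v = a :: l := List.exists_cons_of_ne_nil (by simp)
  rw [h]
  exact ofFn_cases (P := fun m w => sx (f.comp (comb w)) = sx (f.comp (comb v))) h.symm rfl

lemma bary_ofFn {a : D} {l : List D} {n : ℕ} {v : Fin (n + 1) → D} (h : a :: l = List.ofFn v) :
    bary a l = comb v stdSimplex.barycenter :=
  ofFn_cases (P := fun _ w => comb w stdSimplex.barycenter = comb v stdSimplex.barycenter) h rfl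

lemma R_lmap (f : C(D', X)) {φ : C(D, D')} (hφ : IsAff φ) (c : LCh D) :
    R f (lmap φ c) = R (f.comp φ) c :=
  lin_ext_apply (F := R f ∘ₗ lmap φ) (G := R (f.comp φ)) (fun l => by
    change R f (lmap φ (ls l)) = R (f.comp φ) (ls l)
    rcases eq_or_ne l [] with rfl | h
    · simp
    · obtain ⟨n, v, rfl⟩ := exists_ofFn h
      rw [lmap_ls, List.map_ofFn, R_ofFn, R_ofFn]
      congr 1
      ext t
      exact congrArg f (hφ v t).symm) c

lemma map_bary {φ : C(D, D')} (hφ : IsAff φ) (a : D) (l : List D) :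
    φ (bary a l) = bary (φ a) (l.map φ) := by
  obtain ⟨n, v, h⟩ := exists_ofFn (List.cons_ne_nil a l)
  rw [bary_ofFn h, bary_ofFn (v := φ ∘ v) (by rw [← List.map_cons, h, List.map_ofFn])]
  exact hφ v _

lemma map_iot {n : ℕ} (v : Fin (n + 1) → D) : (iot n).map (comb v) = List.ofFn v := by
  rw [iot, List.map_ofFn]
  congr 1
  ext i
  exact comb_vertex v i

lemma comb_vertices {n : ℕ} : comb (stdSimplex.vertex : Fin (n + 1) → Dl n) =
    ContinuousMap.id (Dl n) := by
  ext t : 2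
  change ∑ i, t i • ((stdSimplex.vertex i : Dl n) : Fin (n + 1) → ℝ) = t.1
  ext j
  simp [stdSimplex.vertex_coe, Pi.single_apply]
  rfl

lemma R_iot {n : ℕ} (f : C(Dl n, X)) : R f (ls (iot n)) = sx f := by
  rw [iot, R_ofFn, comb_vertices]; rfl

/-- The singular operator associated with a list operator. -/
def opr (𝒢 : ∀ n, LCh (Dl n)) : Ch X →ₗ[ℚ] Ch X := lin fun σ => R σ.2 (𝒢 σ.1)

@[simp] lemma lin_sx {N : Type} [AddCommGroup N] [Module ℚ N] (g : Sx X → N) {n : ℕ}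
    (σ : C(Dl n, X)) : lin g (sx σ) = g ⟨n, σ⟩ := by simp [sx]

@[simp] lemma opr_sx (𝒢 : ∀ n, LCh (Dl n)) {n : ℕ} (σ : C(Dl n, X)) :
    opr 𝒢 (sx σ) = R σ (𝒢 n) := by simp [opr]

lemma sx_ext {N : Type} [AddCommGroup N] [Module ℚ N] {F G : Ch X →ₗ[ℚ] N}
    (h : ∀ n (σ : C(Dl n, X)), F (sx σ) = G (sx σ)) (c : Ch X) : F c = G c :=
  lin_ext_apply (fun σ => h σ.1 σ.2) c

lemma opr_R {𝒢 : ∀ n, LCh (Dl n)} {H : LCh D →ₗ[ℚ] LCh D}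
    (h : ∀ (n) (v : Fin (n + 1) → D), lmap (comb v) (𝒢 n) = H (ls (List.ofFn v)))
    (h0 : R (X := X) (D := D) f (H (ls [])) = 0) (c : LCh D) :
    opr 𝒢 (R f c) = R f (H c) :=
  lin_ext_apply (F := opr 𝒢 ∘ₗ R f) (G := R f ∘ₗ H) (fun l => by
    change opr 𝒢 (R f (ls l)) = R f (H (ls l))
    rcases eq_or_ne l [] with rfl | hl
    · simp [h0]
    · obtain ⟨n, v, rfl⟩ := exists_ofFn hl
      rw [R_ofFn, opr_sx, ← h, R_lmap _ (isAff_comb v)]) c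

/-- The singular boundary. -/
def dd : Ch X →ₗ[ℚ] Ch X := opr fun n => bd (ls (iot n))

lemma dd_R (f : C(D, X)) (c : LCh D) : dd (R f c) = R f (bd c) :=
  opr_R (fun n v => by rw [lmap_bd, lmap_ls, map_iot]) (by simp) c

lemma dd_sx {n : ℕ} (σ : C(Dl n, X)) : dd (sx σ) = R σ (bd (ls (iot n))) := by simp [dd]

@[simp] lemma dd_dd (c : Ch X) : dd (dd c) = 0 :=
  sx_ext (F := dd ∘ₗ dd) (G := 0) (fun n σ => by
    change dd (dd (sx σ)) = 0
    rw [dd_sx, dd_R, bd_bd, map_zero]) c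

open Classical in
/-- A function on the simplex as a chain, zero if it is not continuous. -/
def sxd {n : ℕ} (u : Dl n → Y) : Ch Y := if h : Continuous u then sx ⟨u, h⟩ else 0

lemma sxd_eq {n : ℕ} {u : Dl n → Y} (h : Continuous u) : sxd u = sx ⟨u, h⟩ := by simp [sxd, h]

/-- Push-forward along a map, ignoring simplices on which it is not continuous. -/
def push (f : X → Y) : Ch X →ₗ[ℚ] Ch Y := lin fun σ => sxd fun t => f (σ.2 t)

lemma push_sx' (f : X → Y) {n : ℕ} (σ : C(Dl n, X)) : push f (sx σ) = sxd fun t => f (σ t) := by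
  simp [push]

lemma push_sx {f : X → Y} {n : ℕ} {σ : C(Dl n, X)} (h : Continuous fun t => f (σ t)) :
    push f (sx σ) = sx ⟨_, h⟩ := by
  rw [push_sx', sxd_eq h]

lemma push_R {f : X → Y} {g : C(D, X)} (h : Continuous fun t => f (g t)) (c : LCh D) :
    push f (R g c) = R ⟨_, h⟩ c :=
  lin_ext_apply (F := push f ∘ₗ R g) (G := R ⟨_, h⟩) (fun l => by
    change push f (R g (ls l)) = R ⟨_, h⟩ (ls l)
    rcases eq_or_ne l [] with rfl | hl
    · simp
    · obtain ⟨n, v, rfl⟩ := exists_ofFn hl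
      rw [R_ofFn, R_ofFn, push_sx (f := f) (h.comp (comb v).continuous)]
      rfl) c

/-- Chains supported in a subset. -/
def Cin (A : Set X) : Submodule ℚ (Ch X) :=
  Finsupp.supported ℚ ℚ {σ | ∀ t, σ.2 t ∈ A}

/-- Chains of a given degree. -/
def Deg (X : Type) [TopologicalSpace X] (j : ℤ) : Submodule ℚ (Ch X) :=
  Finsupp.supported ℚ ℚ {σ | (σ.1 : ℤ) = j}

lemma sx_mem_Cin {A : Set X} {n : ℕ} {σ : C(Dl n, X)} (h : ∀ t, σ t ∈ A) : sx σ ∈ Cin A :=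
  Finsupp.single_mem_supported _ _ h

lemma sx_mem_Deg {n : ℕ} (σ : C(Dl n, X)) : sx σ ∈ Deg X n :=
  Finsupp.single_mem_supported _ _ rfl

lemma map_mem_of_Cin {N : Type} [AddCommGroup N] [Module ℚ N] {A : Set X} {F : Ch X →ₗ[ℚ] N}
    {P : Submodule ℚ N} (h : ∀ n (σ : C(Dl n, X)), (∀ t, σ t ∈ A) → F (sx σ) ∈ P) {c : Ch X}
    (hc : c ∈ Cin A) : F c ∈ P :=
  map_mem_of_supported (fun σ hσ => h σ.1 σ.2 (by exact hσ)) hc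

lemma eq_of_Cin {N : Type} [AddCommGroup N] [Module ℚ N] {A : Set X} {F G : Ch X →ₗ[ℚ] N}
    (h : ∀ n (σ : C(Dl n, X)), (∀ t, σ t ∈ A) → F (sx σ) = G (sx σ)) {c : Ch X}
    (hc : c ∈ Cin A) : F c = G c := by
  have := map_mem_of_Cin (F := F - G) (P := ⊥) (fun n σ hσ => by simp [h n σ hσ]) hc
  simpa [sub_eq_zero] using this

lemma map_mem_of_Deg {N : Type} [AddCommGroup N] [Module ℚ N] {j : ℤ} {F : Ch X →ₗ[ℚ] N}
    {P : Submodule ℚ N} (h : ∀ n (σ : C(Dl n, X)), (n : ℤ) = j → F (sx σ) ∈ P) {c : Ch X}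
    (hc : c ∈ Deg X j) : F c ∈ P :=
  map_mem_of_supported (fun σ hσ => h σ.1 σ.2 hσ) hc

lemma eq_of_Deg {N : Type} [AddCommGroup N] [Module ℚ N] {j : ℤ} {F G : Ch X →ₗ[ℚ] N}
    (h : ∀ n (σ : C(Dl n, X)), (n : ℤ) = j → F (sx σ) = G (sx σ)) {c : Ch X}
    (hc : c ∈ Deg X j) : F c = G c := by
  have := map_mem_of_Deg (F := F - G) (P := ⊥) (fun n σ hσ => by simp [h n σ hσ]) hc
  simpa [sub_eq_zero] using this

lemma R_mem_Cin {f : C(D, X)} {A : Set X} (h : ∀ t, f t ∈ A) (c : LCh D) : R f c ∈ Cin A := by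
  refine map_mem_of_supported (s := Set.univ) (fun l _ => ?_) (by simp)
  change R f (ls l) ∈ _
  rcases eq_or_ne l [] with rfl | hl
  · simp
  · obtain ⟨n, v, rfl⟩ := exists_ofFn hl
    rw [R_ofFn]
    exact sx_mem_Cin fun t => h _

lemma R_mem_Deg (f : C(D, X)) {n : ℕ} {c : LCh D} (hc : c ∈ LDeg D n) :
    R f c ∈ Deg X (n - 1) := by
  refine map_mem_of_supported (fun l hl => ?_) hc
  change R f (ls l) ∈ _
  rcases eq_or_ne l [] with rfl | hl'
  · simp
  · obtain ⟨m, v, rfl⟩ := exists_ofFn hl'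
    rw [R_ofFn]
    have : n = m + 1 := by simpa using hl.symm
    subst this
    simpa using sx_mem_Deg (f.comp (comb v))

lemma dd_Cin {A : Set X} {c : Ch X} (hc : c ∈ Cin A) : dd c ∈ Cin A :=
  map_mem_of_Cin (fun n σ h => by rw [dd_sx]; exact R_mem_Cin h _) hc

lemma iot_mem (n : ℕ) : ls (iot n) ∈ LDeg (Dl n) (n + 1) := by
  simpa [iot] using ls_mem_LDeg (iot n)

lemma dd_Deg {j : ℤ} {c : Ch X} (hc : c ∈ Deg X j) : dd c ∈ Deg X (j - 1) :=
  map_mem_of_Deg (fun n σ h => by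
    rw [dd_sx, ← h]; exact R_mem_Deg σ (bd_mem (iot_mem n))) hc

lemma push_Cin {f : X → Y} {A : Set X} {B : Set Y} (hf : Set.MapsTo f A B) {c : Ch X}
    (hc : c ∈ Cin A) : push f c ∈ Cin B := by
  refine map_mem_of_Cin (fun n σ h => ?_) hc
  by_cases h' : Continuous fun t => f (σ t)
  · rw [push_sx h']; exact sx_mem_Cin fun t => hf (h t)
  · simp [push_sx', sxd, h']

lemma push_Deg (f : X → Y) {j : ℤ} {c : Ch X} (hc : c ∈ Deg X j) : push f c ∈ Deg Y j := by
  refine map_mem_of_Deg (fun n σ h => ?_) hc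
  by_cases h' : Continuous fun t => f (σ t)
  · rw [push_sx h', ← h]; exact sx_mem_Deg _
  · simp [push_sx', sxd, h']

lemma continuous_comp_of_Cin {f : X → Y} {A : Set X} (hf : ContinuousOn f A) {n : ℕ}
    {σ : C(Dl n, X)} (h : ∀ t, σ t ∈ A) : Continuous fun t => f (σ t) :=
  hf.comp_continuous σ.continuous h

lemma dd_push {f : X → Y} {A : Set X} (hf : ContinuousOn f A) {c : Ch X} (hc : c ∈ Cin A) :
    dd (push f c) = push f (dd c) :=
  eq_of_Cin (F := dd ∘ₗ push f) (G := push f ∘ₗ dd) (fun n σ h => by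
    have h' := continuous_comp_of_Cin hf h
    change dd (push f (sx σ)) = push f (dd (sx σ))
    rw [push_sx h', dd_sx, dd_sx, push_R h']) hc

lemma push_push {f : X → Y} {g : Y → Z} {A : Set X} (hf : ContinuousOn f A) {c : Ch X}
    (hc : c ∈ Cin A) : push g (push f c) = push (fun x => g (f x)) c :=
  eq_of_Cin (F := push g ∘ₗ push f) (G := push fun x => g (f x)) (fun n σ h => by
    have h' := continuous_comp_of_Cin hf h
    change push g (push f (sx σ)) = _
    rw [push_sx h', push_sx', push_sx']
    rfl) hc

lemma push_congr {f g : X → Y} {A : Set X} (h : ∀ x ∈ A, f x = g x) {c : Ch X}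
    (hc : c ∈ Cin A) : push f c = push g c :=
  eq_of_Cin (fun n σ hσ => by
    have : (fun t => f (σ t)) = fun t => g (σ t) := funext fun t => h _ (hσ t)
    rw [push_sx', push_sx', this]) hc

lemma push_id (c : Ch X) : push (fun x => x) c = c :=
  sx_ext (F := push _) (G := LinearMap.id) (fun n σ => by
    rw [push_sx σ.continuous]; rfl) c

lemma Cin_mono {A B : Set X} (h : A ⊆ B) : Cin A ≤ Cin B :=
  Finsupp.supported_mono fun _ hσ t => h (hσ t)

lemma Cin_inter (A B : Set X) : Cin (A ∩ B) = Cin A ⊓ Cin B := by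
  rw [Cin, Cin, Cin, ← Finsupp.supported_inter]
  congr 1
  ext σ
  exact forall_and

@[simp] lemma Cin_univ : Cin (Set.univ : Set X) = ⊤ := by
  simp [Cin]

@[simp] lemma Cin_empty : Cin (∅ : Set X) = ⊥ := by
  have : {σ : Sx X | ∀ t, σ.2 t ∈ (∅ : Set X)} = ∅ := by
    ext σ; simp
  rw [Cin, this, Finsupp.supported_empty]

end

end

section

open Cvx

/-! ### Subdivision -/

section
variable {D D' : Type} [TopologicalSpace D] [Cvx D] [TopologicalSpace D'] [Cvx D']
  {X Y Z : Type} [TopologicalSpace X] [TopologicalSpace Y] [TopologicalSpace Z]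

/-- The homotopy between the identity and barycentric subdivision on list chains. -/
def Tl : LCh D →ₗ[ℚ] LCh D := coneRec ls bary

/-- Barycentric subdivision on list chains. -/
def Sl : LCh D →ₗ[ℚ] LCh D := LinearMap.id - bd ∘ₗ Tl - Tl ∘ₗ bd

lemma Sl_apply (c : LCh D) : Sl c = c - bd (Tl c) - Tl (bd c) := rfl

lemma Sl_nil : Sl (ls ([] : List D)) = ls [] := by simp [Sl_apply, Tl]

lemma Sl_cons (a : D) (l : List D) :
    Sl (ls (a :: l)) = cone (bary a l) (Sl (bd (ls (a :: l)))) := by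
  have h : Tl (ls (a :: l)) = cone (bary a l) (ls (a :: l) - Tl (bd (ls (a :: l)))) :=
    coneRec_cons _ _ _ _
  rw [Sl_apply, Sl_apply, h, bd_cone, bd_bd]
  simp only [map_sub, map_zero, sub_zero]
  abel

lemma lmap_Tl {φ : C(D, D')} (hφ : IsAff φ) (c : LCh D) : lmap φ (Tl c) = Tl (lmap φ c) :=
  coneRec_natural _ φ φ (fun l => lmap_ls _ l) (fun a l => map_bary hφ a l) c

lemma lmap_Sl {φ : C(D, D')} (hφ : IsAff φ) (c : LCh D) : lmap φ (Sl c) = Sl (lmap φ c) := by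
  simp only [Sl_apply, map_sub, lmap_bd, lmap_Tl hφ]

lemma Tl_mem {n : ℕ} {c : LCh D} (hc : c ∈ LDeg D n) : Tl c ∈ LDeg D (n + 1) :=
  coneRec_mem _ ls_mem_LDeg hc

lemma Sl_mem {n : ℕ} {c : LCh D} (hc : c ∈ LDeg D (n + 1)) : Sl c ∈ LDeg D (n + 1) :=
  Submodule.sub_mem _ (Submodule.sub_mem _ hc (bd_mem (Tl_mem hc))) (Tl_mem (bd_mem hc))

/-- Barycentric subdivision of singular chains. -/
def SS : Ch X →ₗ[ℚ] Ch X := opr fun n => Sl (ls (iot n))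

/-- The homotopy between the identity and barycentric subdivision. -/
def TT : Ch X →ₗ[ℚ] Ch X := opr fun n => Tl (ls (iot n))

lemma TT_R (f : C(D, X)) (c : LCh D) : TT (R f c) = R f (Tl c) :=
  opr_R (fun n v => by rw [lmap_Tl (isAff_comb v), lmap_ls, map_iot]) (by simp [Tl]) c

lemma SS_R (f : C(D, X)) (c : LCh D) : SS (R f c) = R f (Sl c) :=
  opr_R (fun n v => by rw [lmap_Sl (isAff_comb v), lmap_ls, map_iot]) (by simp [Sl_nil]) c

lemma SS_sx {n : ℕ} (σ : C(Dl n, X)) : SS (sx σ) = R σ (Sl (ls (iot n))) := by simp [SS]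

lemma dd_TT (c : Ch X) : dd (TT c) + TT (dd c) = c - SS c :=
  sx_ext (F := dd ∘ₗ TT + TT ∘ₗ dd) (G := LinearMap.id - SS) (fun n σ => by
    change dd (TT (sx σ)) + TT (dd (sx σ)) = sx σ - SS (sx σ)
    rw [dd_sx, TT_R, SS_sx, TT, opr_sx, dd_R, ← R_iot σ, ← map_add, ← map_sub, Sl_apply]
    congr 1
    abel) c

lemma dd_SS (c : Ch X) : dd (SS c) = SS (dd c) := by
  have h1 := congrArg dd (dd_TT c)
  have h2 := dd_TT (dd c)
  simp only [map_add, map_sub, dd_dd, map_zero, zero_add, add_zero] at h1 h2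
  rw [h1] at h2
  exact sub_right_injective h2

lemma opr_Cin (𝒢 : ∀ n, LCh (Dl n)) {A : Set X} {c : Ch X} (hc : c ∈ Cin A) :
    opr 𝒢 c ∈ Cin A :=
  map_mem_of_Cin (fun n σ h => by rw [opr_sx]; exact R_mem_Cin h _) hc

lemma SS_Cin {A : Set X} {c : Ch X} (hc : c ∈ Cin A) : SS c ∈ Cin A := opr_Cin _ hc

lemma TT_Cin {A : Set X} {c : Ch X} (hc : c ∈ Cin A) : TT c ∈ Cin A := opr_Cin _ hc

lemma TT_Deg {j : ℤ} {c : Ch X} (hc : c ∈ Deg X j) : TT c ∈ Deg X (j + 1) :=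
  map_mem_of_Deg (fun n σ h => by
    rw [TT, opr_sx, ← h]
    simpa using R_mem_Deg σ (Tl_mem (iot_mem n))) hc

lemma SS_Deg {j : ℤ} {c : Ch X} (hc : c ∈ Deg X j) : SS c ∈ Deg X j :=
  map_mem_of_Deg (fun n σ h => by
    rw [SS, opr_sx, ← h]
    simpa using R_mem_Deg σ (Sl_mem (iot_mem n))) hc

lemma SS_pow_Cin {A : Set X} {c : Ch X} (hc : c ∈ Cin A) (N : ℕ) : (SS ^ N) c ∈ Cin A := by
  induction N with
  | zero => simpa
  | succ N ih => rw [pow_succ']; exact SS_Cin ih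

lemma SS_pow_Deg {j : ℤ} {c : Ch X} (hc : c ∈ Deg X j) (N : ℕ) : (SS ^ N) c ∈ Deg X j := by
  induction N with
  | zero => simpa
  | succ N ih => rw [pow_succ']; exact SS_Deg ih

lemma dd_SS_pow (c : Ch X) (N : ℕ) : dd ((SS ^ N) c) = (SS ^ N) (dd c) := by
  induction N with
  | zero => simp
  | succ N ih =>
    rw [pow_succ']
    change dd (SS ((SS ^ N) c)) = SS ((SS ^ N) (dd c))
    rw [dd_SS, ih]

lemma exists_SS_homotopy (N : ℕ) : ∃ H : Ch X →ₗ[ℚ] Ch X,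
    (∀ c, dd (H c) + H (dd c) = c - (SS ^ N) c) ∧ (∀ A c, c ∈ Cin A → H c ∈ Cin A) ∧
    ∀ j c, c ∈ Deg X j → H c ∈ Deg X (j + 1) := by
  induction N with
  | zero => exact ⟨0, by simp, by simp, by simp⟩
  | succ N ih =>
    obtain ⟨H, h1, h2, h3⟩ := ih
    refine ⟨H + TT ∘ₗ (SS ^ N), fun c => ?_, fun A c hc => ?_, fun j c hc => ?_⟩
    · have h4 := h1 c
      have h5 := dd_TT ((SS ^ N) c)
      rw [dd_SS_pow] at h5
      simp only [LinearMap.add_apply, LinearMap.comp_apply, map_add, pow_succ', Module.End.mul_apply]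
      rw [add_add_add_comm, h4, h5]
      abel
    · exact Submodule.add_mem _ (h2 A c hc) (TT_Cin (SS_pow_Cin hc N))
    · exact Submodule.add_mem _ (h3 j c hc) (TT_Deg (SS_pow_Deg hc N))

/-! ### Mesh estimates -/

lemma bd_sublist (l : List D) : bd (ls l) ∈
    Finsupp.supported ℚ ℚ {l' : List D | l' ⊆ l ∧ l'.length + 1 = l.length} := by
  induction l with
  | nil => simp
  | cons a l ih =>
    rw [bd_cons]
    refine Submodule.sub_mem _ (Finsupp.single_mem_supported _ _ (by simp)) ?_
    refine lin_mem_of_supported (fun l' hl' => Finsupp.single_mem_supported _ _ ?_) ih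
    obtain ⟨h1, h2⟩ := hl'
    exact ⟨List.cons_subset_cons _ h1, by simpa using h2⟩

/-- Lists with entries in `K`, of length `k`, with distances at most `δ`. -/
def meshSet (n : ℕ) (K : Set (Fin (n + 1) → ℝ)) (k : ℕ) (δ : ℝ) : Set (List (Dl n)) :=
  {l | (∀ x ∈ l, x.1 ∈ K) ∧ l.length = k ∧ ∀ x ∈ l, ∀ y ∈ l, dist x.1 y.1 ≤ δ}

lemma comb_mem_convex {n m : ℕ} {K : Set (Fin (n + 1) → ℝ)} (hK : Convex ℝ K)
    {v : Fin (m + 1) → Dl n} (hv : ∀ i, (v i).1 ∈ K) (t : Dl m) : (comb v t).1 ∈ K :=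
  hK.sum_mem (fun i _ => t.2.1 i) t.2.2 (fun i _ => hv i)

lemma dist_bary_le {n : ℕ} {a : Dl n} {l : List (Dl n)} {δ : ℝ}
    (h : ∀ x ∈ a :: l, ∀ y ∈ a :: l, dist x.1 y.1 ≤ δ) {x : Dl n} (hx : x ∈ a :: l) :
    dist (bary a l).1 x.1 ≤ l.length / (l.length + 1) * δ := by
  obtain ⟨i₀, rfl⟩ := List.mem_iff_get.1 hx
  set v := (a :: l).get
  have e1 : (bary a l).1 = ∑ i, ((1 : ℝ) / (l.length + 1)) • (v i).1 := by
    change ∑ i, (stdSimplex.barycenter : Dl l.length) i • (v i).1 = _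
    refine Finset.sum_congr rfl fun i _ => ?_
    congr 1
    refine (stdSimplex.barycenter_apply (𝕜 := ℝ) (i : Fin (l.length + 1))).trans ?_
    simp
  have e2 : (bary a l).1 - (v i₀).1 =
      ∑ i, ((1 : ℝ) / (l.length + 1)) • ((v i).1 - (v i₀).1) := by
    rw [e1]
    simp only [smul_sub, Finset.sum_sub_distrib, Finset.sum_const, Finset.card_univ,
      Fintype.card_fin]
    congr 1
    rw [← Nat.cast_smul_eq_nsmul ℝ, smul_smul, List.length_cons]
    push_cast
    rw [mul_one_div_cancel (by positivity), one_smul]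
  rw [dist_eq_norm, e2]
  refine (norm_sum_le _ _).trans ?_
  rw [← Finset.sum_erase Finset.univ (a := i₀) (by simp)]
  refine (Finset.sum_le_card_nsmul _ _ (1 / (l.length + 1) * δ) fun i _ => ?_).trans ?_
  · rw [norm_smul, ← dist_eq_norm, Real.norm_of_nonneg (by positivity)]
    exact mul_le_mul_of_nonneg_left (h _ (List.get_mem _ _) _ (List.get_mem _ _)) (by positivity)
  · rw [Finset.card_erase_of_mem (Finset.mem_univ _)]
    simp
    apply le_of_eq
    ring

set_option maxHeartbeats 400000 in
lemma Sl_mesh {n : ℕ} (k : ℕ) : ∀ (K : Set (Fin (n + 1) → ℝ)) (δ : ℝ), Convex ℝ K → 0 ≤ δ →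
    ∀ l ∈ meshSet n K (k + 1) δ,
      Sl (ls l) ∈ Finsupp.supported ℚ ℚ (meshSet n K (k + 1) (k / (k + 1) * δ)) := by
  induction k with
  | zero =>
    rintro K δ hK hδ l ⟨h1, h2, h3⟩
    obtain ⟨x, rfl⟩ := List.length_eq_one_iff.1 h2
    rw [Sl_cons]
    have : Sl (bd (ls [x])) = ls [] := by rw [bd_cons]; simp [Sl_nil]
    rw [this, cone_ls]
    refine Finsupp.single_mem_supported _ _ ⟨?_, rfl, ?_⟩
    · intro y hy
      obtain rfl : y = bary x [] := by simpa using hy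
      exact comb_mem_convex hK (fun i => h1 _ (List.get_mem _ i)) _
    · intro y hy z hz
      simp only [List.mem_singleton] at hy hz
      subst hy hz
      simp
  | succ k ih =>
    rintro K δ hK hδ l ⟨h1, h2, h3⟩
    obtain ⟨a, l, rfl⟩ : ∃ a l', l = a :: l' := List.exists_cons_of_length_eq_add_one h2
    have hlen : l.length = k + 1 := by simpa using h2
    rw [Sl_cons]
    set K' : Set (Fin (n + 1) → ℝ) :=
      K ∩ Metric.closedBall (bary a l).1 (((k + 1 : ℕ) : ℝ) / ((k + 1 : ℕ) + 1) * δ)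
    have hK' : Convex ℝ K' := hK.inter (convex_closedBall _ _)
    have h4 : Sl (bd (ls (a :: l))) ∈
        Finsupp.supported ℚ ℚ (meshSet n K' (k + 1) (k / (k + 1) * δ)) := by
      refine map_mem_of_supported (fun l' hl' => ?_) (bd_sublist (a :: l))
      refine ih K' δ hK' hδ l' ⟨fun x hx => ⟨h1 x (hl'.1 hx), ?_⟩, ?_,
        fun x hx y hy => h3 x (hl'.1 hx) y (hl'.1 hy)⟩
      · rw [Metric.mem_closedBall, dist_comm, ← hlen]
        exact dist_bary_le h3 (hl'.1 hx)
      · have := hl'.2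
        rw [h2] at this
        omega
    have hle : (k : ℝ) / (k + 1) * δ ≤ ((k + 1 : ℕ) : ℝ) / ((k + 1 : ℕ) + 1) * δ := by
      refine mul_le_mul_of_nonneg_right ?_ hδ
      push_cast
      rw [div_le_div_iff₀ (by positivity) (by positivity)]
      nlinarith
    refine lin_mem_of_supported (fun l' hl' => Finsupp.single_mem_supported _ _ ?_) h4
    obtain ⟨g1, g2, g3⟩ := hl'
    have hb : (bary a l).1 ∈ K :=
      comb_mem_convex hK (fun i => h1 _ (List.get_mem _ i)) _
    refine ⟨?_, by simp [g2], ?_⟩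
    · intro x hx
      rcases List.mem_cons.1 hx with rfl | hx
      · exact hb
      · exact (g1 x hx).1
    · have hc : ∀ x ∈ l', dist x.1 (bary a l).1 ≤ ((k + 1 : ℕ) : ℝ) / ((k + 1 : ℕ) + 1) * δ :=
        fun x hx => (g1 x hx).2
      intro x hx y hy
      rcases List.mem_cons.1 hx with rfl | hx <;> rcases List.mem_cons.1 hy with rfl | hy
      · rw [dist_self]; positivity
      · rw [dist_comm]; exact hc y hy
      · exact hc x hx
      · exact (g3 x hx y hy).trans hle

lemma Sl_pow_mesh (n N : ℕ) : (Sl ^ N) (ls (iot n)) ∈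
    Finsupp.supported ℚ ℚ (meshSet n Set.univ (n + 1) (((n : ℝ) / (n + 1)) ^ N)) := by
  induction N with
  | zero =>
    refine Finsupp.single_mem_supported _ _ ⟨by simp, by simp [iot], fun x _ y _ => ?_⟩
    rw [pow_zero]
    refine (dist_pi_le_iff zero_le_one).2 fun i => ?_
    have := mem_Icc_of_mem_stdSimplex x.2 i
    have := mem_Icc_of_mem_stdSimplex y.2 i
    rw [Real.dist_eq, abs_le]
    constructor <;> linarith [this.1, this.2, (mem_Icc_of_mem_stdSimplex x.2 i).1,
      (mem_Icc_of_mem_stdSimplex x.2 i).2]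
  | succ N ih =>
    rw [pow_succ', pow_succ', Module.End.mul_apply]
    refine map_mem_of_supported (fun l hl => ?_) ih
    exact Sl_mesh n _ _ convex_univ (by positivity) l hl

lemma SS_pow_R (f : C(D, X)) (c : LCh D) (N : ℕ) : (SS ^ N) (R f c) = R f ((Sl ^ N) c) := by
  induction N with
  | zero => simp
  | succ N ih =>
    rw [pow_succ', pow_succ']
    change SS ((SS ^ N) _) = R f (Sl ((Sl ^ N) c))
    rw [ih, SS_R]

/-- Iterated subdivision makes chains small with respect to an open cover. -/
theorem small_chains_sx {A B : Set X} (hA : IsOpen A) (hB : IsOpen B) {n : ℕ} (σ : C(Dl n, X))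
    (h : ∀ t, σ t ∈ A ∪ B) : ∃ N, (SS ^ N) (sx σ) ∈ Cin A ⊔ Cin B := by
  obtain ⟨δ, hδ, H⟩ := lebesgue_number_lemma_of_metric (s := (Set.univ : Set (Dl n)))
    (c := fun b : Bool => σ ⁻¹' (cond b A B)) isCompact_univ
    (fun b => by cases b <;> exact IsOpen.preimage σ.continuous (by assumption))
    (fun t _ => by
      rcases h t with h | h
      · exact Set.mem_iUnion.2 ⟨true, h⟩
      · exact Set.mem_iUnion.2 ⟨false, h⟩)
  obtain ⟨N, hN⟩ := exists_pow_lt_of_lt_one hδ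
    (show (n : ℝ) / (n + 1) < 1 from (div_lt_one (by positivity)).2 (by linarith))
  refine ⟨N, ?_⟩
  rw [← R_iot, SS_pow_R]
  refine map_mem_of_supported (fun l hl => ?_) (Sl_pow_mesh n N)
  change R σ (ls l) ∈ _
  obtain ⟨-, hl2, hl3⟩ := hl
  obtain ⟨m, v, rfl⟩ := exists_ofFn (l := l) (by rintro rfl; simp at hl2)
  rw [R_ofFn]
  have hball : ∀ t, comb v t ∈ Metric.ball (v 0) δ := fun t => by
    refine lt_of_le_of_lt ?_ hN
    exact comb_mem_convex (convex_closedBall (v 0).1 _)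
      (fun i => hl3 _ (List.mem_ofFn.2 ⟨i, rfl⟩) _ (List.mem_ofFn.2 ⟨0, rfl⟩)) t
  obtain ⟨b, hb⟩ := H (v 0) trivial
  cases b
  · exact Submodule.mem_sup_right (sx_mem_Cin fun t => hb (hball t))
  · exact Submodule.mem_sup_left (sx_mem_Cin fun t => hb (hball t))

lemma SS_pow_sup {A B : Set X} {c : Ch X} (hc : c ∈ Cin A ⊔ Cin B) (N : ℕ) :
    (SS ^ N) c ∈ Cin A ⊔ Cin B := by
  obtain ⟨a, ha, b, hb, rfl⟩ := Submodule.mem_sup.1 hc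
  rw [map_add]
  exact Submodule.add_mem_sup (SS_pow_Cin ha N) (SS_pow_Cin hb N)

theorem small_chains {A B : Set X} (hA : IsOpen A) (hB : IsOpen B) {c : Ch X}
    (hc : c ∈ Cin (A ∪ B)) : ∃ N, ∀ N' ≥ N, (SS ^ N') c ∈ Cin A ⊔ Cin B := by
  have key : ∃ N, (SS ^ N) c ∈ Cin A ⊔ Cin B := by
    rw [Cin, Finsupp.supported_eq_span_single] at hc
    induction hc using Submodule.span_induction with
    | mem x hx =>
      obtain ⟨σ, hσ, rfl⟩ := hx
      exact small_chains_sx hA hB σ.2 hσ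
    | zero => exact ⟨0, by simp⟩
    | add x y _ _ hx hy =>
      obtain ⟨N, hN⟩ := hx
      obtain ⟨N', hN'⟩ := hy
      refine ⟨N + N', ?_⟩
      rw [map_add]
      refine Submodule.add_mem _ ?_ ?_
      · rw [add_comm, pow_add]; exact SS_pow_sup hN N'
      · rw [pow_add]; exact SS_pow_sup hN' N
    | smul r x _ hx =>
      obtain ⟨N, hN⟩ := hx
      exact ⟨N, by rw [map_smul]; exact Submodule.smul_mem _ _ hN⟩
  obtain ⟨N, hN⟩ := key
  refine ⟨N, fun N' h => ?_⟩
  obtain ⟨k, rfl⟩ := Nat.exists_eq_add_of_le' h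
  rw [pow_add]
  exact SS_pow_sup hN k

end

end

section

open Cvx

/-! ### Homotopies -/

section
variable {D D' : Type} [TopologicalSpace D] [Cvx D] [TopologicalSpace D'] [Cvx D']
  {X Y Z : Type} [TopologicalSpace X] [TopologicalSpace Y] [TopologicalSpace Z]

/-- The difference of the two end inclusions on lists. -/
def endl (l : List D) : LCh (D × unitInterval) :=
  ls (l.map fun x => (x, 1)) - ls (l.map fun x => (x, 0))

/-- The prism operator on list chains. -/
def Pl : LCh D →ₗ[ℚ] LCh (D × unitInterval) := coneRec endl fun a _ => (a, 0)

lemma lin_endl (c : LCh D) :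
    lin endl c = lmap (fun x => (x, 1)) c - lmap (fun x => (x, 0)) c :=
  lin_ext_apply (F := lin endl) (G := lmap (fun x => (x, 1)) - lmap (fun x => (x, 0)))
    (fun l => by
      change lin endl (ls l) = lmap _ (ls l) - lmap _ (ls l)
      simp [endl]) c

lemma bd_Pl (c : LCh D) : bd (Pl c) =
    lmap (fun x => (x, 1)) c - lmap (fun x => (x, 0)) c - Pl (bd c) := by
  rw [Pl, bd_coneRec, lin_endl]
  · intro c
    rw [lin_endl, lin_endl, map_sub, lmap_bd, lmap_bd]
  · simp [endl]

lemma Pl_mem {n : ℕ} {c : LCh D} (hc : c ∈ LDeg D n) : Pl c ∈ LDeg (D × unitInterval) (n + 1) :=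
  coneRec_mem _ (fun l => Submodule.sub_mem _
    (by simpa using ls_mem_LDeg (l.map fun x => (x, (1 : unitInterval))))
    (by simpa using ls_mem_LDeg (l.map fun x => (x, (0 : unitInterval))))) hc

lemma comb_const {n : ℕ} (c : D) (t : Dl n) : comb (fun _ => c) t = c := by
  have h := comb_comb (fun _ : Fin (0 + 1) => c) (fun _ : Fin (n + 1) => stdSimplex.vertex 0) t
  simp only [comb_vertex] at h
  rw [← h, Subsingleton.elim (α := Dl 0) (convComb _ _ t) (stdSimplex.vertex 0), comb_vertex]

lemma isAff_prodMk_const (c : D') :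
    IsAff (⟨fun x => (x, c), by fun_prop⟩ : C(D, D × D')) := fun _ t =>
  Prod.ext rfl (comb_const c t).symm

lemma isAff_id : IsAff (ContinuousMap.id D) := fun _ _ => rfl

lemma isAff_prodMap {E E' : Type} [TopologicalSpace E] [Cvx E] [TopologicalSpace E'] [Cvx E']
    {φ : C(D, E)} {ψ : C(D', E')} (hφ : IsAff φ) (hψ : IsAff ψ) : IsAff (φ.prodMap ψ) :=
  fun v t => Prod.ext (hφ (fun i => (v i).1) t) (hψ (fun i => (v i).2) t)

lemma lmap_Pl {φ : D → D'} (c : LCh D) : lmap (Prod.map φ id) (Pl c) = Pl (lmap φ c) :=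
  coneRec_natural _ φ (Prod.map φ id) (fun l => by
    simp [endl, Function.comp_def]) (fun a l => rfl) c

open Classical in
/-- The chain homotopy induced by a homotopy. -/
def hP (H : X → unitInterval → Y) : Ch X →ₗ[ℚ] Ch Y := lin fun σ =>
  if h : Continuous fun p : Dl σ.1 × unitInterval => H (σ.2 p.1) p.2 then
    R ⟨_, h⟩ (Pl (ls (iot σ.1))) else 0

lemma hP_sx {H : X → unitInterval → Y} {n : ℕ} {σ : C(Dl n, X)}
    (h : Continuous fun p : Dl n × unitInterval => H (σ p.1) p.2) :
    hP H (sx σ) = R ⟨_, h⟩ (Pl (ls (iot n))) := by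
  simp only [hP, lin_sx]
  rw [dif_pos h]

lemma hP_R {H : X → unitInterval → Y} {f : C(D, X)}
    (h : Continuous fun p : D × unitInterval => H (f p.1) p.2) (c : LCh D) :
    hP H (R f c) = R ⟨_, h⟩ (Pl c) :=
  lin_ext_apply (F := hP H ∘ₗ R f) (G := R ⟨_, h⟩ ∘ₗ Pl) (fun l => by
    change hP H (R f (ls l)) = R ⟨_, h⟩ (Pl (ls l))
    rcases eq_or_ne l [] with rfl | hl
    · simp [Pl]
    · obtain ⟨n, v, rfl⟩ := exists_ofFn hl
      have h' : Continuous fun p : Dl n × unitInterval => H (f.comp (comb v) p.1) p.2 :=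
        h.comp ((comb v).continuous.prodMap continuous_id)
      have h2 := R_lmap (⟨_, h⟩ : C(D × unitInterval, Y))
        (isAff_prodMap (isAff_comb v) isAff_id) (Pl (ls (iot n)))
      have h3 : ⇑((comb v).prodMap (ContinuousMap.id unitInterval)) = Prod.map (comb v) id := rfl
      rw [h3] at h2
      rw [R_ofFn, hP_sx h', ← map_iot, ← lmap_ls, ← lmap_Pl]
      refine Eq.trans ?_ h2.symm
      rfl) c

lemma hP_continuous {H : X → unitInterval → Y} {A : Set X}
    (hH : ContinuousOn (fun p : X × unitInterval => H p.1 p.2) (A ×ˢ Set.univ)) {n : ℕ}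
    {σ : C(Dl n, X)} (h : ∀ t, σ t ∈ A) :
    Continuous fun p : Dl n × unitInterval => H (σ p.1) p.2 :=
  hH.comp_continuous (f := fun p : Dl n × unitInterval => (σ p.1, p.2))
    (by fun_prop) (fun p => ⟨h p.1, trivial⟩)

/-- The prism formula. -/
theorem dd_hP {H : X → unitInterval → Y} {A : Set X}
    (hH : ContinuousOn (fun p : X × unitInterval => H p.1 p.2) (A ×ˢ Set.univ)) {c : Ch X}
    (hc : c ∈ Cin A) :
    dd (hP H c) + hP H (dd c) = push (fun x => H x 1) c - push (fun x => H x 0) c :=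
  eq_of_Cin (F := dd ∘ₗ hP H + hP H ∘ₗ dd)
    (G := push (fun x => H x 1) - push (fun x => H x 0)) (fun n σ hσ => by
    have h := hP_continuous hH hσ
    have h1 (s : unitInterval) : Continuous fun t => H (σ t) s :=
      h.comp (continuous_id.prodMk continuous_const)
    have h2 (s : unitInterval) : R ⟨_, h⟩ (lmap (fun x => (x, s)) (ls (iot n))) =
        push (fun x => H x s) (sx σ) := by
      rw [push_sx (h1 s), ← R_iot]
      exact R_lmap _ (isAff_prodMk_const s) _
    change dd (hP H (sx σ)) + hP H (dd (sx σ)) = push _ (sx σ) - push _ (sx σ)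
    rw [hP_sx h, dd_R, bd_Pl, dd_sx, hP_R h, ← h2, ← h2]
    simp only [map_sub]
    abel) hc

lemma hP_Cin {H : X → unitInterval → Y} {A : Set X} {B : Set Y}
    (hAB : ∀ x ∈ A, ∀ t, H x t ∈ B) {c : Ch X} (hc : c ∈ Cin A) : hP H c ∈ Cin B := by
  refine map_mem_of_Cin (fun n σ hσ => ?_) hc
  by_cases h : Continuous fun p : Dl n × unitInterval => H (σ p.1) p.2
  · rw [hP_sx h]
    exact R_mem_Cin (fun t => hAB _ (hσ _) _) _
  · simp only [hP, lin_sx]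
    rw [dif_neg h]
    exact zero_mem _

lemma hP_Deg (H : X → unitInterval → Y) {j : ℤ} {c : Ch X} (hc : c ∈ Deg X j) :
    hP H c ∈ Deg Y (j + 1) := by
  refine map_mem_of_Deg (fun n σ hσ => ?_) hc
  by_cases h : Continuous fun p : Dl n × unitInterval => H (σ p.1) p.2
  · rw [hP_sx h, ← hσ]
    simpa using R_mem_Deg (⟨_, h⟩ : C(Dl n × unitInterval, Y)) (Pl_mem (iot_mem n))
  · simp only [hP, lin_sx]
    rw [dif_neg h]
    exact zero_mem _

/-! ### Relative cycles -/

/-- Every cycle of the pair `(W, A)` in degree `j` is a boundary modulo `F`. -/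
def GV (j : ℤ) (W A : Set X) (F : Submodule ℚ (Ch X)) : Prop :=
  ∀ c ∈ Deg X j, c ∈ Cin W → dd c ∈ Cin A →
    ∃ e ∈ Deg X (j + 1), e ∈ Cin W ∧ ∃ f ∈ F, f ∈ Deg X j ∧ c - dd e - f ∈ Cin A

/-- The homology of the pair `(W, A)` vanishes in degree `j`. -/
def HV (j : ℤ) (W A : Set X) : Prop := GV j W A ⊥

lemma HV_iff {j : ℤ} {W A : Set X} : HV j W A ↔ ∀ c ∈ Deg X j, c ∈ Cin W → dd c ∈ Cin A →
    ∃ e ∈ Deg X (j + 1), e ∈ Cin W ∧ c - dd e ∈ Cin A := by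
  refine forall₄_congr fun c _ _ _ => exists_congr fun e => and_congr_right fun _ =>
    and_congr_right fun _ => ⟨?_, fun h => ⟨0, rfl, zero_mem _, by simpa⟩⟩
  rintro ⟨f, rfl, -, h⟩
  simpa using h

lemma GV.mono {j : ℤ} {W A : Set X} {F G : Submodule ℚ (Ch X)} (h : GV j W A F) (hFG : F ≤ G) :
    GV j W A G := fun c h1 h2 h3 => by
  obtain ⟨e, he, he', f, hf, h⟩ := h c h1 h2 h3
  exact ⟨e, he, he', f, hFG hf, h⟩

lemma GV_self (j : ℤ) (A : Set X) (F : Submodule ℚ (Ch X)) : GV j A A F := fun c _ h _ =>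
  ⟨0, zero_mem _, zero_mem _, 0, zero_mem _, zero_mem _, by simpa⟩

lemma Deg_of_neg {j : ℤ} (hj : j < 0) {c : Ch X} (hc : c ∈ Deg X j) : c = 0 := by
  have := map_mem_of_Deg (F := LinearMap.id) (P := ⊥) (fun n σ h => by omega) hc
  simpa using this

lemma HV_of_neg {j : ℤ} (hj : j < 0) (W A : Set X) : HV j W A := HV_iff.2 fun c h1 _ _ =>
  ⟨0, zero_mem _, zero_mem _, by simp [Deg_of_neg hj h1]⟩

lemma split_sup {A B : Set X} {c : Ch X} (hc : c ∈ Cin A ⊔ Cin B) :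
    ∃ a b, a ∈ Cin A ∧ b ∈ Cin B ∧ c = a + b ∧
      (∀ W, c ∈ Cin W → a ∈ Cin W ∧ b ∈ Cin W) ∧ ∀ j, c ∈ Deg X j → a ∈ Deg X j ∧ b ∈ Deg X j := by
  classical
  rw [Cin, Cin, ← Finsupp.supported_union] at hc
  set P : Sx X → Prop := fun σ => ∀ t, σ.2 t ∈ A
  have h1 : ∀ s : Set (Sx X), c ∈ Finsupp.supported ℚ ℚ s →
      c.filter P ∈ Finsupp.supported ℚ ℚ s ∧ c.filter (fun σ => ¬ P σ) ∈ Finsupp.supported ℚ ℚ s :=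
    fun s hs => ⟨fun σ hσ => hs (by simp at hσ ⊢; tauto), fun σ hσ => hs (by simp at hσ ⊢; tauto)⟩
  refine ⟨c.filter P, c.filter fun σ => ¬ P σ, fun σ hσ => ?_, fun σ hσ => ?_,
    (Finsupp.filter_add_filter_not c P).symm, fun W hW => h1 _ hW, fun j hj => h1 _ hj⟩
  · simp at hσ
    exact hσ.2
  · simp at hσ
    exact (hc (by simpa using hσ.1)).resolve_left (by simpa [P] using hσ.2)

lemma GV_transport {j : ℤ} {f : X → Y} {g : Y → X} {W A : Set X} {W' A' : Set Y}
    {F : Submodule ℚ (Ch X)} (h : GV j W A F)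
    (hg : ContinuousOn g W') (hf : ContinuousOn f W)
    (hgW : Set.MapsTo g W' W) (hgA : Set.MapsTo g A' A)
    (hfW : Set.MapsTo f W W') (hfA : Set.MapsTo f A A')
    (H : Y → unitInterval → Y)
    (hH : ContinuousOn (fun p : Y × unitInterval => H p.1 p.2) (W' ×ˢ Set.univ))
    (hHW : ∀ y ∈ W', ∀ t, H y t ∈ W') (hHA : ∀ y ∈ A', ∀ t, H y t ∈ A')
    (h0 : ∀ y ∈ W', H y 0 = f (g y)) (h1 : ∀ y ∈ W', H y 1 = y) :
    GV j W' A' (F.map (push f)) := by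
  intro c hc hcW hcA
  obtain ⟨e, he, heW, u, hu, huj, hr⟩ := h (push g c) (push_Deg g hc) (push_Cin hgW hcW)
    (by rw [dd_push hg hcW]; exact push_Cin hgA hcA)
  refine ⟨push f e + hP H c, Submodule.add_mem _ (push_Deg f he) (hP_Deg H hc),
    Submodule.add_mem _ (push_Cin hfW heW) (hP_Cin hHW hcW), push f u,
    Submodule.mem_map_of_mem hu, push_Deg f huj, ?_⟩
  have e1 := dd_hP hH hcW
  rw [push_congr h1 hcW, push_id, push_congr h0 hcW, ← push_push hg hcW] at e1
  have e2 : push f (push g c - dd e - u) ∈ Cin A' := push_Cin hfA hr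
  rw [map_sub, map_sub, ← dd_push hf heW] at e2
  have e3 : c = push f (push g c) + (dd (hP H c) + hP H (dd c)) := by rw [e1]; abel
  have e4 : c - dd (push f e + hP H c) - push f u =
      (push f (push g c) - dd (push f e) - push f u) + hP H (dd c) := by
    nth_rewrite 1 [e3]
    rw [map_add]
    abel
  rw [e4]
  exact Submodule.add_mem _ e2 (hP_Cin hHA hcA)

/-- Mayer–Vietoris for pairs. -/
theorem GV_union {j : ℤ} {W₁ W₂ A₁ A₂ : Set X} {F : Submodule ℚ (Ch X)}
    (oW₁ : IsOpen W₁) (oW₂ : IsOpen W₂) (oA₁ : IsOpen A₁) (oA₂ : IsOpen A₂)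
    (h₁ : A₁ ⊆ W₁) (h₂ : A₂ ⊆ W₂) (g₁ : GV j W₁ A₁ F) (g₂ : GV j W₂ A₂ F)
    (g : HV (j - 1) (W₁ ∩ W₂) (A₁ ∩ A₂)) : GV j (W₁ ∪ W₂) (A₁ ∪ A₂) F := by
  intro c hc hcW hcA
  obtain ⟨N₁, hN₁⟩ := small_chains oW₁ oW₂ hcW
  obtain ⟨N₂, hN₂⟩ := small_chains oA₁ oA₂ hcA
  set N := max N₁ N₂
  obtain ⟨H, H1, H2, H3⟩ := exists_SS_homotopy (X := X) N
  obtain ⟨c₁, c₂, hc₁, hc₂, hcs, -, hcd⟩ := split_sup (hN₁ N (le_max_left _ _))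
  obtain ⟨a₁, a₂, ha₁, ha₂, has, -, had⟩ := split_sup (hN₂ N (le_max_right _ _))
  obtain ⟨d₁, d₂⟩ := hcd j (SS_pow_Deg hc N)
  obtain ⟨ad₁, ad₂⟩ := had (j - 1) (SS_pow_Deg (dd_Deg hc) N)
  have hb : dd c₁ - a₁ = -(dd c₂ - a₂) := by
    have : dd c₁ + dd c₂ = a₁ + a₂ := by rw [← map_add, ← hcs, dd_SS_pow, has]
    rw [eq_neg_iff_add_eq_zero, ← sub_eq_zero.2 this]
    abel
  have hda : dd a₁ = - dd a₂ := by
    have := congrArg dd hb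
    simp only [map_sub, map_neg, dd_dd, zero_sub, neg_neg] at this
    exact neg_eq_iff_eq_neg.1 this
  obtain ⟨e, he, heW, hea⟩ := HV_iff.1 g (dd c₁ - a₁)
    (Submodule.sub_mem _ (dd_Deg d₁) ad₁)
    (by
      rw [Cin_inter]
      refine ⟨Submodule.sub_mem _ (dd_Cin hc₁) (Cin_mono h₁ ha₁), ?_⟩
      rw [hb]
      exact Submodule.neg_mem _ (Submodule.sub_mem _ (dd_Cin hc₂) (Cin_mono h₂ ha₂)))
    (by
      rw [map_sub, dd_dd, zero_sub, Cin_inter]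
      refine ⟨Submodule.neg_mem _ (dd_Cin ha₁), ?_⟩
      rw [hda, neg_neg]
      exact dd_Cin ha₂)
  rw [sub_add_cancel] at he
  rw [Cin_inter] at heW hea
  obtain ⟨e₁, de₁, we₁, f₁, hf₁, df₁, r₁⟩ := g₁ (c₁ - e) (Submodule.sub_mem _ d₁ he)
    (Submodule.sub_mem _ hc₁ heW.1)
    (by
      have : dd (c₁ - e) = (dd c₁ - a₁ - dd e) + a₁ := by rw [map_sub]; abel
      rw [this]
      exact Submodule.add_mem _ hea.1 ha₁)
  obtain ⟨e₂, de₂, we₂, f₂, hf₂, df₂, r₂⟩ := g₂ (c₂ + e) (Submodule.add_mem _ d₂ he)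
    (Submodule.add_mem _ hc₂ heW.2)
    (by
      have : dd (c₂ + e) = -(dd c₁ - a₁ - dd e) + a₂ := by rw [map_add, hb]; abel
      rw [this]
      exact Submodule.add_mem _ (Submodule.neg_mem _ hea.2) ha₂)
  refine ⟨e₁ + e₂ + H c, Submodule.add_mem _ (Submodule.add_mem _ de₁ de₂) (H3 j c hc),
    Submodule.add_mem _ (Submodule.add_mem _ (Cin_mono Set.subset_union_left we₁)
      (Cin_mono Set.subset_union_right we₂)) (H2 _ c hcW), f₁ + f₂,
    Submodule.add_mem _ hf₁ hf₂, Submodule.add_mem _ df₁ df₂, ?_⟩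
  have e3 : c = c₁ + c₂ + (dd (H c) + H (dd c)) := by rw [H1, hcs]; abel
  have e4 : c - dd (e₁ + e₂ + H c) - (f₁ + f₂) =
      (c₁ - e - dd e₁ - f₁) + (c₂ + e - dd e₂ - f₂) + H (dd c) := by
    nth_rewrite 1 [e3]
    rw [map_add, map_add]
    abel
  rw [e4]
  exact Submodule.add_mem _ (Submodule.add_mem _ (Cin_mono Set.subset_union_left r₁)
    (Cin_mono Set.subset_union_right r₂)) (H2 _ _ hcA)

/-- Excision, one direction. -/
theorem GV_excision {j : ℤ} {W A : Set X} {F : Submodule ℚ (Ch X)} (oW : IsOpen W)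
    (oA : IsOpen A) (h : GV j W (A ∩ W) F) : GV j (A ∪ W) A F := by
  have := GV_union (W₁ := A) (A₁ := A) (j := j) (F := F) oA oW oA (oA.inter oW) subset_rfl
    Set.inter_subset_right (GV_self _ _ _) h
    (by
      have : A ∩ (A ∩ W) = A ∩ W := by rw [← Set.inter_assoc, Set.inter_self]
      rw [this]
      exact GV_self _ _ _)
  rwa [Set.union_eq_self_of_subset_right Set.inter_subset_left] at this

/-- Relative boundaries modulo two open sets combine. -/
theorem rel_boundary_inter {j : ℤ} {W A₁ A₂ : Set X} (oA₁ : IsOpen A₁) (oA₂ : IsOpen A₂)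
    (h₁ : A₁ ⊆ W)
    (h : HV (j + 1) W (A₁ ∪ A₂)) {c : Ch X} (hcj : c ∈ Deg X j) (hcW : c ∈ Cin W)
    (hcA : dd c ∈ Cin (A₁ ∩ A₂))
    {e₁ e₂ : Ch X} (d₁ : e₁ ∈ Deg X (j + 1)) (w₁ : e₁ ∈ Cin W) (r₁ : c - dd e₁ ∈ Cin A₁)
    (d₂ : e₂ ∈ Deg X (j + 1)) (w₂ : e₂ ∈ Cin W) (r₂ : c - dd e₂ ∈ Cin A₂) :
    ∃ e ∈ Deg X (j + 1), e ∈ Cin W ∧ c - dd e ∈ Cin (A₁ ∩ A₂) := by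
  obtain ⟨g, dg, wg, rg⟩ := HV_iff.1 h (e₁ - e₂) (Submodule.sub_mem _ d₁ d₂)
    (Submodule.sub_mem _ w₁ w₂) (by
      have : dd (e₁ - e₂) = (c - dd e₂) - (c - dd e₁) := by rw [map_sub]; abel
      rw [this]
      exact Submodule.sub_mem _ (Cin_mono Set.subset_union_right r₂)
        (Cin_mono Set.subset_union_left r₁))
  obtain ⟨N, hN⟩ := small_chains oA₁ oA₂ rg
  obtain ⟨H, H1, H2, H3⟩ := exists_SS_homotopy (X := X) N
  obtain ⟨p₁, p₂, hp₁, hp₂, hps, -, hpd⟩ := split_sup (hN N le_rfl)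
  have hdeg : e₁ - e₂ - dd g ∈ Deg X (j + 1) :=
    Submodule.sub_mem _ (Submodule.sub_mem _ d₁ d₂) (by simpa using dd_Deg dg)
  obtain ⟨dp₁, dp₂⟩ := hpd _ (SS_pow_Deg hdeg N)
  have hAA : dd c ∈ Cin A₁ ∧ dd c ∈ Cin A₂ := by rwa [Cin_inter] at hcA
  have e0 : c = (SS ^ N) c + (dd (H c) + H (dd c)) := by rw [H1]; abel
  have e1 : (SS ^ N) (dd e₁) - (SS ^ N) (dd e₂) = dd p₁ + dd p₂ := by
    have := congrArg dd hps
    rw [dd_SS_pow] at this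
    simpa using this
  refine ⟨(SS ^ N) e₁ - p₁ + H c, Submodule.add_mem _ (Submodule.sub_mem _ (SS_pow_Deg d₁ N) dp₁)
    (H3 _ _ hcj), Submodule.add_mem _ (Submodule.sub_mem _ (SS_pow_Cin w₁ N) (Cin_mono h₁ hp₁))
    (H2 _ _ hcW), ?_⟩
  rw [Cin_inter]
  constructor
  · have e2 : c - dd ((SS ^ N) e₁ - p₁ + H c) = (SS ^ N) (c - dd e₁) + dd p₁ + H (dd c) := by
      nth_rewrite 1 [e0]
      simp only [map_sub, map_add, dd_SS_pow]
      abel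
    rw [e2]
    exact Submodule.add_mem _ (Submodule.add_mem _ (SS_pow_Cin r₁ N) (dd_Cin hp₁)) (H2 _ _ hAA.1)
  · have e2 : c - dd ((SS ^ N) e₁ - p₁ + H c) = (SS ^ N) (c - dd e₂) - dd p₂ + H (dd c) := by
      have e3 : (SS ^ N) (dd e₁) = dd p₁ + dd p₂ + (SS ^ N) (dd e₂) := by rw [← e1]; abel
      nth_rewrite 1 [e0]
      simp only [map_sub, map_add, dd_SS_pow, e3]
      abel
    rw [e2]
    exact Submodule.add_mem _ (Submodule.sub_mem _ (SS_pow_Cin r₂ N) (dd_Cin hp₂)) (H2 _ _ hAA.2)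

end

end

section

open Cvx

/-! ### Homology of a point -/

section
variable {X Y Z : Type} [TopologicalSpace X] [TopologicalSpace Y] [TopologicalSpace Z]

lemma bd_replicate {D : Type} (a : D) (n : ℕ) :
    bd (ls (List.replicate (n + 1) a)) = if Even n then ls (List.replicate n a) else 0 := by
  induction n with
  | zero => simp [bd_cons]
  | succ n ih =>
    rw [List.replicate_succ, bd_cons, ih]
    by_cases h : Even n
    · have h' : ¬ Even (n + 1) := by simp [Nat.even_add_one, h]
      rw [if_pos h, if_neg h', cone_ls, ← List.replicate_succ, sub_self]
    · have h' : Even (n + 1) := by simp [Nat.even_add_one, h]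
      rw [if_neg h, if_pos h', map_zero, sub_zero]

lemma sx_eq_replicate [Subsingleton X] (x : X) {n : ℕ} (σ : C(Dl n, X)) :
    sx σ = R (ContinuousMap.const (Dl 0) x)
      (ls (List.replicate (n + 1) (stdSimplex.vertex 0))) := by
  have h : List.replicate (n + 1) (stdSimplex.vertex 0 : Dl 0) =
      List.ofFn fun _ : Fin (n + 1) => stdSimplex.vertex 0 := (List.ofFn_const _ _).symm
  rw [h, R_ofFn]
  congr 1
  ext t
  exact Subsingleton.elim _ _

lemma HV_subsingleton [Subsingleton X] {j : ℤ} (hj : 0 < j) (A : Set X) : HV j Set.univ A := by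
  rw [HV_iff]
  intro c hc _ hA
  rcases isEmpty_or_nonempty X with hX | ⟨⟨x⟩⟩
  · have : c = 0 := by
      have := map_mem_of_Deg (F := LinearMap.id) (P := ⊥)
        (fun n σ h => (hX.false (σ (stdSimplex.vertex 0))).elim) hc
      simpa using this
    exact ⟨0, zero_mem _, by simp, by simp [this]⟩
  rcases A.eq_empty_or_nonempty with rfl | ⟨y, hy⟩
  swap
  · refine ⟨0, zero_mem _, by simp, ?_⟩
    have : A = Set.univ := Set.eq_univ_of_forall fun z => Subsingleton.elim y z ▸ hy
    rw [this, Cin_univ]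
    trivial
  rw [Cin_empty, Submodule.mem_bot] at hA
  obtain ⟨k, rfl⟩ : ∃ k : ℕ, j = k + 1 := ⟨(j - 1).toNat, by omega⟩
  set P : ℕ → Ch X := fun n => R (ContinuousMap.const (Dl 0) x)
    (ls (List.replicate (n + 1) (stdSimplex.vertex 0)))
  have hP : ∀ n, dd (P (n + 1)) = if Even n then 0 else P n := fun n => by
    change dd (R _ _) = _
    rw [dd_R, bd_replicate]
    by_cases h : Even n
    · have h' : ¬ Even (n + 1) := by simp [Nat.even_add_one, h]
      simp [h, h']
    · have h' : Even (n + 1) := by simp [Nat.even_add_one, h]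
      simp [h, h', P]
  have hPd : ∀ n : ℕ, P n ∈ Deg X n := fun n => by
    have := sx_mem_Deg (ContinuousMap.const (Dl n) x)
    rwa [sx_eq_replicate x] at this
  have hs : c ∈ Submodule.span ℚ {P (k + 1)} := by
    refine map_mem_of_Deg (F := LinearMap.id) (fun n σ h => ?_) hc
    have : n = k + 1 := by omega
    subst this
    rw [LinearMap.id_apply, sx_eq_replicate x]
    exact Submodule.subset_span rfl
  obtain ⟨q, rfl⟩ := Submodule.mem_span_singleton.1 hs
  rw [map_smul, hP] at hA
  by_cases h : Even k
  · refine ⟨q • P (k + 2), Submodule.smul_mem _ _ (by exact_mod_cast hPd (k + 2)), by simp, ?_⟩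
    have h' : ¬ Even (k + 1) := by simp [Nat.even_add_one, h]
    rw [map_smul, hP, if_neg h', sub_self]
    exact zero_mem _
  · rw [if_neg h] at hA
    have : P k ≠ 0 := by
      have := sx_eq_replicate x (ContinuousMap.const (Dl k) x)
      change _ = P k at this
      rw [← this]
      simp [sx]
    rw [(smul_eq_zero.1 hA).resolve_right this]
    exact ⟨0, zero_mem _, by simp, by simp⟩

/-! ### Suspension -/

lemma push_hP {H : X → unitInterval → Y}
    (hH : Continuous fun p : X × unitInterval => H p.1 p.2) {g : Y → Z} (hg : Continuous g)
    (c : Ch X) : push g (hP H c) = hP (fun x t => g (H x t)) c :=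
  sx_ext (F := push g ∘ₗ hP H) (G := hP fun x t => g (H x t)) (fun n σ => by
    have h : Continuous fun p : Dl n × unitInterval => H (σ p.1) p.2 :=
      hH.comp (f := fun p : Dl n × unitInterval => (σ p.1, p.2)) (by fun_prop)
    change push g (hP H (sx σ)) = _
    rw [hP_sx h, push_R (hg.comp h), hP_sx (hg.comp h)]
    rfl) c

lemma hP_push {f : X → Y} (hf : Continuous f) {H : Y → unitInterval → Z}
    (hH : Continuous fun p : Y × unitInterval => H p.1 p.2) (c : Ch X) :
    hP H (push f c) = hP (fun x t => H (f x) t) c :=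
  sx_ext (F := hP H ∘ₗ push f) (G := hP fun x t => H (f x) t) (fun n σ => by
    have h : Continuous fun p : Dl n × unitInterval => H (f (σ p.1)) p.2 :=
      hH.comp (f := fun p : Dl n × unitInterval => (f (σ p.1), p.2)) (by fun_prop)
    change hP H (push f (sx σ)) = _
    rw [push_sx (hf.comp σ.continuous), hP_sx h, hP_sx]
    rfl) c

/-- The path from `(y, 1)` to `(y, -1)`. -/
def susp (y : Y) (t : unitInterval) : Y × ℝ := (y, 1 - 2 * (t : ℝ))

lemma continuous_susp : Continuous fun p : Y × unitInterval => susp p.1 p.2 := by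
  unfold susp; fun_prop

set_option maxHeartbeats 400000 in
theorem GV_susp {j : ℤ} {B : Set Y} (oB : IsOpen B) {F : Submodule ℚ (Ch Y)}
    (h : GV (j - 1) Set.univ B F) :
    GV j Set.univ {p : Y × ℝ | p.2 ≠ 0 ∨ p.1 ∈ B} (F.map (hP susp)) := by
  intro c hc _ hcA
  obtain ⟨A₁, hA₁⟩ : ∃ A : Set (Y × ℝ), A = {p | 0 < p.2 ∨ p.1 ∈ B} := ⟨_, rfl⟩
  obtain ⟨A₂, hA₂⟩ : ∃ A : Set (Y × ℝ), A = {p | p.2 < 0 ∨ p.1 ∈ B} := ⟨_, rfl⟩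
  obtain ⟨BB, hBB⟩ : ∃ A : Set (Y × ℝ), A = {p | p.1 ∈ B} := ⟨_, rfl⟩
  have m₁ : ∀ p, p ∈ A₁ ↔ 0 < p.2 ∨ p.1 ∈ B := fun p => by rw [hA₁]; rfl
  have m₂ : ∀ p, p ∈ A₂ ↔ p.2 < 0 ∨ p.1 ∈ B := fun p => by rw [hA₂]; rfl
  have mB : ∀ p, p ∈ BB ↔ p.1 ∈ B := fun p => by rw [hBB]; rfl
  have oBB : IsOpen BB := hBB ▸ oB.preimage continuous_fst
  have oA₁ : IsOpen A₁ := hA₁ ▸ (isOpen_lt continuous_const continuous_snd).union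
    (oB.preimage continuous_fst)
  have oA₂ : IsOpen A₂ := hA₂ ▸ (isOpen_lt continuous_snd continuous_const).union
    (oB.preimage continuous_fst)
  have hAu : {p : Y × ℝ | p.2 ≠ 0 ∨ p.1 ∈ B} = A₁ ∪ A₂ := by
    ext p
    simp only [m₁, m₂, Set.mem_ofPred_eq, Set.mem_union, ne_iff_lt_or_gt]
    tauto
  have hAi : A₁ ∩ A₂ ⊆ BB := by
    rintro p ⟨h1, h2⟩
    rw [m₁] at h1
    rw [m₂] at h2
    rw [mB]
    rcases h1 with h1 | h1 <;> rcases h2 with h2 | h2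
    · exact absurd h1 h2.not_gt
    all_goals assumption
  have hB1 : BB ⊆ A₁ := fun p hp => (m₁ p).2 (Or.inr ((mB p).1 hp))
  have hB2 : BB ⊆ A₂ := fun p hp => (m₂ p).2 (Or.inr ((mB p).1 hp))
  rw [hAu] at hcA ⊢
  have h1u : Cin A₁ ≤ Cin (A₁ ∪ A₂) := Cin_mono Set.subset_union_left
  have h2u : Cin A₂ ≤ Cin (A₁ ∪ A₂) := Cin_mono Set.subset_union_right
  obtain ⟨N, hN⟩ := small_chains oA₁ oA₂ hcA
  obtain ⟨G, G1, G2, G3⟩ := exists_SS_homotopy (X := Y × ℝ) N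
  obtain ⟨a₁, a₂, ha₁, ha₂, has, -, had⟩ := split_sup (hN N le_rfl)
  obtain ⟨da₁, da₂⟩ := had _ (SS_pow_Deg (dd_Deg hc) N)
  have uC : ∀ {T : Type} [TopologicalSpace T] (x : Ch T), x ∈ Cin Set.univ := fun x => by simp
  have hda : dd a₁ ∈ Cin BB := by
    refine Cin_mono hAi ?_
    rw [Cin_inter]
    refine ⟨dd_Cin ha₁, ?_⟩
    have : dd a₁ = - dd a₂ := by
      rw [eq_neg_iff_add_eq_zero, ← map_add, ← has, ← dd_SS_pow, dd_dd]
    rw [this]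
    exact Submodule.neg_mem _ (dd_Cin ha₂)
  have hfst : ContinuousOn (Prod.fst : Y × ℝ → Y) Set.univ := continuousOn_fst
  obtain ⟨e₀, de₀, -, f, hf, df, hb⟩ := h (push Prod.fst a₁) (push_Deg _ da₁) (uC _) (by
    rw [dd_push hfst (uC _)]
    exact push_Cin (f := Prod.fst) (A := BB) (fun p hp => (mB p).1 hp) hda)
  rw [sub_add_cancel] at de₀
  obtain ⟨b₀, hb₀⟩ : ∃ x, x = push Prod.fst a₁ - dd e₀ - f := ⟨_, rfl⟩
  rw [← hb₀] at hb
  have ddf : dd f ∈ Cin B := by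
    have : dd f = push Prod.fst (dd a₁) - dd b₀ := by
      rw [hb₀, map_sub, map_sub, dd_dd, ← dd_push hfst (uC _)]; abel
    rw [this]
    exact Submodule.sub_mem _ (push_Cin (f := Prod.fst) (A := BB) (fun p hp => (mB p).1 hp) hda) (dd_Cin hb)
  set i₁ : Y → Y × ℝ := fun y => (y, 1)
  have ci₁ : Continuous i₁ := by fun_prop
  set K : Y × ℝ → unitInterval → Y × ℝ := fun p s => (p.1, (1 - s) * p.2 + s)
  have cK : ContinuousOn (fun p : (Y × ℝ) × unitInterval => K p.1 p.2) (Set.univ ×ˢ Set.univ) := by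
    simp only [K]; fun_prop
  have hKA : ∀ p ∈ A₁, ∀ s, K p s ∈ A₁ := by
    intro p hp s
    rw [m₁] at hp ⊢
    rcases hp with hp | hp
    · left
      change 0 < (1 - (s : ℝ)) * p.2 + s
      rcases eq_or_lt_of_le s.2.1 with h0 | h0
      · rw [← h0]; simpa using hp
      · have := mul_nonneg (sub_nonneg.2 s.2.2) hp.le
        linarith
    · exact Or.inr hp
  have eK := dd_hP cK (uC a₁)
  have eK1 : push (fun p => K p 1) a₁ = push i₁ (push Prod.fst a₁) := by
    rw [push_push hfst (uC _)]
    congr 2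
    ext p <;> simp [K, i₁]
  have eK0 : push (fun p => K p 0) a₁ = a₁ := by
    have : (fun p => K p 0) = fun p => p := by ext p <;> simp [K]
    rw [this, push_id]
  rw [eK1, eK0] at eK
  have hPb : push Prod.fst a₁ = dd e₀ + f + b₀ := by rw [hb₀]; abel
  rw [hPb, map_add, map_add, ← dd_push ci₁.continuousOn (uC _)] at eK
  obtain ⟨e₁, he₁⟩ : ∃ x, x = push i₁ e₀ - hP K a₁ := ⟨_, rfl⟩
  have de₁ : e₁ ∈ Deg (Y × ℝ) j := he₁ ▸ Submodule.sub_mem _ (push_Deg _ de₀)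
    (by simpa using hP_Deg K da₁)
  have we₁ : e₁ ∈ Cin A₁ := he₁ ▸ Submodule.sub_mem _
    (push_Cin (f := i₁) (B := A₁) (fun y _ => (m₁ _).2 (Or.inl one_pos)) (uC e₀)) (hP_Cin hKA ha₁)
  obtain ⟨b₁, hb₁⟩ : ∃ x, x = push i₁ b₀ - hP K (dd a₁) := ⟨_, rfl⟩
  have wb₁ : b₁ ∈ Cin BB := hb₁ ▸ Submodule.sub_mem _ (push_Cin (f := i₁) (A := B) (B := BB) (fun y hy => (mB _).2 hy) hb)
    (hP_Cin (H := K) (A := BB) (fun p hp _ => (mB _).2 ((mB p).1 hp)) hda)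
  have ea₁ : a₁ = dd e₁ + b₁ + push i₁ f := by
    rw [he₁, hb₁, map_sub, eq_sub_of_add_eq eK]; abel
  have eP := dd_hP (H := susp (Y := Y)) (A := Set.univ) continuous_susp.continuousOn (uC f)
  have es0 : (fun y : Y => susp y 0) = i₁ := by ext y <;> simp [susp, i₁]
  rw [es0] at eP
  have wPd : hP susp (dd f) ∈ Cin BB := hP_Cin (H := susp) (A := B) (fun y hy _ => (mB _).2 hy) ddf
  obtain ⟨c', hc'⟩ : ∃ x, x = (SS ^ N) c - e₁ + hP susp f := ⟨_, rfl⟩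
  have dc' : c' ∈ Deg (Y × ℝ) j := hc' ▸ Submodule.add_mem _ (Submodule.sub_mem _ (SS_pow_Deg hc N) de₁)
    (by simpa using hP_Deg susp df)
  have edc' : dd c' = a₂ + b₁ + push (fun y => susp y 1) f - hP susp (dd f) := by
    rw [hc', map_add, map_sub, eq_sub_of_add_eq eP, dd_SS_pow, has]
    nth_rewrite 1 [ea₁]
    abel
  have wdc' : dd c' ∈ Cin A₂ := by
    rw [edc']
    refine Submodule.sub_mem _ (Submodule.add_mem _ (Submodule.add_mem _ ha₂ (Cin_mono hB2 wb₁))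
      (push_Cin (f := fun y => susp y 1) (fun y _ => (m₂ _).2 (Or.inl ?_)) (uC f))) (Cin_mono hB2 wPd)
    change 1 - 2 * (((1 : unitInterval) : ℝ)) < 0
    norm_num
  set L : Y × ℝ → unitInterval → Y × ℝ := fun p s => (p.1, (1 - s) * p.2 - s * (|p.2| + 1))
  have cL : ContinuousOn (fun p : (Y × ℝ) × unitInterval => L p.1 p.2) (Set.univ ×ˢ Set.univ) := by
    simp only [L]
    exact Continuous.continuousOn (by fun_prop)
  have hLA : ∀ p ∈ A₂, ∀ s, L p s ∈ A₂ := by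
    intro p hp s
    rw [m₂] at hp ⊢
    rcases hp with hp | hp
    · left
      change (1 - (s : ℝ)) * p.2 - s * (|p.2| + 1) < 0
      have h3 : 0 ≤ |p.2| := abs_nonneg _
      rcases eq_or_lt_of_le s.2.1 with h0 | h0
      · rw [← h0]; simpa using hp
      · have := mul_nonneg (sub_nonneg.2 s.2.2) (neg_nonneg.2 hp.le)
        nlinarith
    · exact Or.inr hp
  have eL := dd_hP cL (uC c')
  have eL0 : push (fun p => L p 0) c' = c' := by
    have : (fun p => L p 0) = fun p => p := by ext p <;> simp [L]
    rw [this, push_id]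
  rw [eL0] at eL
  have wL1 : push (fun p => L p 1) c' ∈ Cin A₂ := push_Cin (f := fun p => L p 1) (fun p _ => (m₂ _).2 <| Or.inl (by
    have h3 : 0 ≤ |p.2| := abs_nonneg _
    simp only [L, Set.Icc.coe_one]
    linarith)) (uC c')
  refine ⟨G c - hP L c', Submodule.sub_mem _ (G3 _ _ hc) (hP_Deg L dc'), uC _, -hP susp f,
    Submodule.neg_mem _ (Submodule.mem_map_of_mem hf),
    Submodule.neg_mem _ (by simpa using hP_Deg susp df), ?_⟩
  have efin : c - dd (G c - hP L c') - -hP susp f =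
      e₁ + (push (fun p => L p 1) c' - hP L (dd c')) + G (dd c) := by
    have h1 := G1 c
    have h2 : (SS ^ N) c = c' + e₁ - hP susp f := by rw [hc']; abel
    rw [h2] at h1
    have h3 : c = dd (G c) + G (dd c) + (c' + e₁ - hP susp f) := by rw [h1]; abel
    have h4 : dd (hP L c') = push (fun p => L p 1) c' - c' - hP L (dd c') := eq_sub_of_add_eq eL
    nth_rewrite 1 [h3]
    rw [map_sub, h4]
    abel
  rw [efin]
  exact Submodule.add_mem _ (Submodule.add_mem _ (h1u we₁)
    (Submodule.sub_mem _ (h2u wL1) (h2u (hP_Cin hLA wdc')))) (G2 _ _ hcA)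

end

end

section

open Cvx

/-! ### Local homology of Euclidean space -/

section
variable {X Y Z : Type} [TopologicalSpace X] [TopologicalSpace Y] [TopologicalSpace Z]

lemma GV_homeo {j : ℤ} (h : X ≃ₜ Y) {A : Set X} {F : Submodule ℚ (Ch X)}
    (hG : GV j Set.univ A F) : GV j Set.univ (h.symm ⁻¹' A) (F.map (push h)) := by
  refine GV_transport (f := h) (g := h.symm) hG h.symm.continuous.continuousOn
    h.continuous.continuousOn (fun _ _ => trivial) (fun _ hy => hy) (fun _ _ => trivial)
    (fun x hx => ?_) (fun y _ => y) continuousOn_fst (fun _ _ _ => trivial) (fun _ hy _ => hy)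
    (fun y _ => (h.apply_symm_apply y).symm) (fun _ _ => rfl)
  simpa using hx

lemma HV_homeo {j : ℤ} (h : X ≃ₜ Y) {A : Set X} (hG : HV j Set.univ A) :
    HV j Set.univ (h.symm ⁻¹' A) := by
  have := GV_homeo h hG
  rwa [Submodule.map_bot] at this

/-- The standard relative cycle of `(ℝᵏ, ℝᵏ ∖ 0)`. -/
def nu : (k : ℕ) → Ch (Fin k → ℝ)
  | 0 => sx (ContinuousMap.const (Dl 0) 0)
  | k + 1 => push (fun p : (Fin k → ℝ) × ℝ => (Fin.cons p.2 p.1 : Fin (k + 1) → ℝ))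
      (hP susp (nu k))

/-- Splitting off a coordinate. -/
def consHomeo (Z : Type) [TopologicalSpace Z] (k : ℕ) :
    (Z × (Fin k → ℝ)) × ℝ ≃ₜ Z × (Fin (k + 1) → ℝ) where
  toFun p := (p.1.1, Fin.cons p.2 p.1.2)
  invFun q := ((q.1, Fin.tail q.2), q.2 0)
  left_inv p := by simp
  right_inv q := by simp
  continuous_toFun := by fun_prop
  continuous_invFun := by
    unfold Fin.tail
    fun_prop

/-- Span of the fibrewise standard relative cycles. -/
def nuSpan (Z : Type) [TopologicalSpace Z] (k : ℕ) : Submodule ℚ (Ch (Z × (Fin k → ℝ))) :=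
  Submodule.span ℚ (Set.range fun z => push (fun v => (z, v)) (nu k))

lemma consHomeo_symm_preimage (k : ℕ) :
    (consHomeo Z k).symm ⁻¹' {p | p.2 ≠ 0 ∨ p.1 ∈ {q : Z × (Fin k → ℝ) | q.2 ≠ 0}} =
      {q | q.2 ≠ 0} := by
  ext q
  change q.2 0 ≠ 0 ∨ Fin.tail q.2 ≠ 0 ↔ q.2 ≠ 0
  rw [← not_and_or, not_iff_not]
  constructor
  · rintro ⟨h1, h2⟩
    rw [← Fin.cons_self_tail q.2, h1, h2]
    ext i
    refine Fin.cases ?_ ?_ i <;> simp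
  · intro h
    rw [h]
    exact ⟨rfl, rfl⟩

lemma isOpen_snd_ne (k : ℕ) : IsOpen {q : Z × (Fin k → ℝ) | q.2 ≠ 0} :=
  isOpen_ne_fun continuous_snd continuous_const

lemma nuSpan_map (k : ℕ) :
    ((nuSpan Z k).map (hP susp)).map (push (consHomeo Z k)) ≤ nuSpan Z (k + 1) := by
  rw [nuSpan, Submodule.map_span, Submodule.map_span, Submodule.span_le]
  rintro _ ⟨_, ⟨_, ⟨z, rfl⟩, rfl⟩, rfl⟩
  refine Submodule.subset_span ⟨z, ?_⟩
  have hs := continuous_susp (Y := Z × (Fin k → ℝ))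
  have hs' := continuous_susp (Y := Fin k → ℝ)
  change push (fun v => (z, v)) (push _ _) = push _ (hP susp (push _ _))
  rw [hP_push (by fun_prop) hs, push_hP (by unfold susp; fun_prop) (consHomeo Z k).continuous,
    push_push (f := fun p : (Fin k → ℝ) × ℝ => (Fin.cons p.2 p.1 : Fin (k + 1) → ℝ))
      (A := Set.univ) (Continuous.continuousOn (by fun_prop)) (by simp), push_hP hs' (by fun_prop)]
  rfl

lemma HV_euclid_lt (Z : Type) [TopologicalSpace Z] (k : ℕ) (j : ℤ) (hj : j < k) :
    HV j Set.univ {q : Z × (Fin k → ℝ) | q.2 ≠ 0} := by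
  induction k generalizing j with
  | zero => exact HV_of_neg hj _ _
  | succ k ih =>
    have h := GV_susp (isOpen_snd_ne k) (ih (j - 1) (by push_cast at hj; omega))
    rw [Submodule.map_bot] at h
    have := HV_homeo (consHomeo Z k) h
    rwa [consHomeo_symm_preimage] at this

lemma HV_euclid_gt (Z : Type) [TopologicalSpace Z] [Subsingleton Z] (k : ℕ) (j : ℤ) (hj : k < j) :
    HV j Set.univ {q : Z × (Fin k → ℝ) | q.2 ≠ 0} := by
  induction k generalizing j with
  | zero => exact HV_subsingleton hj _
  | succ k ih =>
    have h := GV_susp (isOpen_snd_ne k) (ih (j - 1) (by push_cast at hj; omega))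
    rw [Submodule.map_bot] at h
    have := HV_homeo (consHomeo Z k) h
    rwa [consHomeo_symm_preimage] at this

lemma GV_euclid (Z : Type) [TopologicalSpace Z] (k : ℕ) :
    GV k Set.univ {q : Z × (Fin k → ℝ) | q.2 ≠ 0} (nuSpan Z k) := by
  induction k with
  | zero =>
    intro c hc _ _
    refine ⟨0, zero_mem _, by simp, c, ?_, hc, by simp⟩
    refine map_mem_of_Deg (F := LinearMap.id) (fun n σ h => ?_) hc
    have : n = 0 := by exact_mod_cast h
    subst this
    refine Submodule.subset_span ⟨(σ (stdSimplex.vertex 0)).1, ?_⟩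
    change push _ (sx _) = sx σ
    rw [push_sx (by fun_prop)]
    congr 1
    ext t : 1
    rw [Subsingleton.elim t (stdSimplex.vertex 0)]
    exact Prod.ext rfl (Subsingleton.elim _ _)
  | succ k ih =>
    have e : ((k + 1 : ℕ) : ℤ) - 1 = k := by push_cast; ring
    have h := GV_susp (j := (k + 1 : ℕ)) (isOpen_snd_ne k) (e ▸ ih)
    have := GV_homeo (consHomeo Z k) h
    rw [consHomeo_symm_preimage] at this
    exact this.mono (nuSpan_map k)

/-- Translation identifies the homology away from a point with the homology away from `0`. -/
def ptHomeo (k : ℕ) (x : Fin k → ℝ) : Unit × (Fin k → ℝ) ≃ₜ (Fin k → ℝ) where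
  toFun p := p.2 + x
  invFun v := ((), v - x)
  left_inv p := by simp
  right_inv v := by simp
  continuous_toFun := by fun_prop
  continuous_invFun := by fun_prop

lemma ptHomeo_preimage (k : ℕ) (x : Fin k → ℝ) :
    (ptHomeo k x).symm ⁻¹' {q | q.2 ≠ 0} = {x}ᶜ := by
  ext v
  change v - x ≠ 0 ↔ v ≠ x
  exact sub_ne_zero

lemma HV_point {k : ℕ} (x : Fin k → ℝ) {j : ℤ} (hj : j ≠ k) :
    HV j Set.univ ({x}ᶜ : Set (Fin k → ℝ)) := by
  rw [← ptHomeo_preimage]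
  rcases lt_or_gt_of_ne hj with h | h
  · exact HV_homeo _ (HV_euclid_lt _ _ _ h)
  · exact HV_homeo _ (HV_euclid_gt _ _ _ h)

lemma GV_point {k : ℕ} (x : Fin k → ℝ) :
    GV k Set.univ ({x}ᶜ : Set (Fin k → ℝ)) (Submodule.span ℚ {push (fun v => v + x) (nu k)}) := by
  rw [← ptHomeo_preimage]
  refine (GV_homeo (ptHomeo k x) (GV_euclid Unit k)).mono ?_
  rw [nuSpan, Submodule.map_span]
  refine Submodule.span_mono ?_
  rintro _ ⟨_, ⟨z, rfl⟩, rfl⟩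
  rw [push_push (A := Set.univ) (by fun_prop) (by simp)]
  rfl

end

end

section

open Cvx

/-! ### Relative boundaries -/

section
variable {X Y Z : Type} [TopologicalSpace X] [TopologicalSpace Y] [TopologicalSpace Z]

/-- `c` is a boundary modulo chains in `A`, within `W`. -/
def RB (j : ℤ) (W A : Set X) (c : Ch X) : Prop :=
  ∃ e ∈ Deg X (j + 1), e ∈ Cin W ∧ c - dd e ∈ Cin A

lemma RB.mono {j : ℤ} {W W' A A' : Set X} {c : Ch X} (h : RB j W A c) (hW : W ⊆ W')
    (hA : A ⊆ A') : RB j W' A' c := by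
  obtain ⟨e, he, hw, hr⟩ := h
  exact ⟨e, he, Cin_mono hW hw, Cin_mono hA hr⟩

lemma HV_iff_RB {j : ℤ} {W A : Set X} :
    HV j W A ↔ ∀ c ∈ Deg X j, c ∈ Cin W → dd c ∈ Cin A → RB j W A c := HV_iff

lemma RB_of_mem {j : ℤ} {W A : Set X} {c : Ch X} (h : c ∈ Cin A) : RB j W A c :=
  ⟨0, zero_mem _, zero_mem _, by simpa⟩

lemma RB.add {j : ℤ} {W A : Set X} {c c' : Ch X} (h : RB j W A c) (h' : RB j W A c') :
    RB j W A (c + c') := by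
  obtain ⟨e, he, hw, hr⟩ := h
  obtain ⟨e', he', hw', hr'⟩ := h'
  refine ⟨e + e', Submodule.add_mem _ he he', Submodule.add_mem _ hw hw', ?_⟩
  rw [map_add, add_sub_add_comm]
  exact Submodule.add_mem _ hr hr'

lemma RB.smul {j : ℤ} {W A : Set X} {c : Ch X} (h : RB j W A c) (q : ℚ) :
    RB j W A (q • c) := by
  obtain ⟨e, he, hw, hr⟩ := h
  refine ⟨q • e, Submodule.smul_mem _ _ he, Submodule.smul_mem _ _ hw, ?_⟩
  rw [map_smul, ← smul_sub]
  exact Submodule.smul_mem _ _ hr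

lemma RB.neg {j : ℤ} {W A : Set X} {c : Ch X} (h : RB j W A c) : RB j W A (-c) := by
  simpa using h.smul (-1)

lemma RB.sub {j : ℤ} {W A : Set X} {c c' : Ch X} (h : RB j W A c) (h' : RB j W A c') :
    RB j W A (c - c') := by
  rw [sub_eq_add_neg]
  exact h.add h'.neg

lemma RB_dd {j : ℤ} {W A : Set X} {e : Ch X} (he : e ∈ Deg X (j + 1)) (hw : e ∈ Cin W) :
    RB j W A (dd e) := ⟨e, he, hw, by simp⟩

lemma RB.push {j : ℤ} {W A : Set X} {W' A' : Set Y} {c : Ch X} (h : RB j W A c) {f : X → Y}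
    (hf : ContinuousOn f W) (hW : Set.MapsTo f W W') (hA : Set.MapsTo f A A') :
    RB j W' A' (push f c) := by
  obtain ⟨e, he, hw, hr⟩ := h
  refine ⟨ConfStab.push f e, push_Deg f he, push_Cin hW hw, ?_⟩
  rw [dd_push hf hw, ← map_sub]
  exact push_Cin hA hr

/-- Relative cycles are preserved by homotopies, up to boundaries. -/
lemma RB_homotopy {j : ℤ} {W A : Set X} {W' A' : Set Y} {c : Ch X} (hc : c ∈ Deg X j)
    (hw : c ∈ Cin W) (ha : dd c ∈ Cin A) {H : X → unitInterval → Y}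
    (hH : ContinuousOn (fun p : X × unitInterval => H p.1 p.2) (W ×ˢ Set.univ))
    (hW : ∀ x ∈ W, ∀ t, H x t ∈ W') (hA : ∀ x ∈ A, ∀ t, H x t ∈ A') :
    RB j W' A' (push (fun x => H x 1) c - push (fun x => H x 0) c) := by
  refine ⟨hP H c, hP_Deg H hc, hP_Cin hW hw, ?_⟩
  rw [← dd_hP hH hw, add_sub_cancel_left]
  exact hP_Cin hA ha

lemma exists_support (c : Ch X) : ∃ L : Set X, IsCompact L ∧ c ∈ Cin L ∧ ∀ A, c ∈ Cin A → L ⊆ A := by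
  refine ⟨⋃ σ ∈ c.support, Set.range σ.2, c.support.isCompact_biUnion fun σ _ =>
    isCompact_range σ.2.continuous, fun σ hσ t => ?_, fun A hA => ?_⟩
  · exact Set.mem_biUnion hσ ⟨t, rfl⟩
  · simp only [Set.iUnion_subset_iff]
    rintro σ hσ _ ⟨t, rfl⟩
    exact hA hσ t

/-! ### Compact subsets of Euclidean space -/

variable {n : ℕ}

lemma RB_convex {j : ℤ} {C : Set (Fin n → ℝ)} (hC : Convex ℝ C) (hK : IsCompact C)
    {x : Fin n → ℝ} (hx : x ∈ C) {c : Ch (Fin n → ℝ)} (hc : c ∈ Deg _ j) (hcC : dd c ∈ Cin Cᶜ)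
    (h : RB j Set.univ {x}ᶜ c) : RB j Set.univ Cᶜ c := by
  obtain ⟨e, he, hw, hr⟩ := h
  obtain ⟨r, hr0, hCr⟩ := hK.isBounded.subset_closedBall_lt 0 x
  set H : (Fin n → ℝ) → unitInterval → (Fin n → ℝ) :=
    fun y t => y + ((t : ℝ) * (r / ‖y - x‖)) • (y - x)
  have hH : ContinuousOn (fun p : (Fin n → ℝ) × unitInterval => H p.1 p.2)
      ({x}ᶜ ×ˢ Set.univ) := by
    have h1 : ContinuousOn (fun p : (Fin n → ℝ) × unitInterval => r / ‖p.1 - x‖)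
        ({x}ᶜ ×ˢ Set.univ) := by
      refine ContinuousOn.div continuousOn_const (by fun_prop) ?_
      rintro ⟨y, t⟩ ⟨hy, -⟩
      exact norm_ne_zero_iff.2 (sub_ne_zero.2 hy)
    simp only [H]
    exact (by fun_prop : ContinuousOn (fun p : (Fin n → ℝ) × unitInterval => p.1) _).add
      (((by fun_prop : ContinuousOn (fun p : (Fin n → ℝ) × unitInterval => (p.2 : ℝ)) _).mul
        h1).smul (by fun_prop))
  have hdc : dd (c - dd e) = dd c := by simp
  have hxC : Cᶜ ⊆ ({x}ᶜ : Set (Fin n → ℝ)) := fun y hy h' => hy (h' ▸ hx)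
  have key : RB j Set.univ Cᶜ (push (fun y => H y 1) (c - dd e) - push (fun y => H y 0) (c - dd e)) := by
    refine RB_homotopy (A := Cᶜ) (Submodule.sub_mem _ hc (by simpa using dd_Deg he)) hr
      (by rwa [hdc]) hH (fun _ _ _ => trivial) ?_
    intro y hy t hyt
    refine hy ?_
    have hs : 0 ≤ (t : ℝ) * (r / ‖y - x‖) := mul_nonneg t.2.1 (by positivity)
    set s := (t : ℝ) * (r / ‖y - x‖)
    have := hC hyt hx (a := 1 / (1 + s)) (b := s / (1 + s)) (by positivity) (by positivity)
      (by field_simp)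
    convert this using 1
    ext i
    simp only [H, Pi.add_apply, Pi.smul_apply, Pi.sub_apply, smul_eq_mul]
    change y i = 1 / (1 + s) * (y i + s * (y i - x i)) + s / (1 + s) * x i
    field_simp
    ring
  have h0 : push (fun y => H y 0) (c - dd e) = c - dd e := by
    have : (fun y => H y 0) = fun y => y := by ext; simp [H]
    rw [this, push_id]
  have h1 : RB j Set.univ Cᶜ (push (fun y => H y 1) (c - dd e)) := by
    refine RB_of_mem (push_Cin (f := fun y => H y 1) (A := {x}ᶜ) (B := Cᶜ) (fun y hy hyC => ?_) hr)
    have hn : 0 < ‖y - x‖ := norm_pos_iff.2 (sub_ne_zero.2 hy)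
    have := hCr hyC
    rw [Metric.mem_closedBall, dist_eq_norm] at this
    have e1 : H y 1 - x = (1 + r / ‖y - x‖) • (y - x) := by
      simp only [H, Set.Icc.coe_one, one_mul]
      module
    rw [e1, norm_smul, Real.norm_of_nonneg (by positivity)] at this
    have : (1 + r / ‖y - x‖) * ‖y - x‖ = ‖y - x‖ + r := by field_simp
    linarith
  rw [h0] at key
  have := ((h1.sub key).add (RB_dd (A := Cᶜ) he hw))
  simpa using this

lemma RB_convex_union {ι : Type} (s : Finset ι) : ∀ (j : ℤ), (n : ℤ) ≤ j →
    ∀ C : ι → Set (Fin n → ℝ), (∀ i, Convex ℝ (C i)) → (∀ i, IsCompact (C i)) →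
    ∀ c ∈ Deg (Fin n → ℝ) j, dd c ∈ Cin (⋃ i ∈ s, C i)ᶜ →
    (∀ i ∈ s, RB j Set.univ (C i)ᶜ c) → RB j Set.univ (⋃ i ∈ s, C i)ᶜ c := by
  classical
  induction s using Finset.induction_on with
  | empty =>
    intro j _ C _ _ c _ _ _
    exact RB_of_mem (by simp)
  | insert a s ha ih =>
    intro j hj C hC hK c hc hcC hR
    have hU : (⋃ i ∈ insert a s, C i)ᶜ = (C a)ᶜ ∩ (⋃ i ∈ s, C i)ᶜ := by
      rw [Finset.set_biUnion_insert, Set.compl_union]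
    rw [hU] at hcC ⊢
    have hcC' := hcC
    rw [Cin_inter] at hcC'
    have o1 : IsOpen (C a)ᶜ := (hK a).isClosed.isOpen_compl
    have o2 : IsOpen (⋃ i ∈ s, C i)ᶜ :=
      (s.isCompact_biUnion fun i _ => hK i).isClosed.isOpen_compl
    obtain ⟨e₁, d₁, w₁, r₁⟩ := hR a (Finset.mem_insert_self _ _)
    obtain ⟨e₂, d₂, w₂, r₂⟩ := ih j hj C hC hK c hc hcC'.2
      fun i hi => hR i (Finset.mem_insert_of_mem hi)
    refine rel_boundary_inter o1 o2 (Set.subset_univ _) ?_ hc (by simp) hcC d₁ w₁ r₁ d₂ w₂ r₂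
    have hI : (C a)ᶜ ∪ (⋃ i ∈ s, C i)ᶜ = (⋃ i ∈ s, C i ∩ C a)ᶜ := by
      rw [← Set.compl_inter, Set.inter_comm, Set.iUnion₂_inter]
    rw [hI, HV_iff_RB]
    intro c' hc' _ hcC'
    refine ih (j + 1) (by omega) (fun i => C i ∩ C a) (fun i => (hC i).inter (hC a))
      (fun i => (hK i).inter (hK a)) c' hc' hcC' fun i hi => ?_
    rcases (C i ∩ C a).eq_empty_or_nonempty with h | ⟨x, hx⟩
    · exact RB_of_mem (by rw [h]; simp)
    · have hs : C i ∩ C a ⊆ ⋃ i ∈ s, C i ∩ C a := Set.subset_biUnion_of_mem (u := fun i => C i ∩ C a) hi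
      have hm := Cin_mono (Set.compl_subset_compl.2 hs) hcC'
      refine RB_convex ((hC i).inter (hC a)) ((hK i).inter (hK a)) hx hc' hm ?_
      refine HV_iff_RB.1 (HV_point x (by omega)) c' hc' (by simp) ?_
      exact Cin_mono (by simpa using hx) hm

theorem RB_compact {j : ℤ} (hj : (n : ℤ) ≤ j) {K : Set (Fin n → ℝ)} (hK : IsCompact K)
    {c : Ch (Fin n → ℝ)} (hc : c ∈ Deg _ j) (hcK : dd c ∈ Cin Kᶜ)
    (h : ∀ x ∈ K, RB j Set.univ {x}ᶜ c) : RB j Set.univ Kᶜ c := by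
  obtain ⟨L, hL, hcL, hLK⟩ := exists_support (dd c)
  have hr : ∀ x ∈ K, ∃ r : ℝ, 0 < r ∧ Metric.closedBall x r ⊆ Lᶜ := fun x hx =>
    Metric.nhds_basis_closedBall.mem_iff.1 (hL.isClosed.isOpen_compl.mem_nhds
      fun hxL => hLK _ hcK hxL hx)
  choose! r hr0 hrL using hr
  obtain ⟨t, htK, hKt⟩ := hK.elim_nhds_subcover (fun x => Metric.closedBall x (r x))
    fun x hx => Metric.closedBall_mem_nhds x (hr0 x hx)
  refine (RB_convex_union t j hj (fun x => Metric.closedBall x (r x))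
    (fun x => convex_closedBall _ _) (fun x => isCompact_closedBall _ _) c hc ?_ ?_).mono
    subset_rfl (Set.compl_subset_compl.2 hKt)
  · refine Cin_mono (fun y hy => ?_) hcL
    simp only [Set.mem_compl_iff, Set.mem_iUnion₂, not_exists]
    exact fun x hx hyx => hrL x (htK x hx) hyx hy
  · intro x hx
    refine RB_convex (convex_closedBall _ _) (isCompact_closedBall _ _)
      (Metric.mem_closedBall_self (hr0 x (htK x hx)).le) hc ?_ (h x (htK x hx))
    exact Cin_mono (fun y hy hyx => hrL x (htK x hx) hyx hy) hcL

theorem HV_compact {j : ℤ} (hj : (n : ℤ) < j) {K : Set (Fin n → ℝ)} (hK : IsCompact K) :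
    HV j Set.univ Kᶜ := HV_iff_RB.2 fun c hc _ hcK => RB_compact hj.le hK hc hcK fun x hx =>
  HV_iff_RB.1 (HV_point x hj.ne') c hc (by simp) (Cin_mono (by simpa using hx) hcK)

lemma HV_contractible {j : ℤ} (hj : 0 < j) : HV j Set.univ (∅ : Set (Fin n → ℝ)) := by
  have h := GV_transport (f := fun _ : Unit => (0 : Fin n → ℝ)) (g := fun _ => ())
    (W' := Set.univ) (A' := ∅) (HV_subsingleton hj (∅ : Set Unit)) continuousOn_const
    continuousOn_const (fun _ _ => trivial) (fun _ h => h) (fun _ _ => trivial) (fun _ h => h.elim)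
    (fun y t => (t : ℝ) • y) (Continuous.continuousOn (by fun_prop)) (fun _ _ _ => trivial)
    (fun _ h => h.elim) (fun y _ => by simp) (fun y _ => by simp)
  rwa [Submodule.map_bot] at h

/-- High-dimensional homology of open subsets of Euclidean space vanishes. -/
theorem HV_open {j : ℤ} (hj : (n : ℤ) < j) {O : Set (Fin n → ℝ)} (hO : IsOpen O) : HV j O ∅ := by
  rw [HV_iff_RB]
  intro z hz hzO hdz
  obtain ⟨e, he, -, hez⟩ := HV_iff_RB.1 (HV_contractible (n := n) (j := j) (by omega)) z hz
    (by simp) hdz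
  rw [Cin_empty, Submodule.mem_bot] at hez hdz
  rw [sub_eq_zero] at hez
  obtain ⟨L, hL, hzL, hLA⟩ := exists_support z
  obtain ⟨r, hr⟩ := hL.isBounded.subset_ball 0
  set K : Set (Fin n → ℝ) := {x | r ≤ ‖x‖ ∧ ‖x‖ ≤ r + 1} ∪ Metric.closedBall 0 r \ O with hKdef
  have hK : IsCompact K := by
    refine IsCompact.union ?_ ((isCompact_closedBall 0 r).diff hO)
    refine (isCompact_closedBall (0 : Fin n → ℝ) (r + 1)).of_isClosed_subset
      ((isClosed_le continuous_const continuous_norm).inter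
        (isClosed_le continuous_norm continuous_const)) fun x hx => ?_
    simpa using hx.2
  set U : Set (Fin n → ℝ) := O ∩ Metric.ball 0 r with hU
  set V : Set (Fin n → ℝ) := {x | r + 1 < ‖x‖} with hV
  have oU : IsOpen U := hO.inter Metric.isOpen_ball
  have oV : IsOpen V := isOpen_lt continuous_const continuous_norm
  have hUV : Kᶜ ⊆ U ∪ V := by
    intro x hx
    simp only [hKdef, Set.mem_compl_iff, Set.mem_union, Set.mem_ofPred_eq, Set.mem_sdiff,
      Metric.mem_closedBall, dist_zero_right, not_or, not_and, not_not, not_le] at hx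
    simp only [hU, hV, Set.mem_union, Set.mem_inter_iff, Metric.mem_ball, dist_zero_right,
      Set.mem_ofPred_eq]
    by_cases h : r ≤ ‖x‖
    · exact Or.inr (hx.1 h)
    · push Not at h
      exact Or.inl ⟨hx.2 h.le, h⟩
  have hUK : U ⊆ Kᶜ := by
    rintro x ⟨hx1, hx2⟩ (hx | hx)
    · rw [Metric.mem_ball, dist_zero_right] at hx2
      exact absurd hx.1 hx2.not_ge
    · exact hx.2 hx1
  have hdis : U ∩ V = ∅ := by
    ext x
    simp only [hU, hV, Set.mem_inter_iff, Metric.mem_ball, dist_zero_right, Set.mem_ofPred_eq,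
      Set.mem_empty_iff_false, iff_false, not_and, not_lt]
    intro h
    linarith [h.2]
  have hzU : z ∈ Cin U := by
    rw [hU, Cin_inter]
    exact ⟨hzO, Cin_mono hr hzL⟩
  obtain ⟨g, hg, -, hgr⟩ := HV_iff_RB.1 (HV_compact (j := j + 1) (by omega) hK) e he (by simp)
    (by rw [← hez]; exact Cin_mono hUK hzU)
  obtain ⟨N, hN⟩ := small_chains oU oV (Cin_mono hUV hgr)
  obtain ⟨G, G1, G2, G3⟩ := exists_SS_homotopy (X := Fin n → ℝ) N
  obtain ⟨p, q, hp, hq, hpq, -, hpd⟩ := split_sup (hN N le_rfl)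
  obtain ⟨dp, dq⟩ := hpd (j + 1) (SS_pow_Deg (Submodule.sub_mem _ he (by simpa using dd_Deg hg)) N)
  have e1 : (SS ^ N) z = dd p + dd q := by
    rw [← map_add, ← hpq, dd_SS_pow, map_sub, dd_dd, sub_zero, ← hez]
  have e2 : dd q = 0 := by
    have : dd q ∈ Cin (U ∩ V) := by
      rw [Cin_inter]
      refine ⟨?_, dd_Cin hq⟩
      have : dd q = (SS ^ N) z - dd p := by rw [e1]; abel
      rw [this]
      exact Submodule.sub_mem _ (SS_pow_Cin hzU N) (dd_Cin hp)
    rwa [hdis, Cin_empty, Submodule.mem_bot] at this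
  have e3 : z = dd (p + G z) := by
    have := G1 z
    rw [hdz, map_zero, add_zero, e1, e2, add_zero] at this
    rw [map_add, this]
    abel
  rw [e3]
  exact RB_dd (Submodule.add_mem _ dp (G3 _ _ hz)) (Cin_mono Set.inter_subset_left
    (Submodule.add_mem _ hp (G2 _ _ hzU)))

end

end

section

open Cvx

/-! ### Charts -/

section
variable {X Y Z : Type} [TopologicalSpace X] [TopologicalSpace Y] [TopologicalSpace Z]

lemma invFun_emb [Nonempty Y] {ψ : Y → X} (h : Topology.IsOpenEmbedding ψ) (y : Y) :
    Function.invFun ψ (ψ y) = y := Function.leftInverse_invFun h.injective y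

lemma emb_invFun [Nonempty Y] {ψ : Y → X} {x : X} (hx : x ∈ Set.range ψ) :
    ψ (Function.invFun ψ x) = x := Function.invFun_eq hx

lemma continuousOn_invFun [Nonempty Y] {ψ : Y → X} (h : Topology.IsOpenEmbedding ψ) :
    ContinuousOn (Function.invFun ψ) (Set.range ψ) := by
  rw [h.isInducing.continuousOn_iff]
  exact continuousOn_id.congr fun x hx => emb_invFun hx

lemma GV_emb [Nonempty Y] {ψ : Y → X} (h : Topology.IsOpenEmbedding ψ) {j : ℤ} {W A : Set Y}
    {F : Submodule ℚ (Ch Y)} (hG : GV j W A F) : GV j (ψ '' W) (ψ '' A) (F.map (push ψ)) := by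
  have hs : ∀ S : Set Y, Set.MapsTo (Function.invFun ψ) (ψ '' S) S := by
    rintro S _ ⟨y, hy, rfl⟩
    rwa [invFun_emb h]
  exact GV_transport (f := ψ) (g := Function.invFun ψ) hG
    ((continuousOn_invFun h).mono (Set.image_subset_range _ _)) h.continuous.continuousOn
    (hs W) (hs A) (Set.mapsTo_image _ _) (Set.mapsTo_image _ _) (fun x _ => x) continuousOn_fst
    (fun _ hx _ => hx) (fun _ hx _ => hx)
    (fun x hx => (emb_invFun (Set.image_subset_range _ _ hx)).symm) (fun _ _ => rfl)

lemma HV_emb [Nonempty Y] {ψ : Y → X} (h : Topology.IsOpenEmbedding ψ) {j : ℤ} {W A : Set Y}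
    (hG : HV j W A) : HV j (ψ '' W) (ψ '' A) := by
  have := GV_emb h hG
  rwa [Submodule.map_bot] at this

/-- Vanishing of high-dimensional homology for open subsets of a finite union of charts. -/
theorem HV_charts {ι : Type} {n : ℕ} {ψ : ι → (Fin n → ℝ) → X}
    (hψ : ∀ s, Topology.IsOpenEmbedding (ψ s)) (s : Finset ι) : ∀ (j : ℤ), (n : ℤ) + s.card < j →
    ∀ O : Set X, IsOpen O → O ⊆ ⋃ i ∈ s, Set.range (ψ i) → HV j O ∅ := by
  classical
  induction s using Finset.induction_on with
  | empty =>
    intro j _ O _ hO'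
    have : O = ∅ := by simpa using hO'
    rw [this]
    exact GV_self _ _ _
  | insert a s ha ih =>
    intro j hj O hO hO'
    rw [Finset.card_insert_of_notMem ha] at hj
    push_cast at hj
    have o1 : IsOpen (O ∩ Set.range (ψ a)) := hO.inter (hψ a).isOpen_range
    have o2 : IsOpen (O ∩ ⋃ i ∈ s, Set.range (ψ i)) :=
      hO.inter (isOpen_biUnion fun i _ => (hψ i).isOpen_range)
    have hOu : O = (O ∩ Set.range (ψ a)) ∪ (O ∩ ⋃ i ∈ s, Set.range (ψ i)) := by
      rw [Finset.set_biUnion_insert] at hO'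
      rw [← Set.inter_union_distrib_left, Set.inter_eq_self_of_subset_left hO']
    rw [hOu, ← Set.union_self (∅ : Set X)]
    refine GV_union o1 o2 isOpen_empty isOpen_empty (Set.empty_subset _) (Set.empty_subset _)
      ?_ (ih j (by omega) _ o2 Set.inter_subset_right) ?_
    · have h := HV_emb (hψ a) (HV_open (j := j) (by omega) (hO.preimage (hψ a).continuous))
      rwa [Set.image_preimage_eq_inter_range, Set.image_empty] at h
    · rw [Set.inter_self]
      exact ih (j - 1) (by omega) _ (o1.inter o2) (Set.inter_subset_right.trans
        Set.inter_subset_right)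

lemma RB_excise {j : ℤ} {W U A : Set X} (oU : IsOpen U) (oA : IsOpen A) (hUA : U ∪ A = W)
    {c : Ch X} (hc : c ∈ Deg X j) (hcU : c ∈ Cin U) (hcA : dd c ∈ Cin A)
    (h : RB j W A c) : RB j U (A ∩ U) c := by
  obtain ⟨e, he, heW, hr⟩ := h
  obtain ⟨N, hN⟩ := small_chains oU oA (c := e) (by rwa [hUA])
  obtain ⟨H, H1, H2, H3⟩ := exists_SS_homotopy (X := X) N
  obtain ⟨p, q, hp, hq, hpq, -, hpd⟩ := split_sup (hN N le_rfl)
  obtain ⟨dp, dq⟩ := hpd _ (SS_pow_Deg he N)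
  have hU : p + H c ∈ Cin U := Submodule.add_mem _ hp (H2 _ _ hcU)
  refine ⟨p + H c, Submodule.add_mem _ dp (H3 _ _ hc), hU, ?_⟩
  rw [Cin_inter]
  refine ⟨?_, Submodule.sub_mem _ hcU (dd_Cin hU)⟩
  have e1 : c - dd (p + H c) = (SS ^ N) (c - dd e) + dd q + H (dd c) := by
    have e2 : (SS ^ N) (dd e) = dd p + dd q := by rw [← dd_SS_pow, hpq, map_add]
    have e3 : c = dd (H c) + H (dd c) + (SS ^ N) c := by rw [H1]; abel
    rw [map_sub, e2, map_add]
    nth_rewrite 1 [e3]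
    abel
  rw [e1]
  exact Submodule.add_mem _ (Submodule.add_mem _ (SS_pow_Cin hr N) (dd_Cin hq)) (H2 _ _ hcA)

/-- Up to relative boundaries, a cycle modulo the complement of `K` lives near `K`. -/
lemma exists_local {j : ℤ} {U A : Set X} (oU : IsOpen U) (oA : IsOpen A)
    (hUA : U ∪ A = Set.univ) {c : Ch X} (hc : c ∈ Deg X j) (hcA : dd c ∈ Cin A) :
    ∃ b ∈ Deg X j, b ∈ Cin U ∧ dd b ∈ Cin A ∧ RB j Set.univ A (c - b) := by
  obtain ⟨N, hN⟩ := small_chains oU oA (c := c) (by rw [hUA]; simp)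
  obtain ⟨H, H1, H2, H3⟩ := exists_SS_homotopy (X := X) N
  obtain ⟨p, q, hp, hq, hpq, -, hpd⟩ := split_sup (hN N le_rfl)
  obtain ⟨dp, dq⟩ := hpd _ (SS_pow_Deg hc N)
  refine ⟨p, dp, hp, ?_, H c, H3 _ _ hc, by simp, ?_⟩
  · have : dd p = (SS ^ N) (dd c) - dd q := by rw [← dd_SS_pow, hpq, map_add]; abel
    rw [this]
    exact Submodule.sub_mem _ (SS_pow_Cin hcA N) (dd_Cin hq)
  · have : c - p - dd (H c) = q + H (dd c) := by
      have e3 : c = dd (H c) + H (dd c) + (SS ^ N) c := by rw [H1]; abel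
      nth_rewrite 1 [e3]
      rw [hpq]
      abel
    rw [this]
    exact Submodule.add_mem _ hq (H2 _ _ hcA)

variable [T2Space X] {n : ℕ}

lemma union_compl_image {ψ : (Fin n → ℝ) → X} {K : Set (Fin n → ℝ)} :
    Set.range ψ ∪ (ψ '' K)ᶜ = Set.univ := by
  rw [Set.eq_univ_iff_forall]
  intro x
  by_cases h : x ∈ ψ '' K
  · exact Or.inl (Set.image_subset_range _ _ h)
  · exact Or.inr h

lemma chart_transfer {ψ : (Fin n → ℝ) → X} (hψ : Topology.IsOpenEmbedding ψ) {j : ℤ}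
    {K : Set (Fin n → ℝ)} (hK : IsCompact K) {c : Ch X} (hc : c ∈ Deg X j)
    (hcK : dd c ∈ Cin (ψ '' K)ᶜ) :
    ∃ b ∈ Deg (Fin n → ℝ) j, dd b ∈ Cin Kᶜ ∧
      (∀ x ∈ K, RB j Set.univ {ψ x}ᶜ c → RB j Set.univ {x}ᶜ b) ∧
      (RB j Set.univ Kᶜ b → RB j Set.univ (ψ '' K)ᶜ c) ∧
      RB j Set.univ (ψ '' K)ᶜ (c - push ψ b) := by
  have oK : IsOpen (ψ '' K)ᶜ := (hK.image hψ.continuous).isClosed.isOpen_compl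
  obtain ⟨b, hb, hbU, hbK, hbc⟩ := exists_local hψ.isOpen_range oK union_compl_image hc hcK
  have hcg := continuousOn_invFun hψ
  have hm : ∀ S : Set (Fin n → ℝ), Set.MapsTo (Function.invFun ψ) ((ψ '' S)ᶜ ∩ Set.range ψ) Sᶜ := by
    rintro S _ ⟨hx, ⟨y, rfl⟩⟩ hy
    rw [invFun_emb hψ] at hy
    exact hx ⟨y, hy, rfl⟩
  have hpb : push ψ (push (Function.invFun ψ) b) = b := by
    rw [push_push hcg hbU, push_congr (g := fun x => x) (fun x hx => emb_invFun hx) hbU, push_id]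
  have hlast : RB j Set.univ (ψ '' K)ᶜ (c - push ψ (push (Function.invFun ψ) b)) := by rwa [hpb]
  refine ⟨push (Function.invFun ψ) b, push_Deg _ hb, ?_, fun x hx hR => ?_, fun hR => ?_, hlast⟩
  · rw [dd_push hcg hbU]
    refine push_Cin (hm K) ?_
    rw [Cin_inter]
    exact ⟨hbK, dd_Cin hbU⟩
  · have hxK : (ψ '' K)ᶜ ⊆ ({ψ x}ᶜ : Set X) := fun y hy h' => hy ⟨x, hx, h'.symm⟩
    have h1 : RB j Set.univ {ψ x}ᶜ b := by
      have := hR.sub (hbc.mono subset_rfl hxK)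
      rwa [sub_sub_cancel] at this
    have hu : Set.range ψ ∪ ({ψ x}ᶜ : Set X) = Set.univ := by
      rw [← Set.image_singleton]; exact union_compl_image
    have h2 := RB_excise hψ.isOpen_range isOpen_compl_singleton hu hb hbU (Cin_mono hxK hbK) h1
    refine h2.push hcg (fun _ _ => trivial) ?_
    have := hm {x}
    rwa [Set.image_singleton] at this
  · have h1 := hR.push (f := ψ) (W' := Set.univ) (A' := (ψ '' K)ᶜ) hψ.continuous.continuousOn (fun _ _ => trivial)
      (fun y hy h' => hy ((hψ.injective.mem_set_image).1 h'))
    have := hlast.add h1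
    rwa [sub_add_cancel] at this

theorem RB_chart {ψ : (Fin n → ℝ) → X} (hψ : Topology.IsOpenEmbedding ψ) {j : ℤ}
    (hj : (n : ℤ) ≤ j) {K : Set X} (hK : IsCompact K) (hKψ : K ⊆ Set.range ψ) {c : Ch X}
    (hc : c ∈ Deg X j) (hcK : dd c ∈ Cin Kᶜ) (h : ∀ x ∈ K, RB j Set.univ {x}ᶜ c) :
    RB j Set.univ Kᶜ c := by
  obtain ⟨K', rfl⟩ := Set.subset_range_iff_exists_image_eq.1 hKψ
  have hK' : IsCompact K' := (hψ.isInducing.isCompact_iff).2 hK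
  obtain ⟨b, hb, hbK, h1, h2, -⟩ := chart_transfer hψ hK' hc hcK
  exact h2 (RB_compact hj hK' hb hbK fun x hx => h1 x hx (h _ (Set.mem_image_of_mem _ hx)))

lemma RB_chart_convex {ψ : (Fin n → ℝ) → X} (hψ : Topology.IsOpenEmbedding ψ) {j : ℤ}
    {K : Set (Fin n → ℝ)} (hK : IsCompact K) (hKc : Convex ℝ K) {c : Ch X}
    (hc : c ∈ Deg X j) (hcK : dd c ∈ Cin (ψ '' K)ᶜ) {x : Fin n → ℝ} (hx : x ∈ K)
    (h : RB j Set.univ {ψ x}ᶜ c) : RB j Set.univ (ψ '' K)ᶜ c := by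
  obtain ⟨b, hb, hbK, h1, h2, -⟩ := chart_transfer hψ hK hc hcK
  exact h2 (RB_convex hKc hK hx hb hbK (h1 x hx h))

lemma GV_chart_point {ψ : (Fin n → ℝ) → X} (hψ : Topology.IsOpenEmbedding ψ) (x : Fin n → ℝ)
    {j : ℤ} {F : Submodule ℚ (Ch (Fin n → ℝ))} (h : GV j Set.univ {x}ᶜ F) :
    GV j Set.univ ({ψ x}ᶜ : Set X) (F.map (push ψ)) := by
  have h1 := GV_emb hψ h
  rw [Set.image_univ] at h1
  have h2 : ψ '' {x}ᶜ = {ψ x}ᶜ ∩ Set.range ψ := by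
    ext y
    constructor
    · rintro ⟨z, hz, rfl⟩
      exact ⟨fun h' => hz (hψ.injective h'), z, rfl⟩
    · rintro ⟨hy, z, rfl⟩
      exact ⟨z, fun h' => hy (congrArg ψ h'), rfl⟩
  rw [h2] at h1
  have h3 := GV_excision hψ.isOpen_range isOpen_compl_singleton h1
  have hu : ({ψ x}ᶜ : Set X) ∪ Set.range ψ = Set.univ := by
    rw [Set.union_comm, ← Set.image_singleton]; exact union_compl_image
  rwa [hu] at h3

lemma HV_chart_point {ψ : (Fin n → ℝ) → X} (hψ : Topology.IsOpenEmbedding ψ) (x : Fin n → ℝ)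
    {j : ℤ} (hj : j ≠ n) : HV j Set.univ ({ψ x}ᶜ : Set X) := by
  have := GV_chart_point hψ x (HV_point x hj)
  rwa [Submodule.map_bot] at this

end

/-! ### Atlases -/

/-- A finite collection of charts whose unit balls cover. -/
structure Atl (n : ℕ) (M : Type) [TopologicalSpace M] where
  /-- Index type. -/
  ι : Type
  /-- Finiteness. -/
  fin : Fintype ι
  /-- The inverse charts. -/
  ψ : ι → (Fin n → ℝ) → M
  emb : ∀ s, Topology.IsOpenEmbedding (ψ s)
  cov : ∀ x, ∃ s, ∃ v, ‖v‖ < 1 ∧ ψ s v = x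

theorem exists_atl (n : ℕ) (M : Type) [TopologicalSpace M]
    [ChartedSpace (EuclideanSpace ℝ (Fin n)) M] [CompactSpace M] : Nonempty (Atl n M) := by
  have key : ∀ x : M, ∃ ψ : (Fin n → ℝ) → M, Topology.IsOpenEmbedding ψ ∧ ψ 0 = x := by
    intro x
    set e := chartAt (EuclideanSpace ℝ (Fin n)) x
    obtain ⟨r, hr, hrt⟩ := Metric.isOpen_iff.1 e.open_target _ (mem_chart_target _ x)
    set u := OpenPartialHomeomorph.univBall (e x) r with hu
    set f := u.trans e.symm with hf
    have hfs : f.source = Set.univ := by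
      rw [hf, OpenPartialHomeomorph.trans_source, OpenPartialHomeomorph.univBall_source,
        Set.univ_inter, Set.eq_univ_iff_forall]
      intro y
      refine hrt ?_
      rw [← OpenPartialHomeomorph.univBall_target (e x) hr]
      exact u.map_source (by simp [hu])
    set h := (EuclideanSpace.equiv (Fin n) ℝ).toHomeomorph.symm
    refine ⟨f ∘ h, (f.isOpenEmbedding hfs).comp h.isOpenEmbedding, ?_⟩
    have h0 : h 0 = 0 := (EuclideanSpace.equiv (Fin n) ℝ).symm.map_zero
    have : f (h 0) = e.symm (u 0) := by rw [h0]; rfl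
    rw [Function.comp_apply, this, hu, OpenPartialHomeomorph.univBall_apply_zero]
    exact e.left_inv (mem_chart_source _ x)
  choose ψ hψ h0 using key
  obtain ⟨t, ht⟩ := isCompact_univ.elim_nhds_subcover (fun x => ψ x '' Metric.ball 0 1)
    fun x _ => by
      have := (hψ x).image_mem_nhds (x := 0) |>.2 (Metric.ball_mem_nhds 0 one_pos)
      rwa [h0] at this
  refine ⟨⟨t, inferInstance, fun s => ψ s, fun s => hψ s, fun x => ?_⟩⟩
  have := ht.2 (Set.mem_univ x)
  simp only [Set.mem_iUnion₂] at this
  obtain ⟨s, hs, v, hv, rfl⟩ := this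
  exact ⟨⟨s, hs⟩, v, by simpa using hv, rfl⟩

attribute [instance] Atl.fin

section
variable {n : ℕ} {M : Type} [TopologicalSpace M] [T2Space M]

lemma Atl.HV_point (𝒜 : Atl n M) {j : ℤ} (hj : j ≠ n) (x : M) : HV j Set.univ ({x}ᶜ : Set M) := by
  obtain ⟨s, v, -, rfl⟩ := 𝒜.cov x
  exact HV_chart_point (𝒜.emb s) v hj

lemma Atl.RB_union (𝒜 : Atl n M) (s : Finset 𝒜.ι) : ∀ (j : ℤ), (n : ℤ) ≤ j →
    ∀ K : 𝒜.ι → Set M, (∀ i, IsCompact (K i)) → (∀ i, K i ⊆ Set.range (𝒜.ψ i)) →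
    ∀ c ∈ Deg M j, dd c ∈ Cin (⋃ i ∈ s, K i)ᶜ →
    (∀ x ∈ ⋃ i ∈ s, K i, RB j Set.univ {x}ᶜ c) → RB j Set.univ (⋃ i ∈ s, K i)ᶜ c := by
  classical
  induction s using Finset.induction_on with
  | empty =>
    intro j _ K _ _ c _ _ _
    exact RB_of_mem (by simp)
  | insert a s ha ih =>
    intro j hj K hK hKψ c hc hcK hR
    rw [Finset.set_biUnion_insert] at hR
    rw [Finset.set_biUnion_insert, Set.compl_union] at hcK ⊢
    have hcK' := hcK
    rw [Cin_inter] at hcK'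
    have hKs : IsCompact (⋃ i ∈ s, K i) := s.isCompact_biUnion fun i _ => hK i
    obtain ⟨e₁, d₁, w₁, r₁⟩ := RB_chart (𝒜.emb a) hj (hK a) (hKψ a) hc hcK'.1
      fun x hx => hR x (Or.inl hx)
    obtain ⟨e₂, d₂, w₂, r₂⟩ := ih j hj K hK hKψ c hc hcK'.2 fun x hx => hR x (Or.inr hx)
    refine rel_boundary_inter (hK a).isClosed.isOpen_compl hKs.isClosed.isOpen_compl
      (Set.subset_univ _) ?_ hc (by simp) hcK d₁ w₁ r₁ d₂ w₂ r₂
    rw [← Set.compl_inter, HV_iff_RB]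
    intro c' hc' _ hcK'
    refine RB_chart (𝒜.emb a) (by omega) ((hK a).inter hKs)
      (Set.inter_subset_left.trans (hKψ a)) hc' hcK' fun x hx => ?_
    exact HV_iff_RB.1 (𝒜.HV_point (by omega) x) c' hc' (by simp) (Cin_mono (by simpa using hx) hcK')

theorem Atl.RB_of_point (𝒜 : Atl n M) {j : ℤ} (hj : (n : ℤ) ≤ j) {c : Ch M} (hc : c ∈ Deg M j) (hdc : dd c = 0)
    (h : ∀ x, RB j Set.univ {x}ᶜ c) : RB j Set.univ ∅ c := by
  have hU : (⋃ i ∈ (Finset.univ : Finset 𝒜.ι), 𝒜.ψ i '' Metric.closedBall 0 1) = Set.univ := by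
    rw [Set.eq_univ_iff_forall]
    intro x
    obtain ⟨s, v, hv, rfl⟩ := 𝒜.cov x
    exact Set.mem_biUnion (Finset.mem_univ s) ⟨v, by simpa using hv.le, rfl⟩
  have := 𝒜.RB_union Finset.univ j hj (fun i => 𝒜.ψ i '' Metric.closedBall 0 1)
    (fun i => (isCompact_closedBall _ _).image (𝒜.emb i).continuous)
    (fun i => Set.image_subset_range _ _) c hc (by simp [hdc]) (fun x _ => h x)
  rwa [hU, Set.compl_univ] at this

theorem Atl.HV_gt (𝒜 : Atl n M) {j : ℤ} (hj : (n : ℤ) < j) : HV j Set.univ (∅ : Set M) :=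
  HV_iff_RB.2 fun c hc _ hdc => by
    rw [Cin_empty, Submodule.mem_bot] at hdc
    exact 𝒜.RB_of_point hj.le hc hdc fun x =>
      HV_iff_RB.1 (𝒜.HV_point hj.ne' x) c hc (by simp) (by simp [hdc])

/-- A nonbounding top-dimensional cycle on a connected manifold is locally nontrivial. -/
theorem Atl.not_RB_point [ConnectedSpace M] (𝒜 : Atl n M) {μ : Ch M} (hμ : μ ∈ Deg M n) (hdμ : dd μ = 0)
    (h : ¬ RB n Set.univ ∅ μ) (x : M) : ¬ RB n Set.univ {x}ᶜ μ := by
  set T : Set M := {x | RB n Set.univ {x}ᶜ μ} with hT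
  have hopen : IsOpen T := by
    rw [isOpen_iff_mem_nhds]
    rintro x ⟨e, he, hw, hr⟩
    obtain ⟨L, hL, hLc, hLA⟩ := exists_support (μ - dd e)
    have : Lᶜ ∈ nhds x := hL.isClosed.isOpen_compl.mem_nhds fun hx => hLA _ hr hx rfl
    filter_upwards [this] with y hy
    exact ⟨e, he, hw, Cin_mono (B := {y}ᶜ) (fun z hz (h' : z = y) => hy (h' ▸ hz)) hLc⟩
  have hclosed : IsClosed T := by
    rw [← isOpen_compl_iff, isOpen_iff_mem_nhds]
    intro y hy
    obtain ⟨s, v, -, rfl⟩ := 𝒜.cov y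
    have := ((𝒜.emb s).image_mem_nhds (x := v)).2 (Metric.closedBall_mem_nhds v one_pos)
    filter_upwards [this]
    rintro _ ⟨w, hw, rfl⟩ hwT
    refine hy ((RB_chart_convex (𝒜.emb s) (isCompact_closedBall v 1) (convex_closedBall v 1) hμ
      (by simp [hdμ]) hw hwT).mono subset_rfl ?_)
    rintro z hz rfl
    exact hz ⟨v, Metric.mem_closedBall_self zero_le_one, rfl⟩
  rcases isClopen_iff.1 ⟨hclosed, hopen⟩ with h0 | h1
  · intro hx
    have : x ∈ T := hx
    rw [h0] at this
    exact this
  · exact absurd (𝒜.RB_of_point le_rfl hμ hdμ fun y => (h1.symm ▸ trivial : y ∈ T)) h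

end

end

section

open Cvx

/-! ### Transfer for finite regular coverings -/

section
variable {E B G : Type} [TopologicalSpace E] [TopologicalSpace B] [Group G] [Fintype G]
  [MulAction G E]

/-- Unique lifting of simplices up to a finite group. -/
structure IsCov (G : Type) [Group G] [Fintype G] [MulAction G E] (π : E → B) : Prop where
  cont : Continuous π
  act : ∀ g : G, Continuous fun x : E => g • x
  inv : ∀ (g : G) (x : E), π (g • x) = π x
  lift : ∀ {n : ℕ} (σ : C(Dl n, B)), ∃ τ : C(Dl n, E), ∀ t, π (τ t) = σ t
  uniq : ∀ {n : ℕ} (τ τ' : C(Dl n, E)), (∀ t, π (τ t) = π (τ' t)) → ∃ g : G, ∀ t, τ' t = g • τ t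

lemma IsCov.of_isQuotientCoveringMap {π : E → B} (h : IsQuotientCoveringMap π G)
    (hc : IsCoveringMap π) : IsCov G π where
  cont := h.continuous
  act g := h.continuous_const_smul g
  inv g x := h.map_smul g
  lift {n} σ := by
    have : ContractibleSpace (Dl n) := (convex_stdSimplex ℝ _).contractibleSpace
      ⟨_, (stdSimplex.vertex 0 : Dl n).2⟩
    have : LocallyPathConnectedSpace (Dl n) := (convex_stdSimplex ℝ _).locallyPathConnectedSpace
    obtain ⟨e, he⟩ := h.surjective (σ (stdSimplex.vertex 0))
    obtain ⟨F, ⟨-, hF⟩, -⟩ := hc.existsUnique_continuousMap_lifts σ (stdSimplex.vertex 0) e he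
    exact ⟨F, congrFun hF⟩
  uniq {n} τ τ' hτ := by
    have : ContractibleSpace (Dl n) := (convex_stdSimplex ℝ _).contractibleSpace
      ⟨_, (stdSimplex.vertex 0 : Dl n).2⟩
    obtain ⟨g, hg⟩ := h.apply_eq_iff_mem_orbit.1 (hτ (stdSimplex.vertex 0)).symm
    refine ⟨g, congrFun (hc.eq_of_comp_eq τ'.continuous
      ((h.continuous_const_smul g).comp τ.continuous) ?_ (stdSimplex.vertex 0) hg.symm)⟩
    ext t
    exact (hτ t).symm.trans (h.map_smul g).symm

variable {π : E → B}

/-- Sum over the group. -/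
def gsum (G : Type) [Group G] [Fintype G] [MulAction G E] : Ch E →ₗ[ℚ] Ch E :=
  ∑ g : G, push fun x : E => g • x

lemma gsum_apply (c : Ch E) : gsum G c = ∑ g : G, push (fun x : E => g • x) c := by
  simp [gsum]

/-- The transfer: sum over all lifts. -/
def tr (h : IsCov G π) : Ch B →ₗ[ℚ] Ch E := lin fun σ => gsum G (sx (h.lift σ.2).choose)

lemma gsum_sx (h : IsCov G π) {n : ℕ} {τ τ' : C(Dl n, E)} (hτ : ∀ t, π (τ t) = π (τ' t)) :
    gsum G (sx τ) = gsum G (sx τ') := by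
  obtain ⟨g, hg⟩ := h.uniq τ τ' hτ
  rw [gsum_apply, gsum_apply, ← Equiv.sum_comp (Equiv.mulRight g)]
  refine Finset.sum_congr rfl fun g' _ => ?_
  rw [push_sx', push_sx']
  congr 1
  ext t
  rw [hg, Equiv.coe_mulRight, mul_smul]

lemma tr_sx (h : IsCov G π) {n : ℕ} (σ : C(Dl n, B)) (τ : C(Dl n, E)) (hτ : ∀ t, π (τ t) = σ t) :
    tr h (sx σ) = gsum G (sx τ) := by
  rw [tr, lin_sx]
  exact gsum_sx h fun t => ((h.lift σ).choose_spec t).trans (hτ t).symm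

lemma tr_R (h : IsCov G π) {D : Type} [TopologicalSpace D] [Cvx D] (σ : C(D, B)) (τ : C(D, E))
    (hτ : ∀ t, π (τ t) = σ t) (c : LCh D) : tr h (R σ c) = gsum G (R τ c) :=
  lin_ext_apply (F := tr h ∘ₗ R σ) (G := gsum G ∘ₗ R τ) (fun l => by
    change tr h (R σ (ls l)) = gsum G (R τ (ls l))
    rcases eq_or_ne l [] with rfl | hl
    · simp
    · obtain ⟨n, v, rfl⟩ := exists_ofFn hl
      rw [R_ofFn, R_ofFn]
      exact tr_sx h _ _ fun t => hτ _) c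

lemma dd_gsum (h : IsCov G π) (c : Ch E) : dd (gsum G c) = gsum G (dd c) := by
  simp only [gsum_apply, map_sum]
  exact Finset.sum_congr rfl fun g _ => dd_push (h.act g).continuousOn (A := Set.univ) (by simp)

lemma dd_tr (h : IsCov G π) (c : Ch B) : dd (tr h c) = tr h (dd c) :=
  sx_ext (F := dd ∘ₗ tr h) (G := tr h ∘ₗ dd) (fun n σ => by
    change dd (tr h (sx σ)) = tr h (dd (sx σ))
    obtain ⟨τ, hτ⟩ := h.lift σ
    rw [tr_sx h σ τ hτ, dd_sx, dd_gsum h, dd_sx, tr_R h σ τ hτ]) c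

lemma tr_Deg (h : IsCov G π) {j : ℤ} {c : Ch B} (hc : c ∈ Deg B j) : tr h c ∈ Deg E j :=
  map_mem_of_Deg (fun n σ hn => by
    obtain ⟨τ, hτ⟩ := h.lift σ
    rw [tr_sx h σ τ hτ, gsum_apply, ← hn]
    exact Submodule.sum_mem _ fun g _ => push_Deg _ (sx_mem_Deg τ)) hc

lemma push_tr (h : IsCov G π) (c : Ch B) : push π (tr h c) = (Fintype.card G : ℚ) • c :=
  sx_ext (F := push π ∘ₗ tr h) (G := (Fintype.card G : ℚ) • LinearMap.id) (fun n σ => by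
    change push π (tr h (sx σ)) = (Fintype.card G : ℚ) • sx σ
    obtain ⟨τ, hτ⟩ := h.lift σ
    have key : ∀ g : G, push π (push (fun x : E => g • x) (sx τ)) = sx σ := fun g => by
      rw [push_push (h.act g).continuousOn (A := Set.univ) (by simp), push_sx']
      have : (fun t => π (g • τ t)) = σ := funext fun t => (h.inv g _).trans (hτ t)
      rw [this, sxd_eq σ.continuous]; rfl
    rw [tr_sx h σ τ hτ, gsum_apply, map_sum, Finset.sum_congr rfl fun g _ => key g,
      Finset.sum_const, Finset.card_univ, Nat.cast_smul_eq_nsmul]) c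

lemma tr_push (h : IsCov G π) (c : Ch E) : tr h (push π c) = gsum G c :=
  sx_ext (F := tr h ∘ₗ push π) (G := gsum G) (fun n τ => by
    change tr h (push π (sx τ)) = gsum G (sx τ)
    rw [push_sx (f := π) (h.cont.comp τ.continuous)]
    exact tr_sx h _ τ fun t => rfl) c

end

/-! ### Configuration spaces -/

section
variable {M : Type} [TopologicalSpace M] [T2Space M] {k : ℕ}

instance : MulAction (Equiv.Perm (Fin k)) (orderedConfig M k) where
  smul g f := ⟨f.1 ∘ g.symm, f.2.comp g.symm.injective⟩
  one_smul _ := rfl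
  mul_smul _ _ _ := rfl

/-- The quotient map of the configuration spaces. -/
def confQ (M : Type) [TopologicalSpace M] (k : ℕ) : orderedConfig M k → unorderedConfig M k :=
  Quot.mk _

lemma confQ_eq {f g : orderedConfig M k} :
    confQ M k f = confQ M k g ↔ ∃ σ : Equiv.Perm (Fin k), g.1 = f.1 ∘ σ := by
  have he : Equivalence
      (fun f g : orderedConfig M k => ∃ σ : Equiv.Perm (Fin k), g.1 = f.1 ∘ σ) := by
    refine ⟨fun f => ⟨1, rfl⟩, fun {f g} ⟨σ, h⟩ => ⟨σ.symm, ?_⟩, fun {f g l} ⟨σ, h⟩ ⟨τ, h'⟩ =>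
      ⟨τ.trans σ, ?_⟩⟩
    · rw [h, Function.comp_assoc]; simp
    · rw [h', h]; rfl
  exact (Quot.eq.trans he.eqvGen_iff)

lemma confQ_isQuotientCoveringMap :
    IsQuotientCoveringMap (confQ M k) (Equiv.Perm (Fin k)) where
  __ := (isQuotientMap_quot_mk : Topology.IsQuotientMap (confQ M k))
  continuous_const_smul g := by
    refine Continuous.subtype_mk (p := Function.Injective) ?_ _
    exact continuous_pi fun i => (continuous_apply _).comp continuous_subtype_val
  apply_eq_iff_mem_orbit {f g} := by
    rw [eq_comm, confQ_eq, MulAction.mem_orbit_iff]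
    constructor
    · rintro ⟨σ, h⟩
      exact ⟨σ.symm, Subtype.ext h.symm⟩
    · rintro ⟨σ, h⟩
      exact ⟨σ.symm, (congrArg Subtype.val h).symm⟩
  disjoint f := by
    obtain ⟨U, hU, hd⟩ := (Set.finite_range f.1).t2_separation
    refine ⟨{g | ∀ i, g.1 i ∈ U (f.1 i)}, ?_, ?_⟩
    · refine IsOpen.mem_nhds ?_ fun i => (hU _).1
      rw [Set.ofPred_forall]
      exact isOpen_iInter_of_finite fun i => (hU (f.1 i)).2.preimage
        ((continuous_apply i).comp continuous_subtype_val)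
    · rintro σ ⟨_, ⟨g, hg, rfl⟩, hg'⟩
      refine Equiv.ext fun i => ?_
      by_contra hne
      have h1 := hg i
      have h2 : g.1 (σ.symm (σ i)) ∈ U (f.1 (σ i)) := hg' (σ i)
      rw [Equiv.symm_apply_apply] at h2
      exact Set.disjoint_left.1 (hd ⟨i, rfl⟩ ⟨σ i, rfl⟩ fun h => hne (f.2 h).symm) h1 h2

lemma confQ_isCov : IsCov (Equiv.Perm (Fin k)) (confQ M k) :=
  .of_isQuotientCoveringMap confQ_isQuotientCoveringMap confQ_isQuotientCoveringMap.isCoveringMap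

lemma isOpen_injective : IsOpen {f : Fin k → M | Function.Injective f} := by
  have : {f : Fin k → M | Function.Injective f} = ⋂ i, ⋂ j, {f | i ≠ j → f i ≠ f j} := by
    ext f
    simp only [Set.mem_iInter, Set.mem_ofPred_eq]
    exact ⟨fun h i j hij h' => hij (h h'), fun h i j h' => by_contra fun hij => h i j hij h'⟩
  rw [this]
  refine isOpen_iInter_of_finite fun i => isOpen_iInter_of_finite fun j => ?_
  by_cases hij : i = j
  · simp [hij]
  · simp only [ne_eq, hij, not_false_eq_true, true_imp_iff]
    exact (isClosed_eq (continuous_apply i) (continuous_apply j)).isOpen_compl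

/-- The inclusion of the ordered configuration space. -/
def cval (f : orderedConfig M k) : Fin k → M := f.1

lemma isOpenEmbedding_val : Topology.IsOpenEmbedding (cval : orderedConfig M k → Fin k → M) :=
  isOpen_injective.isOpenEmbedding_subtypeVal

/-- The homology of ordered configuration spaces vanishes in high degrees. -/
theorem HV_ordered {n : ℕ} (𝒜 : Atl n M) (k : ℕ) :
    ∃ J : ℕ, ∀ j : ℤ, J < j → HV j Set.univ (∅ : Set (orderedConfig M k)) := by
  classical
  obtain ⟨Θ⟩ : Nonempty ((Fin (k * n) → ℝ) ≃ₜ (Fin k → Fin n → ℝ)) :=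
    ⟨(ContinuousLinearEquiv.ofFinrankEq (𝕜 := ℝ) (by simp [Module.finrank_pi_fintype])).toHomeomorph⟩
  have hψ : ∀ s : Fin k → 𝒜.ι, Topology.IsOpenEmbedding ((Pi.map fun i => 𝒜.ψ (s i)) ∘ Θ) :=
    fun s => (Topology.IsOpenEmbedding.piMap fun i => 𝒜.emb (s i)).comp Θ.isOpenEmbedding
  refine ⟨k * n + Fintype.card (Fin k → 𝒜.ι), fun j hj => HV_iff_RB.2 fun c hc _ hdc => ?_⟩
  rw [Cin_empty, Submodule.mem_bot] at hdc
  rcases isEmpty_or_nonempty (orderedConfig M k) with hE | hE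
  · exact RB_of_mem (by rw [← Set.eq_empty_of_isEmpty Set.univ]; simp)
  have hcW : push cval c ∈ Cin {f : Fin k → M | Function.Injective f} :=
    push_Cin (A := Set.univ) (fun x _ => x.2) (by simp)
  have hv := (HV_iff_RB.1 (HV_charts hψ Finset.univ j
    (by rw [Finset.card_univ]; push_cast at hj ⊢; exact hj) _
    isOpen_injective ?_)) (push cval c) (push_Deg _ hc) hcW ?_
  · obtain ⟨e, he, hw, hr⟩ := hv
    have hg : ContinuousOn (Function.invFun (cval (M := M) (k := k)))
        {f : Fin k → M | Function.Injective f} :=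
      (continuousOn_invFun isOpenEmbedding_val).mono fun f hf => ⟨⟨f, hf⟩, rfl⟩
    refine ⟨push (Function.invFun cval) e, push_Deg _ he, by simp, ?_⟩
    rw [Cin_empty, Submodule.mem_bot] at hr ⊢
    rw [dd_push hg hw, ← sub_eq_zero.1 hr, push_push (f := cval) (A := Set.univ)
      isOpenEmbedding_val.continuous.continuousOn (by simp),
      push_congr (g := fun x => x) (A := Set.univ) (fun x _ => invFun_emb isOpenEmbedding_val x)
      (by simp), push_id, sub_self]
  · intro f _
    choose s v _ hv using fun i => 𝒜.cov (f i)
    refine Set.mem_biUnion (Finset.mem_univ s) ?_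
    refine ⟨Θ.symm v, ?_⟩
    simp only [Function.comp_apply, Homeomorph.apply_symm_apply]
    exact funext hv
  · rw [dd_push (f := cval) (A := Set.univ) isOpenEmbedding_val.continuous.continuousOn (by simp),
      hdc, map_zero]
    exact zero_mem _

/-- The homology of unordered configuration spaces vanishes in high degrees. -/
theorem HV_unordered {n : ℕ} (𝒜 : Atl n M) (k : ℕ) :
    ∃ J : ℕ, ∀ j : ℤ, J < j → HV j Set.univ (∅ : Set (unorderedConfig M k)) := by
  obtain ⟨J, hJ⟩ := HV_ordered 𝒜 k
  refine ⟨J, fun j hj => HV_iff_RB.2 fun c hc _ hdc => ?_⟩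
  have h := confQ_isCov (M := M) (k := k)
  rw [Cin_empty, Submodule.mem_bot] at hdc
  obtain ⟨e, he, -, hr⟩ := HV_iff_RB.1 (hJ j hj) (tr h c) (tr_Deg h hc) (by simp)
    (by rw [dd_tr, hdc, map_zero]; exact zero_mem _)
  rw [Cin_empty, Submodule.mem_bot, sub_eq_zero] at hr
  refine ⟨(Fintype.card (Equiv.Perm (Fin k)) : ℚ)⁻¹ • push (confQ M k) e,
    Submodule.smul_mem _ _ (push_Deg _ he), by simp, ?_⟩
  rw [map_smul, dd_push h.cont.continuousOn (A := Set.univ) (by simp), ← hr, push_tr, smul_smul,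
    inv_mul_cancel₀ (by exact_mod_cast Fintype.card_ne_zero), one_smul, sub_self]
  exact zero_mem _

end

end

section

open Cvx

/-! ### Comparison with Mathlib's singular chain complex -/

lemma bd_ofFn {D : Type} {n : ℕ} (v : Fin (n + 1) → D) :
    bd (ls (List.ofFn v)) =
      ∑ i : Fin (n + 1), (-1 : ℚ) ^ (i : ℕ) • ls (List.ofFn (v ∘ i.succAbove)) := by
  induction n with
  | zero => simp [bd_cons]
  | succ n ih =>
    rw [List.ofFn_succ, bd_cons, ih, map_sum, Fin.sum_univ_succ (n := n + 1), sub_eq_add_neg,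
      ← Finset.sum_neg_distrib]
    congr 1
    · simp only [Fin.val_zero, pow_zero, one_smul]
      congr 1
    · refine Finset.sum_congr rfl fun i _ => ?_
      rw [map_smul, cone_ls, List.ofFn_succ, Fin.val_succ, pow_succ]
      simp only [mul_neg, mul_one, neg_smul, Function.comp_def, Fin.succ_succAbove_zero,
        Fin.succ_succAbove_succ]

section Compare

variable (X : Type) [TopologicalSpace X]

/-- Singular simplices in Mathlib's sense, as continuous maps. -/
def simplexEquiv (n : ℕ) :
    (TopCat.toSSet.obj (TopCat.of X)).obj (Opposite.op (SimplexCategory.mk n)) ≃ C(Dl n, X) :=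
  TopCat.toSSetObjEquiv (TopCat.of X) (Opposite.op (SimplexCategory.mk n))

/-- The chains of Mathlib's singular complex inside `Ch X`. -/
def toCh (n : ℕ) : (singularChainComplexQ X).X n →ₗ[ℚ] Ch X :=
  Finsupp.linearCombination ℚ
    (α := (TopCat.toSSet.obj (TopCat.of X)).obj (Opposite.op (SimplexCategory.mk n)))
    fun σ => sx (simplexEquiv X n σ)

/-- A simplex as a chain of Mathlib's singular complex. -/
def ofSx {n : ℕ} (σ : C(Dl n, X)) : (singularChainComplexQ X).X n :=
  (Finsupp.single ((simplexEquiv X n).symm σ) (1 : ℚ) :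
    (TopCat.toSSet.obj (TopCat.of X)).obj (Opposite.op (SimplexCategory.mk n)) →₀ ℚ)

lemma toCh_ofSx {n : ℕ} (σ : C(Dl n, X)) : toCh X n (ofSx X σ) = sx σ := by
  refine (Finsupp.linearCombination_single ℚ _ _).trans ?_
  simp

lemma ext_ofSx {N : Type} [AddCommGroup N] [Module ℚ N] {n : ℕ}
    {F G : (singularChainComplexQ X).X n →ₗ[ℚ] N} (h : ∀ σ, F (ofSx X σ) = G (ofSx X σ)) :
    F = G := by
  refine Finsupp.lhom_ext' (R := ℚ) (M := ℚ) (N := N)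
    (α := (TopCat.toSSet.obj (TopCat.of X)).obj (Opposite.op (SimplexCategory.mk n)))
    (φ := F) (ψ := G) fun σ => LinearMap.ext_ring ?_
  have := h (simplexEquiv X n σ)
  rw [ofSx, Equiv.symm_apply_apply] at this
  exact this

/-- The inverse of `toCh` on chains of degree `n`. -/
def fromCh (n : ℕ) : Ch X →ₗ[ℚ] (singularChainComplexQ X).X n :=
  lin fun σ => if h : σ.1 = n then ofSx X (h ▸ σ.2 : C(Dl n, X)) else 0

lemma fromCh_sx {n : ℕ} (σ : C(Dl n, X)) : fromCh X n (sx σ) = ofSx X σ := by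
  simp [fromCh, lin_sx]

lemma fromCh_toCh (n : ℕ) (c : (singularChainComplexQ X).X n) :
    fromCh X n (toCh X n c) = c := by
  have : fromCh X n ∘ₗ toCh X n = LinearMap.id :=
    ext_ofSx X fun σ => by simp [toCh_ofSx, fromCh_sx]
  exact LinearMap.congr_fun this c

lemma toCh_fromCh (n : ℕ) {c : Ch X} (hc : c ∈ Deg X n) : toCh X n (fromCh X n c) = c := by
  refine eq_of_Deg (F := toCh X n ∘ₗ fromCh X n) (G := LinearMap.id) ?_ hc
  intro k σ hk
  have hk' : k = n := by exact_mod_cast hk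
  subst hk'
  simp [toCh_ofSx, fromCh_sx]

lemma toCh_mem (n : ℕ) (c : (singularChainComplexQ X).X n) : toCh X n c ∈ Deg X n := by
  have : (Deg X n).mkQ ∘ₗ toCh X n = 0 := ext_ofSx X fun σ => by
    rw [LinearMap.comp_apply, toCh_ofSx]
    simpa using sx_mem_Deg σ
  simpa using LinearMap.congr_fun this c

lemma comb_succAbove {n : ℕ} (i : Fin (n + 2)) :
    (comb ((stdSimplex.vertex : Fin (n + 2) → Dl (n + 1)) ∘ i.succAbove) : C(Dl n, _)) =
      ⟨stdSimplex.map i.succAbove, stdSimplex.continuous_map _⟩ := by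
  ext t j
  change (∑ l, t l • (stdSimplex.vertex (i.succAbove l) : Fin (n + 2) → ℝ)) j =
    stdSimplex.map i.succAbove t j
  rw [stdSimplex.map_coe, FunOnFinite.linearMap_apply_apply, Finset.sum_apply,
    Finset.sum_filter]
  refine Finset.sum_congr rfl fun l _ => ?_
  simp [stdSimplex.vertex_coe, Pi.single_apply, eq_comm]

lemma alternatingFaceMapComplex_d_apply (Y : SimplicialObject (ModuleCat.{0} ℚ)) (n : ℕ)
    (x : Y.obj (Opposite.op (SimplexCategory.mk (n + 1)))) :
    (((AlgebraicTopology.alternatingFaceMapComplex (ModuleCat ℚ)).obj Y).d (n + 1) n).hom x =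
      ∑ i : Fin (n + 2), (-1 : ℚ) ^ (i : ℕ) • (Y.δ i).hom x := by
  rw [AlgebraicTopology.alternatingFaceMapComplex_obj_d]
  simp only [AlgebraicTopology.AlternatingFaceMapComplex.objD, ModuleCat.hom_sum]
  refine (LinearMap.sum_apply _ _ _).trans (Finset.sum_congr rfl fun i _ => ?_)
  rw [ModuleCat.hom_zsmul]
  refine (LinearMap.smul_apply _ _ _).trans ?_
  rw [← Int.cast_smul_eq_zsmul ℚ]
  push_cast
  rfl

lemma d_ofSx {n : ℕ} (σ : C(Dl (n + 1), X)) :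
    ((singularChainComplexQ X).d (n + 1) n).hom (ofSx X σ) =
      ∑ i : Fin (n + 2), (-1 : ℚ) ^ (i : ℕ) • ofSx X (σ.comp
        (comb ((stdSimplex.vertex : Fin (n + 2) → Dl (n + 1)) ∘ i.succAbove))) := by
  refine (alternatingFaceMapComplex_d_apply _ n _).trans (Finset.sum_congr rfl fun i _ => ?_)
  rw [comb_succAbove]
  refine congrArg (fun z => (-1 : ℚ) ^ (i : ℕ) • z) ?_
  exact ModuleCat.free_map_apply _ _

lemma toCh_d (n : ℕ) (c : (singularChainComplexQ X).X (n + 1)) :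
    toCh X n (((singularChainComplexQ X).d (n + 1) n).hom c) = dd (toCh X (n + 1) c) := by
  have : toCh X n ∘ₗ ((singularChainComplexQ X).d (n + 1) n).hom = dd ∘ₗ toCh X (n + 1) := by
    refine ext_ofSx X fun σ => ?_
    rw [LinearMap.comp_apply, LinearMap.comp_apply, toCh_ofSx, dd_sx, iot, bd_ofFn, map_sum]
    rw [d_ofSx, map_sum]
    refine Finset.sum_congr rfl fun i _ => ?_
    rw [map_smul, map_smul, toCh_ofSx, R_ofFn]
  exact LinearMap.congr_fun this c

lemma exactAt_iff (n : ℕ) : (singularChainComplexQ X).ExactAt n ↔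
    ∀ c ∈ Deg X n, dd c = 0 → RB n Set.univ ∅ c := by
  have key : (singularChainComplexQ X).ExactAt n ↔
      ∀ x : (singularChainComplexQ X).X n, dd (toCh X n x) = 0 →
        ∃ y, ((singularChainComplexQ X).d (n + 1) n).hom y = x := by
    cases n with
    | zero =>
      rw [HomologicalComplex.exactAt_iff' _ 1 0 0 (by simp) (by simp),
        ShortComplex.moduleCat_exact_iff]
      refine forall_congr' fun (x : (singularChainComplexQ X).X 0) => ?_
      refine imp_congr (iff_of_true ?_ ?_) Iff.rfl
      · change ((singularChainComplexQ X).d 0 0).hom x = 0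
        rw [(singularChainComplexQ X).shape 0 0 (by simp)]
        rfl
      · have := dd_Deg (toCh_mem X 0 x)
        exact Deg_of_neg (by simp) this
    | succ n =>
      rw [HomologicalComplex.exactAt_iff' _ (n + 2) (n + 1) n (by simp) (by simp),
        ShortComplex.moduleCat_exact_iff]
      refine forall_congr' fun (x : (singularChainComplexQ X).X (n + 1)) => imp_congr ?_ Iff.rfl
      change ((singularChainComplexQ X).d (n + 1) n).hom x = 0 ↔ _
      rw [← toCh_d]
      refine ⟨fun h => ?_, fun h => ?_⟩
      · erw [h]; simp
      · have := congrArg (fromCh X n) h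
        rw [map_zero] at this
        exact (fromCh_toCh X n _).symm.trans this
  rw [key]
  constructor
  · intro h c hc hd
    obtain ⟨y, hy⟩ := h (fromCh X n c) (by rw [toCh_fromCh X n hc, hd])
    refine ⟨toCh X (n + 1) y, by exact_mod_cast toCh_mem X (n + 1) y, by simp, ?_⟩
    rw [← toCh_d]
    have : toCh X n (((singularChainComplexQ X).d (n + 1) n).hom y) = c := by
      erw [hy]; exact toCh_fromCh X n hc
    rw [this]; simp
  · intro h x hx
    obtain ⟨e, he, -, hr⟩ := h _ (toCh_mem X n x) hx
    refine ⟨fromCh X (n + 1) e, ?_⟩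
    have h1 : toCh X n x = dd e := by simpa [Cin_empty, sub_eq_zero] using hr
    have h2 := toCh_d X n (fromCh X (n + 1) e)
    rw [toCh_fromCh X (n + 1) (by exact_mod_cast he), ← h1] at h2
    have := congrArg (fromCh X n) h2
    rw [fromCh_toCh, fromCh_toCh] at this
    exact this

theorem nontrivial_cohomology_iff (n : ℕ) : Nontrivial (singularCohomologyQ X n) ↔
    ∃ c ∈ Deg X n, dd c = 0 ∧ ¬ RB n Set.univ ∅ c := by
  have h1 : Nontrivial (singularCohomologyQ X n) ↔ Nontrivial (singularHomologyQ X n) :=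
    Module.nontrivial_dual_iff ℚ
  rw [h1, ← not_iff_not, not_nontrivial_iff_subsingleton]
  push Not
  rw [← exactAt_iff, HomologicalComplex.exactAt_iff_isZero_homology,
    ModuleCat.isZero_iff_subsingleton]
  rfl

end Compare

end

section

open Cvx

/-! ### Shuffles and cup products of list chains -/

section
variable {D D' E E' N : Type} [AddCommGroup N] [Module ℚ N]

@[elab_as_elim]
lemma ls_induction {p : LCh D → Prop} (c : LCh D) (zero : p 0) (basis : ∀ l, p (ls l))
    (add : ∀ c c', p c → p c' → p (c + c')) (smul : ∀ (q : ℚ) c, p c → p (q • c)) : p c := by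
  induction c using Finsupp.induction_linear with
  | zero => exact zero
  | add f g hf hg => exact add f g hf hg
  | single a b =>
    rw [show Finsupp.single a b = b • ls a by simp [ls]]
    exact smul b _ (basis a)

/-- The indicator of the empty list. -/
def epl : List D → ℚ
  | [] => 1
  | _ :: _ => 0

/-- The coefficient of the empty list. -/
def eps : LCh D →ₗ[ℚ] ℚ := lin epl

@[simp] lemma eps_ls (l : List D) : eps (ls l) = epl l := by simp [eps]

@[simp] lemma eps_cone (a : D) (c : LCh D) : eps (cone a c) = 0 := by
  induction c using ls_induction with
  | zero => simp
  | basis l => simp [epl]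
  | add c c' h h' => simp [h, h']
  | smul q c h => simp [h]

/-- The sign operator. -/
def sg : LCh D →ₗ[ℚ] LCh D := lin fun l => (-1 : ℚ) ^ l.length • ls l

@[simp] lemma sg_ls (l : List D) : sg (ls l) = (-1 : ℚ) ^ l.length • ls l := by simp [sg]

lemma sg_mem {n : ℕ} {c : LCh D} (hc : c ∈ LDeg D n) : sg c = (-1 : ℚ) ^ n • c := by
  have := map_mem_of_supported (F := sg - (-1 : ℚ) ^ n • LinearMap.id) (P := ⊥)
    (fun l hl => by
      have hl : l.length = n := hl
      change sg (ls l) - (-1 : ℚ) ^ n • ls l ∈ _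
      simp [hl]) hc
  simpa [sub_eq_zero] using this

lemma sg_cone (a : D) (c : LCh D) : sg (cone a c) = - cone a (sg c) := by
  induction c using ls_induction with
  | zero => simp
  | basis l => simp [pow_succ]
  | add c c' h h' => simp [h, h']; abel
  | smul q c h => simp [h]

lemma bd_sg (c : LCh D) : bd (sg c) = - sg (bd c) := by
  induction c using ls_induction with
  | zero => simp
  | basis l =>
    induction l with
    | nil => simp
    | cons a l ih =>
      rw [bd_cons, map_sub, sg_cone, ← cone_ls, sg_cone, map_neg, bd_cone, ih, map_neg]
  | add c c' h h' => simp [h, h']; abel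
  | smul q c h => simp [h]

@[simp] lemma sg_sg (c : LCh D) : sg (sg c) = c := by
  induction c using ls_induction with
  | zero => simp
  | basis l => simp [smul_smul, ← mul_pow]
  | add c c' h h' => simp [h, h']
  | smul q c h => simp [h]

/-- The signed sum of shuffles. -/
def shl : List D → List D' → LCh (D × D')
  | [], _ => 0
  | _ :: _, [] => 0
  | a :: x, b :: y => cone (a, b) (shl x (b :: y) + (-1 : ℚ) ^ x.length • shl (a :: x) y +
      (epl x * epl y) • ls [])
termination_by x y => x.length + y.length

/-- The shuffle product of list chains. -/
def shu : LCh D →ₗ[ℚ] LCh D' →ₗ[ℚ] LCh (D × D') :=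
  lin (N := LCh D' →ₗ[ℚ] LCh (D × D')) fun x => lin (shl x)

lemma shu_ls (x : List D) (y : List D') : shu (ls x) (ls y) = shl x y := by simp [shu]

@[simp] lemma shu_nil_left (y : LCh D') : shu (ls ([] : List D)) y = 0 := by
  induction y using ls_induction with
  | zero => simp
  | basis l => rw [shu_ls, shl]
  | add c c' h h' => simp [h, h']
  | smul q c h => simp [h]

@[simp] lemma shu_nil_right (x : LCh D) : shu x (ls ([] : List D')) = 0 := by
  induction x using ls_induction with
  | zero => simp
  | basis l => cases l <;> simp [shu_ls, shl]
  | add c c' h h' => simp [h, h']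
  | smul q c h => simp [h]

lemma shu_cone (a : D) (b : D') (x : LCh D) (y : LCh D') :
    shu (cone a x) (cone b y) =
      cone (a, b) (shu x (cone b y) + shu (cone a (sg x)) y + (eps x * eps y) • ls []) := by
  induction x using ls_induction with
  | zero => simp
  | basis l =>
    induction y using ls_induction with
    | zero => simp
    | basis l' =>
      rw [cone_ls, cone_ls, shu_ls, shl]
      simp [shu_ls]
    | add c c' h h' => simp only [map_add, h, h', mul_add, add_smul]; abel
    | smul q c h =>
      simp only [map_smul, map_add, h, smul_add, smul_smul, smul_eq_mul]; ring_nf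
  | add c c' h h' => simp only [map_add, LinearMap.add_apply, h, h', add_mul, add_smul]; abel
  | smul q c h =>
    simp only [map_smul, map_add, LinearMap.smul_apply, h, smul_add, smul_smul, smul_eq_mul]
    ring_nf

lemma bd_shu_cone {a : D} {b : D'} {X : LCh D} {Y : LCh D'}
    (h1 : bd (shu X (cone b Y)) = shu (bd X) (cone b Y) - shu (sg X) (bd (cone b Y)) +
      (eps (bd X) * eps (bd (cone b Y))) • ls [])
    (h3 : bd (shu (cone a (sg X)) Y) = shu (bd (cone a (sg X))) Y -
      shu (sg (cone a (sg X))) (bd Y) + (eps (bd (cone a (sg X))) * eps (bd Y)) • ls []) :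
    bd (shu (cone a X) (cone b Y)) = shu (bd (cone a X)) (cone b Y) -
      shu (sg (cone a X)) (bd (cone b Y)) +
      (eps (bd (cone a X)) * eps (bd (cone b Y))) • ls [] := by
  rw [bd_cone, bd_sg, sg_cone, sg_sg] at h3
  rw [bd_cone] at h1
  rw [shu_cone, bd_cone, bd_cone, bd_cone, sg_cone]
  simp only [map_sub, map_neg, LinearMap.sub_apply, LinearMap.neg_apply, shu_cone,
    eps_cone, sub_zero] at h1 h3 ⊢
  rw [map_add bd, map_add bd, h1, h3, map_smul bd, bd_nil, smul_zero]
  simp only [map_add, map_sub, map_neg, map_smul]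
  simp only [neg_zero, sub_zero, sg_sg, map_zero, add_zero, sub_neg_eq_add]
  abel

lemma bd_shu (x : LCh D) (y : LCh D') :
    bd (shu x y) = shu (bd x) y - shu (sg x) (bd y) + (eps (bd x) * eps (bd y)) • ls [] := by
  induction x using ls_induction with
  | zero => simp
  | basis x =>
    induction y using ls_induction with
    | zero => simp
    | basis y =>
      induction hn : x.length + y.length using Nat.strong_induction_on generalizing x y with
      | _ n ih =>
      rcases x with _ | ⟨a, x⟩
      · simp
      rcases y with _ | ⟨b, y⟩
      · simp
      have h1 := ih _ (by simp at hn ⊢; omega) x (b :: y) rfl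
      have h2 := ih _ (by simp at hn ⊢; omega) (a :: x) y rfl
      rw [← cone_ls] at h1 h2
      have h3 : bd (shu (cone a (sg (ls x))) (ls y)) = shu (bd (cone a (sg (ls x)))) (ls y) -
          shu (sg (cone a (sg (ls x)))) (bd (ls y)) +
          (eps (bd (cone a (sg (ls x)))) * eps (bd (ls y))) • ls [] := by
        rw [sg_ls]
        simp only [map_smul, LinearMap.smul_apply, h2, smul_sub, smul_add, smul_smul, smul_eq_mul]
        ring_nf
      rw [← cone_ls, ← cone_ls]
      exact bd_shu_cone h1 h3
    | add c c' h h' => simp only [map_add, h, h', mul_add, add_smul]; abel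
    | smul q c h => simp only [map_smul, h, smul_add, smul_sub, smul_smul, smul_eq_mul]; ring_nf
  | add c c' h h' => simp only [map_add, LinearMap.add_apply, h, h', add_mul, add_smul]; abel
  | smul q c h =>
    simp only [map_smul, LinearMap.smul_apply, h, smul_add, smul_sub, smul_smul, smul_eq_mul]
    ring_nf

end

end

section

open Cvx

section
variable {D D' E E' N : Type} [AddCommGroup N] [Module ℚ N]

lemma shl_cons (a : D) (x : List D) (b : D') (y : List D') : shl (a :: x) (b :: y) =
    cone (a, b) (shl x (b :: y) + (-1 : ℚ) ^ x.length • shl (a :: x) y +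
      (epl x * epl y) • ls []) := by rw [shl]

@[simp] lemma shl_nil_left (y : List D') : shl ([] : List D) y = 0 := by rw [shl]

@[simp] lemma shl_nil_right (x : List D) : shl x ([] : List D') = 0 := by cases x <;> rw [shl]

lemma shl_induction {p : List D → List D' → Prop} (left : ∀ y, p [] y)
    (right : ∀ x, p x []) (cons : ∀ a x b y, p x (b :: y) → p (a :: x) y → p (a :: x) (b :: y))
    (x : List D) (y : List D') : p x y := by
  induction hn : x.length + y.length using Nat.strong_induction_on generalizing x y with
  | _ n ih =>
    rcases x with _ | ⟨a, x⟩
    · exact left y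
    rcases y with _ | ⟨b, y⟩
    · exact right _
    exact cons a x b y (ih _ (by simp at hn ⊢; omega) x (b :: y) rfl)
      (ih _ (by simp at hn ⊢; omega) (a :: x) y rfl)

lemma epl_map (f : D → E) (l : List D) : epl (l.map f) = epl l := by cases l <;> rfl

lemma lmap_shl (f : D → E) (g : D' → E') (x : List D) (y : List D') :
    lmap (Prod.map f g) (shl x y) = shl (x.map f) (y.map g) := by
  induction x, y using shl_induction with
  | left y => simp
  | right x => simp
  | cons a x b y h1 h2 =>
    rw [shl_cons, lmap_cone, map_add (lmap _), map_add (lmap _), map_smul (lmap _), h1, h2]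
    simp [shl_cons, epl_map]

lemma lmap_shu (f : D → E) (g : D' → E') (x : LCh D) (y : LCh D') :
    lmap (Prod.map f g) (shu x y) = shu (lmap f x) (lmap g y) := by
  induction x using ls_induction with
  | zero => simp
  | basis x =>
    induction y using ls_induction with
    | zero => simp
    | basis y => simp [shu_ls, lmap_shl]
    | add c c' h h' => simp [h, h']
    | smul q c h => simp [h]
  | add c c' h h' => simp [h, h']
  | smul q c h => simp [h]

lemma shl_mem {x : List D} {y : List D'} {n : ℕ} (h : x.length + y.length = n + 1) :
    shl x y ∈ LDeg (D × D') n := by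
  induction x, y using shl_induction generalizing n with
  | left y => simp
  | right x => simp
  | cons a x b y h1 h2 =>
    obtain ⟨n, rfl⟩ : ∃ m, n = m + 1 := ⟨x.length + y.length, by simp at h; omega⟩
    rw [shl_cons]
    refine cone_mem _ (Submodule.add_mem _ (Submodule.add_mem _ (h1 (by simp at h ⊢; omega))
      (Submodule.smul_mem _ _ (h2 (by simp at h ⊢; omega)))) ?_)
    rcases x with _ | ⟨_, x⟩
    · rcases y with _ | ⟨_, y⟩
      · obtain rfl : n = 0 := by simpa using h.symm
        exact Submodule.smul_mem _ _ (ls_mem_LDeg [])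
      · simp [epl]
    · simp [epl]

lemma shl_singleton (a : D) (y : List D') : shl [a] y = lmap (Prod.mk a) (ls y) - epl y • ls [] := by
  induction y with
  | nil => simp [epl]
  | cons b y ih => rw [shl_cons, ih]; simp [epl]

/-- The list version of the cup product. -/
def lcup (p : ℕ) (α β : List D → ℚ) (l : List D) : ℚ := α (l.take (p + 1)) * β (l.drop p)

lemma lin_cone (g : List D → N) (a : D) (c : LCh D) :
    lin g (cone a c) = lin (fun l => g (a :: l)) c := by
  induction c using ls_induction with
  | zero => simp
  | basis l => simp
  | add c c' h h' => simp only [map_add, h, h']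
  | smul q c h => simp only [map_smul, h]

lemma lin_mul (q : ℚ) (g : List D → ℚ) (c : LCh D) : lin (fun l => q * g l) c = q * lin g c := by
  induction c using ls_induction with
  | zero => simp
  | basis l => simp
  | add c c' h h' => simp only [map_add, h, h', mul_add]
  | smul r c h => simp only [map_smul, h, smul_eq_mul]; ring

lemma lin_lcup_bd {p : ℕ} {α β : List D → ℚ} (hα : ∀ l, l.length ≠ p + 1 → α l = 0)
    (hβ : β [] = 0) (l : List D) : lin (lcup p α β) (bd (ls l)) =
      lcup (p + 1) (fun l => lin α (bd (ls l))) β l +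
        (-1) ^ p * lcup p α (fun l => lin β (bd (ls l))) l := by
  induction p generalizing α l with
  | zero =>
    rcases l with _ | ⟨a, l⟩
    · simp [lcup]
    rw [bd_cons, map_sub, lin_cone, lin_ls]
    rcases l with _ | ⟨b, l⟩
    · simp [lcup, bd_cons, hα [] (by simp), hβ]
    · have h : lin (fun m => lcup 0 α β (a :: m)) (bd (ls (b :: l))) =
          α [a] * lin (fun m => β (a :: m)) (bd (ls (b :: l))) := by
        rw [← lin_mul]; rfl
      rw [h]
      simp only [lcup, zero_add, List.take_succ_cons, List.take_zero, List.drop_zero,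
        List.drop_succ_cons, pow_zero, one_mul, bd_cons a, map_sub, lin_cone, lin_ls, bd_cons b [],
        bd_nil, map_zero, sub_zero]
      ring
  | succ p ih =>
    rcases l with _ | ⟨a, l⟩
    · simp [lcup]
    rw [bd_cons, map_sub, lin_cone, lin_ls]
    have h := ih (α := fun m => α (a :: m)) (fun m hm => hα _ (by simpa using hm)) l
    have h' : (fun m => lcup (p + 1) α β (a :: m)) = lcup p (fun m => α (a :: m)) β := by
      ext m; simp [lcup]
    rw [h', h]
    simp only [lcup, List.take_succ_cons, List.drop_succ_cons, bd_cons, map_sub, lin_cone, lin_ls]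
    ring

lemma lin_take_fst_shl {p : ℕ} {α : List D → ℚ} (hα : ∀ l₁ a l₂, α (l₁ ++ a :: a :: l₂) = 0)
    (G : List (D × D') → ℚ) {x : List D} (hx : p + 1 ≤ x.length) (y : List D') :
    lin (lcup p (fun l => α (l.map Prod.fst)) G) (shl x y) =
      α (x.take (p + 1)) * lin G (shl (x.drop p) y) := by
  rcases y with _ | ⟨b, y⟩
  · simp
  induction p generalizing α x with
  | zero =>
    rcases x with _ | ⟨a, x⟩
    · simp at hx
    rw [List.drop_zero, shl_cons, lin_cone, lin_cone, ← lin_mul]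
    congr 1
  | succ p ih =>
    rcases x with _ | ⟨a, x⟩
    · simp at hx
    have h' : (fun m => lcup (p + 1) (fun l => α (l.map Prod.fst)) G ((a, b) :: m)) =
        lcup p (fun m => α (a :: m.map Prod.fst)) G := by
      ext m; simp [lcup]
    have h := ih (α := fun m => α (a :: m)) (fun l₁ c l₂ => hα (a :: l₁) c l₂) (x := x)
      (by simpa using hx)
    have hx0 : epl x = 0 := by cases x <;> simp [epl] at hx ⊢
    have h0 : lin (lcup p (fun m => α (a :: m.map Prod.fst)) G) (shl (a :: x) y) = 0 := by
      rcases y with _ | ⟨c, y⟩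
      · simp
      rw [shl_cons, lin_cone]
      have : (fun l => lcup p (fun m : List (D × D') => α (a :: m.map Prod.fst)) G ((a, c) :: l)) =
          fun l => 0 * (1 : ℚ) := by
        ext m
        simp [lcup, show α (a :: a :: _) = 0 from hα [] a _]
      rw [this, lin_mul, zero_mul]
    rw [shl_cons, lin_cone, h', map_add, map_add, map_smul, h, h0, hx0]
    simp

lemma lin_take_snd_shl {p d : ℕ} {α : List D' → ℚ} (hα : ∀ l₁ a l₂, α (l₁ ++ a :: a :: l₂) = 0)
    (G : List (D × D') → ℚ) {x : List D} (hx : x.length = d + 1) {y : List D'}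
    (hy : p + 1 ≤ y.length) :
    lin (lcup p (fun l => α (l.map Prod.snd)) G) (shl x y) =
      (-1) ^ (p * d) * (α (y.take (p + 1)) * lin G (shl x (y.drop p))) := by
  rcases x with _ | ⟨a, x⟩
  · simp at hx
  simp only [List.length_cons, Nat.add_right_cancel_iff] at hx
  induction p generalizing α y with
  | zero =>
    rcases y with _ | ⟨b, y⟩
    · simp at hy
    rw [List.drop_zero, shl_cons, lin_cone, lin_cone, ← lin_mul]
    simp only [zero_mul, pow_zero, one_mul]
    congr 1
  | succ p ih =>
    rcases y with _ | ⟨b, y⟩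
    · simp at hy
    have h' : (fun m => lcup (p + 1) (fun l => α (l.map Prod.snd)) G ((a, b) :: m)) =
        lcup p (fun m => α (b :: m.map Prod.snd)) G := by
      ext m; simp [lcup]
    have h := ih (α := fun m => α (b :: m)) (fun l₁ c l₂ => hα (b :: l₁) c l₂) (y := y)
      (by simpa using hy)
    have hx0 : epl y = 0 := by cases y <;> simp [epl] at hy ⊢
    have h0 : lin (lcup p (fun m => α (b :: m.map Prod.snd)) G) (shl x (b :: y)) = 0 := by
      rcases x with _ | ⟨c, x⟩
      · simp
      rw [shl_cons, lin_cone]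
      have : (fun l => lcup p (fun m : List (D × D') => α (b :: m.map Prod.snd)) G ((c, b) :: l)) =
          fun l => 0 * (1 : ℚ) := by
        ext m
        simp [lcup, show α (b :: b :: _) = 0 from hα [] b _]
      rw [this, lin_mul, zero_mul]
    rw [shl_cons, lin_cone, h', map_add, map_add, map_smul, h, h0, hx0]
    simp only [hx, zero_add, mul_zero, zero_smul, map_zero, add_zero, smul_eq_mul,
      List.take_succ_cons, List.drop_succ_cons]
    ring

/-- Chains of lists of given length with two equal consecutive entries. -/
def Rep (D : Type) (n : ℕ) : Submodule ℚ (LCh D) :=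
  Submodule.span ℚ {c | ∃ l₁ a l₂, (l₁ ++ a :: a :: l₂).length = n ∧ c = ls (l₁ ++ a :: a :: l₂)}

lemma cone_Rep (a : D) {n : ℕ} {c : LCh D} (hc : c ∈ Rep D n) : cone a c ∈ Rep D (n + 1) := by
  refine (Submodule.span_le (p := (Rep D (n + 1)).comap (cone a))).2 ?_ hc
  rintro _ ⟨l₁, b, l₂, h, rfl⟩
  exact Submodule.subset_span ⟨a :: l₁, b, l₂, by simpa using h, by simp⟩

lemma bd_Rep {n : ℕ} {c : LCh D} (hc : c ∈ Rep D (n + 1)) : bd c ∈ Rep D n := by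
  refine (Submodule.span_le (p := (Rep D n).comap (bd (D := D)))).2 ?_ hc
  rintro _ ⟨l₁, b, l₂, h, rfl⟩
  change bd (ls (l₁ ++ b :: b :: l₂)) ∈ Rep D n
  clear hc
  induction l₁ generalizing n with
  | nil =>
    rw [List.nil_append, bd_cons, bd_cons, map_sub, cone_ls, sub_sub_cancel]
    rcases l₂ with _ | ⟨d, l₂⟩
    · simp
    have h3 : bd (ls (d :: l₂)) ∈ LDeg D l₂.length := bd_mem (ls_mem_LDeg (d :: l₂))
    refine map_mem_of_supported (F := cone b ∘ₗ cone b) (P := Rep D n) (fun l hl => ?_) h3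
    have hl : l.length = l₂.length := hl
    refine Submodule.subset_span ⟨[], b, l, ?_, by change cone b (cone b (ls l)) = _; simp⟩
    simp at h ⊢; omega
  | cons x l₁ ih =>
    rw [List.cons_append, bd_cons]
    obtain ⟨n, rfl⟩ : ∃ k, n = k + 1 := ⟨n - 1, by simp at h; omega⟩
    refine Submodule.sub_mem _ (Submodule.subset_span ⟨l₁, b, l₂, by simpa using h, rfl⟩) ?_
    exact cone_Rep x (ih (by simpa using h))

lemma Sl_Rep [TopologicalSpace D] [Cvx D] {n : ℕ} {c : LCh D} (hc : c ∈ Rep D n) : Sl c = 0 := by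
  induction n generalizing c with
  | zero =>
    refine (Submodule.span_le (p := LinearMap.ker Sl)).2 ?_ hc
    rintro _ ⟨l₁, b, l₂, h, rfl⟩
    simp at h
  | succ n ih =>
    refine (Submodule.span_le (p := LinearMap.ker Sl)).2 ?_ hc
    rintro _ ⟨l₁, b, l₂, h, rfl⟩
    have := ih (bd_Rep (Submodule.subset_span ⟨l₁, b, l₂, h, rfl⟩))
    change Sl _ = 0
    rcases l₁ with _ | ⟨x, l₁⟩
    · rw [List.nil_append] at this ⊢
      rw [Sl_cons, this, map_zero]
    · rw [List.cons_append] at this ⊢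
      rw [Sl_cons, this, map_zero]

end

end

section

open Cvx

/-! ### Cross and cup products of singular chains -/

section
variable {D D' : Type} [TopologicalSpace D] [Cvx D] [TopologicalSpace D'] [Cvx D']
  {X Y Z : Type} [TopologicalSpace X] [TopologicalSpace Y] [TopologicalSpace Z]

lemma isAff_fst : IsAff (⟨Prod.fst, continuous_fst⟩ : C(D × D', D)) := fun _ _ => rfl

lemma isAff_snd : IsAff (⟨Prod.snd, continuous_snd⟩ : C(D × D', D')) := fun _ _ => rfl

/-- The pull-back of a cochain to lists. -/
def pull (α : Ch X →ₗ[ℚ] ℚ) (f : C(D, X)) (l : List D) : ℚ := α (R f (ls l))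

lemma lin_pull (α : Ch X →ₗ[ℚ] ℚ) (f : C(D, X)) (c : LCh D) : lin (pull α f) c = α (R f c) :=
  (lin_ext_apply (F := α ∘ₗ R f) (G := lin (pull α f)) (fun l => by
    change α (R f (ls l)) = lin (pull α f) (ls l)
    rw [lin_ls, pull]) c).symm

@[simp] lemma pull_nil (α : Ch X →ₗ[ℚ] ℚ) (f : C(D, X)) : pull α f [] = 0 := by simp [pull]

lemma pull_map (α : Ch X →ₗ[ℚ] ℚ) (f : C(D', X)) {φ : C(D, D')} (hφ : IsAff φ) (l : List D) :
    pull α f (l.map φ) = pull α (f.comp φ) l := by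
  rw [pull, pull, ← R_lmap _ hφ, lmap_ls]

/-- Cochains vanishing outside degree `p`. -/
def HDeg (p : ℕ) (α : Ch X →ₗ[ℚ] ℚ) : Prop := ∀ n (σ : C(Dl n, X)), n ≠ p → α (sx σ) = 0

lemma HDeg.pull {p : ℕ} {α : Ch X →ₗ[ℚ] ℚ} (h : HDeg p α) (f : C(D, X)) {l : List D}
    (hl : l.length ≠ p + 1) : pull α f l = 0 := by
  rcases eq_or_ne l [] with rfl | h0
  · simp
  obtain ⟨n, v, rfl⟩ := exists_ofFn h0
  rw [ConfStab.pull, R_ofFn, h _ _ (by simpa using hl)]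

lemma HDeg.eq_zero {p : ℕ} {α : Ch X →ₗ[ℚ] ℚ} (h : HDeg p α) {j : ℤ} (hj : j ≠ p) {c : Ch X}
    (hc : c ∈ Deg X j) : α c = 0 :=
  eq_of_Deg (F := α) (G := 0) (fun n σ hn => h n σ (by omega)) hc

lemma HDeg.comp_push {p : ℕ} {α : Ch Y →ₗ[ℚ] ℚ} (h : HDeg p α) (f : X → Y) :
    HDeg p (α ∘ₗ push f) := fun n σ hn =>
  h.eq_zero (j := n) (by omega) (push_Deg f (sx_mem_Deg σ))

/-- Cochains vanishing on the simplices factoring through a standard degeneracy. -/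
def Nrm (α : Ch X →ₗ[ℚ] ℚ) : Prop := ∀ (D : Type) [TopologicalSpace D] [Cvx D] (f : C(D, X))
  (l₁ : List D) (a : D) (l₂ : List D), α (R f (ls (l₁ ++ a :: a :: l₂))) = 0

lemma Nrm_comp_SS (α : Ch X →ₗ[ℚ] ℚ) : Nrm (α ∘ₗ SS) := fun D _ _ f l₁ a l₂ => by
  rw [LinearMap.comp_apply, SS_R, Sl_Rep (Submodule.subset_span ⟨l₁, a, l₂, rfl, rfl⟩)]
  simp

lemma Nrm.comp_push {α : Ch Y →ₗ[ℚ] ℚ} (h : Nrm α) {f : X → Y} (hf : Continuous f) :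
    Nrm (α ∘ₗ push f) := fun D _ _ g l₁ a l₂ => by
  rw [LinearMap.comp_apply, push_R (hf.comp g.continuous)]
  exact h D _ l₁ a l₂

/-- The cup product, on a cochain of degree `p`. -/
def cup (p : ℕ) (α β : Ch X →ₗ[ℚ] ℚ) : Ch X →ₗ[ℚ] ℚ :=
  lin fun σ => lcup p (pull α σ.2) (pull β σ.2) (iot σ.1)

lemma cup_R (p : ℕ) (α β : Ch X →ₗ[ℚ] ℚ) (f : C(D, X)) (c : LCh D) :
    cup p α β (R f c) = lin (lcup p (pull α f) (pull β f)) c :=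
  lin_ext_apply (F := cup p α β ∘ₗ R f) (G := lin (lcup p (pull α f) (pull β f))) (fun l => by
    change cup p α β (R f (ls l)) = lin _ (ls l)
    rw [lin_ls]
    rcases eq_or_ne l [] with rfl | h0
    · simp [lcup]
    obtain ⟨n, v, rfl⟩ := exists_ofFn h0
    rw [R_ofFn, cup, lin_sx]
    simp only [lcup]
    rw [← pull_map _ _ (isAff_comb v), ← pull_map _ _ (isAff_comb v), List.map_take,
      List.map_drop, map_iot]) c

lemma cup_dd {p : ℕ} {α : Ch X →ₗ[ℚ] ℚ} (hα : HDeg p α) (β : Ch X →ₗ[ℚ] ℚ) (c : Ch X) :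
    cup p α β (dd c) = cup (p + 1) (α ∘ₗ dd) β c + (-1) ^ p * cup p α (β ∘ₗ dd) c :=
  sx_ext (F := cup p α β ∘ₗ dd)
    (G := cup (p + 1) (α ∘ₗ dd) β + ((-1) ^ p : ℚ) • cup p α (β ∘ₗ dd)) (fun n σ => by
    have h (γ : Ch X →ₗ[ℚ] ℚ) : pull (γ ∘ₗ dd) σ = fun l => lin (pull γ σ) (bd (ls l)) := by
      ext l
      rw [lin_pull, pull, LinearMap.comp_apply, dd_R]
    change cup p α β (dd (sx σ)) = cup (p + 1) (α ∘ₗ dd) β (sx σ) + (-1) ^ p * cup p α (β ∘ₗ dd) (sx σ)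
    rw [dd_sx, cup_R, lin_lcup_bd (fun l hl => hα.pull σ hl) (by simp), cup, cup, lin_sx, lin_sx,
      h, h]) c

lemma cup_push (p : ℕ) (α β : Ch Y →ₗ[ℚ] ℚ) {f : X → Y} (hf : Continuous f) (c : Ch X) :
    cup p α β (push f c) = cup p (α ∘ₗ push f) (β ∘ₗ push f) c :=
  sx_ext (F := cup p α β ∘ₗ push f) (G := cup p (α ∘ₗ push f) (β ∘ₗ push f)) (fun n σ => by
    have h (γ : Ch Y →ₗ[ℚ] ℚ) : pull (γ ∘ₗ push f) σ = pull γ (⟨_, hf.comp σ.continuous⟩ : C(Dl n, Y)) := by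
      ext l
      rw [pull, pull, LinearMap.comp_apply, push_R (hf.comp σ.continuous)]
      rfl
    change cup p α β (push f (sx σ)) = _
    rw [push_sx (hf.comp σ.continuous), cup, cup, lin_sx, lin_sx]
    simp only [h]
    rfl) c

/-- The cross product of singular chains. -/
def crs : Ch X →ₗ[ℚ] Ch Y →ₗ[ℚ] Ch (X × Y) :=
  lin (N := Ch Y →ₗ[ℚ] Ch (X × Y)) fun σ =>
    lin fun τ => R (σ.2.prodMap τ.2) (shu (ls (iot σ.1)) (ls (iot τ.1)))

lemma crs_sx {m n : ℕ} (σ : C(Dl m, X)) (τ : C(Dl n, Y)) :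
    crs (sx σ) (sx τ) = R (σ.prodMap τ) (shu (ls (iot m)) (ls (iot n))) := by
  rw [crs, lin_sx, lin_sx]

lemma crs_ext {N : Type} [AddCommGroup N] [Module ℚ N] {F G : Ch X →ₗ[ℚ] Ch Y →ₗ[ℚ] N}
    {i j : ℤ} (h : ∀ m (σ : C(Dl m, X)) n (τ : C(Dl n, Y)), (m : ℤ) = i → (n : ℤ) = j →
      F (sx σ) (sx τ) = G (sx σ) (sx τ))
    {c : Ch X} (hc : c ∈ Deg X i) {c' : Ch Y} (hc' : c' ∈ Deg Y j) : F c c' = G c c' :=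
  eq_of_Deg (F := F.flip c') (G := G.flip c') (fun m σ hm =>
    eq_of_Deg (F := F (sx σ)) (G := G (sx σ)) (fun n τ hn => h m σ n τ hm hn) hc') hc

lemma crs_R (f : C(D, X)) (g : C(D', Y)) (x : LCh D) (y : LCh D') :
    crs (R f x) (R g y) = R (f.prodMap g) (shu x y) := by
  induction x using ls_induction with
  | zero => simp
  | basis x =>
    induction y using ls_induction with
    | zero => simp
    | basis y =>
      rcases eq_or_ne x [] with rfl | h0
      · simp
      rcases eq_or_ne y [] with rfl | h1
      · simp
      obtain ⟨m, v, rfl⟩ := exists_ofFn h0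
      obtain ⟨n, w, rfl⟩ := exists_ofFn h1
      have h := R_lmap (f.prodMap g) (isAff_prodMap (isAff_comb v) (isAff_comb w))
        (shu (ls (iot m)) (ls (iot n)))
      have h3 : ⇑((comb v).prodMap (comb w)) = Prod.map (comb v) (comb w) := rfl
      rw [h3, lmap_shu, lmap_ls, lmap_ls, map_iot, map_iot] at h
      rw [R_ofFn, R_ofFn, crs_sx, h]
      rfl
    | add c c' h h' => simp only [map_add, h, h']
    | smul q c h => simp only [map_smul, h]
  | add c c' h h' => simp only [map_add, h, h', LinearMap.add_apply]
  | smul q c h => simp only [map_smul, h, LinearMap.smul_apply]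

lemma dd_crs_sx {m n : ℕ} (σ : C(Dl m, X)) (τ : C(Dl n, Y)) : dd (crs (sx σ) (sx τ)) =
    crs (dd (sx σ)) (sx τ) + (-1 : ℚ) ^ m • crs (sx σ) (dd (sx τ)) := by
  have h1 := R_iot σ
  have h2 := R_iot τ
  rw [crs_sx, dd_R, bd_shu, sg_mem (iot_mem m), dd_sx, dd_sx]
  rw [← h1, ← h2, crs_R, crs_R]
  simp only [map_add, map_sub, map_smul, R_nil, LinearMap.smul_apply, pow_succ, smul_zero]
  simp

lemma dd_crs {p : ℕ} {c : Ch X} (hc : c ∈ Deg X p) (w : Ch Y) :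
    dd (crs c w) = crs (dd c) w + (-1 : ℚ) ^ p • crs c (dd w) := by
  obtain ⟨F, hF⟩ : ∃ F : Ch X →ₗ[ℚ] Ch (X × Y), ∀ x, F x =
      dd (crs x w) - crs (dd x) w - (-1 : ℚ) ^ p • crs x (dd w) :=
    ⟨dd ∘ₗ crs.flip w - crs.flip w ∘ₗ dd - (-1 : ℚ) ^ p • crs.flip (dd w), fun _ => rfl⟩
  have h := eq_of_Deg (F := F) (G := 0) (fun m σ hm => by
    obtain rfl : m = p := by exact_mod_cast hm
    rw [hF]
    have := sx_ext (F := dd ∘ₗ crs (sx σ))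
      (G := crs (dd (sx σ)) + (-1 : ℚ) ^ m • (crs (sx σ) ∘ₗ dd)) (fun n τ => dd_crs_sx σ τ) w
    have h2 : dd (crs (sx σ) w) = crs (dd (sx σ)) w + (-1 : ℚ) ^ m • crs (sx σ) (dd w) := this
    rw [h2, LinearMap.zero_apply]
    abel) hc
  rw [hF, LinearMap.zero_apply, sub_sub, sub_eq_zero] at h
  exact h

lemma crs_Deg {i j : ℤ} {c : Ch X} (hc : c ∈ Deg X i) {c' : Ch Y} (hc' : c' ∈ Deg Y j) :
    crs c c' ∈ Deg (X × Y) (i + j) := by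
  refine map_mem_of_Deg (F := crs.flip c') (fun m σ hm => ?_) hc
  refine map_mem_of_Deg (F := crs (sx σ)) (fun n τ hn => ?_) hc'
  rw [crs_sx, shu_ls]
  have h := R_mem_Deg (σ.prodMap τ) (shl_mem (n := m + n + 1) (x := iot m) (y := iot n)
    (by simp [iot]; omega))
  rwa [show ((m + n + 1 : ℕ) : ℤ) - 1 = i + j by push_cast; omega] at h

lemma crs_Cin {A : Set X} {B : Set Y} {c : Ch X} (hc : c ∈ Cin A) {c' : Ch Y} (hc' : c' ∈ Cin B) :
    crs c c' ∈ Cin (A ×ˢ B) := by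
  refine map_mem_of_Cin (F := crs.flip c') (fun m σ hm => ?_) hc
  refine map_mem_of_Cin (F := crs (sx σ)) (fun n τ hn => ?_) hc'
  change crs (sx σ) (sx τ) ∈ _
  rw [crs_sx]
  exact R_mem_Cin (A := A ×ˢ B) (fun t => Set.mk_mem_prod (hm _) (hn _)) _

lemma pull_push_fst (α : Ch X →ₗ[ℚ] ℚ) (f : C(D, X)) (g : C(D', Y)) :
    pull (α ∘ₗ push Prod.fst) (f.prodMap g) = fun l => pull α f (l.map Prod.fst) := by
  ext l
  rw [pull, LinearMap.comp_apply, push_R (continuous_fst.comp (f.prodMap g).continuous)]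
  exact (pull_map α f isAff_fst l).symm

lemma pull_push_snd (α : Ch Y →ₗ[ℚ] ℚ) (f : C(D, X)) (g : C(D', Y)) :
    pull (α ∘ₗ push Prod.snd) (f.prodMap g) = fun l => pull α g (l.map Prod.snd) := by
  ext l
  rw [pull, LinearMap.comp_apply, push_R (continuous_snd.comp (f.prodMap g).continuous)]
  exact (pull_map α g isAff_snd l).symm

lemma Nrm.pull {α : Ch X →ₗ[ℚ] ℚ} (h : Nrm α) (f : C(D, X)) (l₁ : List D) (a : D) (l₂ : List D) :
    pull α f (l₁ ++ a :: a :: l₂) = 0 := h D f l₁ a l₂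

/-! ### Words of cochains -/

/-- The augmentation. -/
def aug (X : Type) [TopologicalSpace X] : Ch X →ₗ[ℚ] ℚ := lin fun σ => if σ.1 = 0 then 1 else 0

lemma aug_R (f : C(D, X)) (l : List D) : aug X (R f (ls l)) = if l.length = 1 then 1 else 0 := by
  rcases eq_or_ne l [] with rfl | h0
  · simp
  obtain ⟨n, v, rfl⟩ := exists_ofFn h0
  rw [R_ofFn, aug, lin_sx]
  simp

lemma aug_dd (c : Ch X) : aug X (dd c) = 0 :=
  sx_ext (F := aug X ∘ₗ dd) (G := 0) (fun n σ => by
    change aug X (dd (sx σ)) = 0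
    rw [dd_sx, ← lin_pull]
    have h : ∀ l : List (Dl n), lin (pull (aug X) σ) (bd (ls l)) = 0 := by
      intro l
      have h2 : pull (aug X) σ = fun l => if l.length = 1 then 1 else 0 := by
        ext l; rw [pull, aug_R]
      rw [h2]
      rcases l with _ | ⟨a, _ | ⟨b, _ | ⟨d, l⟩⟩⟩
      · simp
      · simp [bd_cons]
      · simp [bd_cons]
      · have h3 : bd (ls (a :: b :: d :: l)) ∈ LDeg (Dl n) (l.length + 2) :=
          bd_mem (ls_mem_LDeg (a :: b :: d :: l))
        have := map_mem_of_supported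
          (F := lin fun l : List (Dl n) => if l.length = 1 then (1 : ℚ) else 0) (P := ⊥)
          (fun l' hl => by
            have hl : l'.length = l.length + 2 := hl
            change lin _ (ls l') ∈ _
            simp [hl]) h3
        simpa using this
    exact h _) c

/-- Iterated cup products of cochains of degree `e`. -/
def wd (e : ℕ) : List (Ch X →ₗ[ℚ] ℚ) → Ch X →ₗ[ℚ] ℚ
  | [] => aug X
  | α :: ws => cup e α (wd e ws)

lemma aug_push {f : X → Y} (hf : Continuous f) (c : Ch X) : aug Y (push f c) = aug X c :=
  sx_ext (F := aug Y ∘ₗ push f) (G := aug X) (fun n σ => by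
    change aug Y (push f (sx σ)) = _
    rw [push_sx (hf.comp σ.continuous), aug, aug, lin_sx, lin_sx]) c

lemma wd_push (e : ℕ) (ws : List (Ch Y →ₗ[ℚ] ℚ)) {f : X → Y} (hf : Continuous f) (c : Ch X) :
    wd e ws (push f c) = wd e (ws.map fun α => α ∘ₗ push f) c := by
  induction ws generalizing c with
  | nil => exact aug_push hf c
  | cons α ws ih =>
    rw [wd, cup_push _ _ _ hf, List.map_cons, wd]
    congr 2
    exact LinearMap.ext ih

lemma cup_zero_left (p : ℕ) (β : Ch X →ₗ[ℚ] ℚ) (c : Ch X) : cup p 0 β c = 0 :=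
  sx_ext (F := cup p 0 β) (G := 0) (fun n σ => by rw [cup, lin_sx]; simp [lcup, pull]) c

lemma cup_zero_right (p : ℕ) (α : Ch X →ₗ[ℚ] ℚ) (c : Ch X) : cup p α 0 c = 0 :=
  sx_ext (F := cup p α 0) (G := 0) (fun n σ => by rw [cup, lin_sx]; simp [lcup, pull]) c

lemma wd_dd {e : ℕ} {ws : List (Ch X →ₗ[ℚ] ℚ)} (h : ∀ α ∈ ws, HDeg e α ∧ α ∘ₗ dd = 0) (c : Ch X) :
    wd e ws (dd c) = 0 := by
  induction ws generalizing c with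
  | nil => exact aug_dd c
  | cons α ws ih =>
    rw [wd, cup_dd (h α (by simp)).1, (h α (by simp)).2, cup_zero_left,
      show wd e ws ∘ₗ dd = 0 from LinearMap.ext (ih fun β hβ => h β (by simp [hβ])),
      cup_zero_right]
    simp

lemma wd_shl {e : ℕ} (he : Even e) {a : Ch X →ₗ[ℚ] ℚ} (ha : Nrm a) {w₁ : List (Ch Y →ₗ[ℚ] ℚ)}
    (h₁ : ∀ α ∈ w₁, Nrm α) (w₂ : List (Ch Y →ₗ[ℚ] ℚ)) (f : C(D, X)) (g : C(D', Y))
    {x : List D} (hx : x.length = e + 1) {y : List D'} (hy : e * w₁.length + 1 ≤ y.length) :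
    wd e (w₁.map (fun α => α ∘ₗ push Prod.snd) ++
      (a ∘ₗ push Prod.fst) :: w₂.map (fun α => α ∘ₗ push Prod.snd)) (R (f.prodMap g) (shl x y)) =
      a (R f (ls x)) * wd e (w₁ ++ w₂) (R g (ls y)) := by
  induction w₁ generalizing y with
  | nil =>
    rw [List.map_nil, List.nil_append, List.nil_append, wd, cup_R, pull_push_fst,
      lin_take_fst_shl (ha.pull f) _ (by omega)]
    have h1 : x.take (e + 1) = x := List.take_of_length_le (by omega)
    obtain ⟨d, hd⟩ : ∃ d, x.drop e = [d] := List.length_eq_one_iff.1 (by simp [hx])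
    rw [h1, hd, shl_singleton, map_sub, map_smul, lin_ls, pull_nil, smul_zero, sub_zero, pull,
      lin_pull]
    congr 1
    have h2 : Continuous fun t => (f.prodMap g t).2 := continuous_snd.comp (f.prodMap g).continuous
    rw [← wd_push e w₂ continuous_snd, push_R h2, lmap_ls]
    congr 1
    have := R_lmap g (isAff_snd (D := D)) (ls (y.map (Prod.mk d)))
    rw [lmap_ls, List.map_map] at this
    exact this.symm.trans (by simp [Function.comp_def])
  | cons α w₁ ih =>
    simp only [List.map_cons, List.cons_append, wd]
    rw [List.length_cons, mul_add, mul_one] at hy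
    rw [cup_R, pull_push_snd, lin_take_snd_shl ((h₁ α (by simp)).pull g) _ hx (by omega),
      lin_pull, ih (fun β hβ => h₁ β (by simp [hβ])) (by simp; omega), (he.mul_left e).neg_one_pow,
      cup_R, lin_ls, lcup, pull, pull]
    ring

lemma wd_crs {e : ℕ} (he : Even e) {a : Ch X →ₗ[ℚ] ℚ} (ha : Nrm a) {w₁ : List (Ch Y →ₗ[ℚ] ℚ)}
    (h₁ : ∀ α ∈ w₁, Nrm α) (w₂ : List (Ch Y →ₗ[ℚ] ℚ)) {c : Ch X} (hc : c ∈ Deg X e)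
    {c' : Ch Y} (hc' : c' ∈ Deg Y (e * (w₁.length + w₂.length) : ℕ)) :
    wd e (w₁.map (fun α => α ∘ₗ push Prod.snd) ++
      (a ∘ₗ push Prod.fst) :: w₂.map (fun α => α ∘ₗ push Prod.snd)) (crs c c') =
      a c * wd e (w₁ ++ w₂) c' := by
  refine crs_ext (F := crs.compr₂ (wd e (w₁.map (fun α => α ∘ₗ push Prod.snd) ++
      (a ∘ₗ push Prod.fst) :: w₂.map (fun α => α ∘ₗ push Prod.snd))))
      (G := (LinearMap.mul ℚ ℚ).compl₁₂ a (wd e (w₁ ++ w₂))) (fun m σ n τ hm hn => ?_) hc hc'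
  have hm : m = e := by exact_mod_cast hm
  have hn : n = e * (w₁.length + w₂.length) := by exact_mod_cast hn
  change wd e _ (crs (sx σ) (sx τ)) = a (sx σ) * wd e (w₁ ++ w₂) (sx τ)
  rw [crs_sx, shu_ls, wd_shl he ha h₁ w₂ σ τ (by simp [iot, hm]) (by simp [iot, hn, mul_add]),
    R_iot, R_iot]

end

end

section

open Cvx

/-! ### Cocycles detecting homology classes -/

section
variable {X Y : Type} [TopologicalSpace X] [TopologicalSpace Y]

/-- The projection to the chains of degree `j`. -/
def degPr (X : Type) [TopologicalSpace X] (j : ℤ) : Ch X →ₗ[ℚ] Ch X :=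
  lin fun σ => if (σ.1 : ℤ) = j then sx σ.2 else 0

lemma degPr_sx (j : ℤ) {n : ℕ} (σ : C(Dl n, X)) :
    degPr X j (sx σ) = if (n : ℤ) = j then sx σ else 0 := by rw [degPr, lin_sx]

lemma degPr_of_Deg {j : ℤ} {c : Ch X} (hc : c ∈ Deg X j) : degPr X j c = c :=
  eq_of_Deg (F := degPr X j) (G := LinearMap.id) (fun n σ hn => by
    rw [degPr_sx, if_pos hn]; rfl) hc

lemma degPr_of_ne {i j : ℤ} (hij : i ≠ j) {c : Ch X} (hc : c ∈ Deg X i) : degPr X j c = 0 :=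
  eq_of_Deg (F := degPr X j) (G := 0) (fun n σ hn => by
    rw [degPr_sx, if_neg (by omega)]; rfl) hc

lemma degPr_mem (j : ℤ) (c : Ch X) : degPr X j c ∈ Deg X j := by
  have hc : c ∈ Cin (Set.univ : Set X) := by simp
  refine map_mem_of_Cin (fun n σ _ => ?_) hc
  rw [degPr_sx]
  split_ifs with h
  · exact h ▸ sx_mem_Deg σ
  · exact zero_mem _

lemma degPr_Cin (j : ℤ) {A : Set X} {c : Ch X} (hc : c ∈ Cin A) : degPr X j c ∈ Cin A := by
  refine map_mem_of_Cin (fun n σ h => ?_) hc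
  rw [degPr_sx]
  split_ifs
  · exact sx_mem_Cin h
  · exact zero_mem _

lemma degPr_dd (j : ℤ) (c : Ch X) : degPr X j (dd c) = dd (degPr X (j + 1) c) :=
  sx_ext (F := degPr X j ∘ₗ dd) (G := dd ∘ₗ degPr X (j + 1)) (fun n σ => by
    change degPr X j (dd (sx σ)) = dd (degPr X (j + 1) (sx σ))
    rcases eq_or_ne (n : ℤ) (j + 1) with h | h
    · rw [degPr_of_Deg (c := sx σ) (h ▸ sx_mem_Deg σ)]
      exact degPr_of_Deg (by simpa [h] using dd_Deg (sx_mem_Deg σ))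
    · rw [degPr_of_ne h (sx_mem_Deg σ), map_zero]
      exact degPr_of_ne (by omega) (dd_Deg (sx_mem_Deg σ))) c

lemma exists_cocycle {e : ℕ} {A : Set X} {c : Ch X} (hc : c ∈ Deg X e)
    (h : ¬ RB e Set.univ A c) : ∃ u : Ch X →ₗ[ℚ] ℚ, HDeg e u ∧ u ∘ₗ dd = 0 ∧
      (∀ x ∈ Cin A, u x = 0) ∧ u c ≠ 0 := by
  have h1 : c ∉ LinearMap.range (dd (X := X)) ⊔ Cin A := by
    intro h2
    obtain ⟨_, ⟨x, rfl⟩, y, hy, hxy⟩ := Submodule.mem_sup.1 h2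
    refine h ⟨degPr X (e + 1) x, degPr_mem _ _, by simp, ?_⟩
    rw [← degPr_dd, ← degPr_of_Deg hc, ← hxy, map_add, add_sub_cancel_left]
    exact degPr_Cin _ hy
  obtain ⟨v, hv, hle⟩ := Submodule.exists_le_ker_of_notMem h1
  have hv1 : ∀ x, v (dd x) = 0 := fun x => hle (Submodule.mem_sup_left ⟨x, rfl⟩)
  refine ⟨v ∘ₗ degPr X e, fun n σ hn => ?_, ?_, fun x hx => ?_, ?_⟩
  · rw [LinearMap.comp_apply, degPr_of_ne (by exact_mod_cast hn) (sx_mem_Deg σ), map_zero]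
  · ext1 x
    exact LinearMap.ext_ring (by simp [degPr_dd, hv1])
  · exact hle (Submodule.mem_sup_right (degPr_Cin _ hx))
  · rwa [LinearMap.comp_apply, degPr_of_Deg hc]

lemma HDeg.comp_SS {e : ℕ} {u : Ch X →ₗ[ℚ] ℚ} (h : HDeg e u) : HDeg e (u ∘ₗ SS) :=
  fun n σ hn => h.eq_zero (j := n) (by exact_mod_cast hn)
    (by simpa using SS_pow_Deg (sx_mem_Deg σ) 1)

lemma exists_normalized_cocycle {e : ℕ} {c : Ch X} (hc : c ∈ Deg X e) (hd : dd c = 0)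
    (h : ¬ RB e Set.univ ∅ c) : ∃ u : Ch X →ₗ[ℚ] ℚ, HDeg e u ∧ u ∘ₗ dd = 0 ∧ Nrm u ∧ u c ≠ 0 := by
  obtain ⟨u, h1, h2, -, h3⟩ := exists_cocycle hc h
  have hu : ∀ x, u (dd x) = 0 := fun x => LinearMap.congr_fun h2 x
  refine ⟨u ∘ₗ SS, h1.comp_SS, ?_, Nrm_comp_SS u, ?_⟩
  · refine LinearMap.ext fun x => ?_
    have := dd_SS_pow x 1
    rw [pow_one] at this
    rw [LinearMap.comp_apply, LinearMap.comp_apply, ← this, hu, LinearMap.zero_apply]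
  · obtain ⟨H, hH, -, -⟩ := exists_SS_homotopy (X := X) 1
    have := congrArg u (hH c)
    rw [hd, map_zero, add_zero, hu, map_sub, pow_one] at this
    rw [LinearMap.comp_apply]
    intro h0
    rw [h0, sub_zero] at this
    exact h3 this.symm

end

/-! ### Products of cycles in configuration spaces -/

section
variable {M : Type} [TopologicalSpace M]

/-- The cross product of a family of chains. -/
def prodCh : ∀ {k : ℕ}, (Fin k → Ch M) → Ch (Fin k → M)
  | 0, _ => sx (n := 0) (ContinuousMap.const _ Fin.elim0)
  | _ + 1, z => push (fun p : M × (Fin _ → M) => (Fin.cons p.1 p.2 : Fin (_ + 1) → M))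
      (crs (z 0) (prodCh (Fin.tail z)))

lemma continuous_cons {k : ℕ} :
    Continuous fun p : M × (Fin k → M) => (Fin.cons p.1 p.2 : Fin (k + 1) → M) := by
  refine continuous_pi fun i => ?_
  refine Fin.cases ?_ (fun i => ?_) i
  · exact continuous_fst
  · exact (continuous_apply i).comp continuous_snd

lemma prodCh_Deg {e k : ℕ} {z : Fin k → Ch M} (hz : ∀ i, z i ∈ Deg M e) :
    prodCh z ∈ Deg (Fin k → M) (e * k : ℕ) := by
  induction k with
  | zero => exact sx_mem_Deg _
  | succ k ih =>
    have := push_Deg (fun p : M × (Fin k → M) => (Fin.cons p.1 p.2 : Fin (k + 1) → M))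
      (crs_Deg (hz 0) (ih (z := Fin.tail z) fun i => hz i.succ))
    rwa [show (e : ℤ) + (e * k : ℕ) = (e * (k + 1) : ℕ) by push_cast; ring] at this

lemma prodCh_Cin {k : ℕ} {z : Fin k → Ch M} {K : Fin k → Set M} (hz : ∀ i, z i ∈ Cin (K i)) :
    prodCh z ∈ Cin {f : Fin k → M | ∀ i, f i ∈ K i} := by
  induction k with
  | zero => exact sx_mem_Cin fun _ i => i.elim0
  | succ k ih =>
    refine push_Cin (A := K 0 ×ˢ {f : Fin k → M | ∀ i, f i ∈ K i.succ}) (fun p hp => ?_)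
      (crs_Cin (hz 0) (ih (z := Fin.tail z) (K := fun i => K i.succ) fun i => hz i.succ))
    exact fun i => Fin.cases hp.1 (fun i => hp.2 i) i

lemma dd_prodCh {e k : ℕ} {z : Fin k → Ch M} (hz : ∀ i, z i ∈ Deg M e) (hd : ∀ i, dd (z i) = 0) :
    dd (prodCh z) = 0 := by
  induction k with
  | zero =>
    have := dd_Deg (prodCh_Deg (e := 0) (z := z) (fun i => i.elim0))
    exact Deg_of_neg (by simp) this
  | succ k ih =>
    rw [prodCh, dd_push continuous_cons.continuousOn (A := Set.univ) (by simp), dd_crs (hz 0),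
      hd 0, ih (z := Fin.tail z) (fun i => hz i.succ) fun i => hd i.succ]
    simp

lemma exists_eq_map_succ {k : ℕ} {l : List (Fin (k + 1))} (h : 0 ∉ l) :
    ∃ l' : List (Fin k), l = l'.map Fin.succ := by
  induction l with
  | nil => exact ⟨[], rfl⟩
  | cons a l ih =>
    obtain ⟨l', rfl⟩ := ih fun h' => h (List.mem_cons_of_mem _ h')
    obtain ⟨b, rfl⟩ := Fin.exists_succ_eq.2 (show a ≠ 0 from fun h' => h (h' ▸ List.mem_cons_self))
    exact ⟨b :: l', rfl⟩

/-- The pull-back of a cochain along a coordinate. -/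
def coch {k : ℕ} (a : Ch M →ₗ[ℚ] ℚ) (j : Fin k) : Ch (Fin k → M) →ₗ[ℚ] ℚ :=
  a ∘ₗ push fun f : Fin k → M => f j

lemma push_push_continuous {X Y Z : Type} [TopologicalSpace X] [TopologicalSpace Y]
    [TopologicalSpace Z] {f : X → Y} (hf : Continuous f) (g : Y → Z) (c : Ch X) :
    push g (push f c) = push (fun x => g (f x)) c :=
  push_push hf.continuousOn (A := Set.univ) (by simp)

lemma wd_prodCh {e : ℕ} (he : Even e) {a : Ch M →ₗ[ℚ] ℚ} (hN : Nrm a) {k : ℕ}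
    {z : Fin k → Ch M} (hz : ∀ i, z i ∈ Deg M e) {l : List (Fin k)} (hl : l.Nodup)
    (hk : l.length = k) : wd e (l.map (coch a)) (prodCh z) = ∏ i, a (z i) := by
  induction k with
  | zero =>
    obtain rfl : l = [] := List.length_eq_zero_iff.1 hk
    simp [wd, aug, prodCh]
  | succ k ih =>
    have h0 : (0 : Fin (k + 1)) ∈ l := by
      have : l.toFinset = Finset.univ := by
        rw [← Finset.card_eq_iff_eq_univ, List.toFinset_card_of_nodup hl, hk, Fintype.card_fin]
      exact List.mem_toFinset.1 (this ▸ Finset.mem_univ _)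
    obtain ⟨l₁, l₂, rfl⟩ := List.append_of_mem h0
    rw [List.nodup_middle, List.nodup_cons, List.mem_append, not_or] at hl
    obtain ⟨l₁, rfl⟩ := exists_eq_map_succ hl.1.1
    obtain ⟨l₂, rfl⟩ := exists_eq_map_succ hl.1.2
    have hlen : l₁.length + l₂.length = k := by simp at hk; omega
    have h2 : (l₁ ++ l₂).Nodup := by
      rw [← List.map_append] at hl
      exact hl.2.of_map _
    have e0 : coch a (0 : Fin (k + 1)) ∘ₗ
        push (fun p : M × (Fin k → M) => (Fin.cons p.1 p.2 : Fin (k + 1) → M)) =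
        a ∘ₗ push Prod.fst := LinearMap.ext fun c => congrArg a (push_push_continuous continuous_cons _ c)
    have e1 : ∀ j : Fin k, coch a j.succ ∘ₗ
        push (fun p : M × (Fin k → M) => (Fin.cons p.1 p.2 : Fin (k + 1) → M)) =
        coch a j ∘ₗ push Prod.snd := fun j => LinearMap.ext fun c => by
      have h1 := push_push_continuous (continuous_cons (M := M) (k := k))
        (fun f : Fin (k + 1) → M => f j.succ) c
      have h2 := push_push_continuous (continuous_snd (X := M) (Y := Fin k → M))
        (fun f : Fin k → M => f j) c
      simp only [Fin.cons_succ] at h1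
      exact congrArg a (h1.trans h2.symm)
    have hw : ∀ α ∈ l₁.map (coch a), Nrm α := fun α hα => by
      obtain ⟨j, -, rfl⟩ := List.mem_map.1 hα
      exact hN.comp_push (continuous_apply j)
    have hp : prodCh (Fin.tail z) ∈ Deg (Fin k → M)
        (e * ((l₁.map (coch a)).length + (l₂.map (coch a)).length) : ℕ) := by
      rw [List.length_map, List.length_map, hlen]
      exact prodCh_Deg fun i => hz i.succ
    have h3 := wd_crs (X := M) (Y := Fin k → M) he hN hw (l₂.map (coch a)) (hz 0) hp
    rw [← List.map_append, ih (z := Fin.tail z) (fun i => hz i.succ) h2 (by simpa using hlen)] at h3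
    have h4 : ((l₁.map Fin.succ ++ 0 :: l₂.map Fin.succ).map (coch a)).map (fun α => α ∘ₗ
        push (fun p : M × (Fin k → M) => (Fin.cons p.1 p.2 : Fin (k + 1) → M))) =
        (l₁.map (coch a)).map (fun α => α ∘ₗ push Prod.snd) ++ (a ∘ₗ push Prod.fst) ::
          (l₂.map (coch a)).map (fun α => α ∘ₗ push Prod.snd) := by
      simp only [List.map_append, List.map_cons, List.map_map, Function.comp_def, e0, e1]
    rw [prodCh, wd_push _ _ continuous_cons, h4, h3, Fin.prod_univ_succ]
    rfl

variable [T2Space M]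

theorem exists_cycle_unordered {e k : ℕ} (he : Even e) {a : Ch M →ₗ[ℚ] ℚ} (ha : HDeg e a)
    (had : a ∘ₗ dd = 0) (hN : Nrm a) {z : Fin k → Ch M} (hz : ∀ i, z i ∈ Deg M e)
    (hd : ∀ i, dd (z i) = 0) (haz : ∀ i, a (z i) ≠ 0) {K : Fin k → Set M}
    (hK : ∀ i, z i ∈ Cin (K i)) (hdisj : ∀ i j, i ≠ j → Disjoint (K i) (K j)) :
    ∃ c ∈ Deg (unorderedConfig M k) (e * k : ℕ), dd c = 0 ∧
      ¬ RB (e * k : ℕ) Set.univ ∅ c := by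
  have hinj : ∀ f ∈ {f : Fin k → M | ∀ i, f i ∈ K i}, Function.Injective f := fun f hf i j hij =>
    by_contra fun hne => Set.disjoint_left.1 (hdisj i j hne) (hf i) (hij ▸ hf j)
  obtain ⟨c', h1, h2, h3, h4⟩ : ∃ c' : Ch (orderedConfig M k), c' ∈ Deg _ (e * k : ℕ) ∧ dd c' = 0 ∧
      push cval c' = prodCh z ∧ True := by
    rcases isEmpty_or_nonempty (orderedConfig M k) with hE | hE
    · have h0 : prodCh z = 0 := by
        have : {f : Fin k → M | ∀ i, f i ∈ K i} = ∅ := by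
          ext f
          simp only [Set.mem_empty_iff_false, iff_false]
          exact fun hf => hE.false ⟨f, hinj f hf⟩
        have h := prodCh_Cin hK
        rw [this] at h
        simpa using h
      exact ⟨0, zero_mem _, by simp, by simp [h0], trivial⟩
    obtain ⟨s, hs1, hs2⟩ : ∃ s : (Fin k → M) → orderedConfig M k,
        ContinuousOn s {f | ∀ i, f i ∈ K i} ∧ ∀ f ∈ {f : Fin k → M | ∀ i, f i ∈ K i},
          cval (s f) = f := by
      classical
      refine ⟨fun f => if h : Function.Injective f then ⟨f, h⟩ else hE.some, ?_, fun f hf => ?_⟩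
      · rw [isOpenEmbedding_val.isInducing.continuousOn_iff]
        refine continuousOn_id.congr fun f hf => ?_
        simp [hinj f hf, cval]
      · simp [hinj f hf, cval]
    have hc := prodCh_Cin hK
    refine ⟨push s (prodCh z), push_Deg _ (prodCh_Deg hz), ?_, ?_, trivial⟩
    · rw [dd_push hs1 hc, dd_prodCh hz hd, map_zero]
    · rw [push_push hs1 hc, push_congr hs2 hc, push_id]
  have hcov := confQ_isCov (M := M) (k := k)
  refine ⟨push (confQ M k) c', push_Deg _ h1, ?_, ?_⟩
  · rw [dd_push hcov.cont.continuousOn (A := Set.univ) (by simp), h2, map_zero]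
  rintro ⟨x, -, -, hx⟩
  rw [Cin_empty, Submodule.mem_bot, sub_eq_zero] at hx
  have hx' := congrArg (tr hcov) hx
  rw [tr_push, ← dd_tr, gsum_apply] at hx'
  have hval : Continuous (cval (M := M) (k := k)) := isOpenEmbedding_val.continuous
  have hL := congrArg (wd e ((List.finRange k).map (coch a))) (congrArg (push cval) hx')
  rw [← dd_push hval.continuousOn (A := Set.univ) (by simp), wd_dd, map_sum, map_sum] at hL
  · have hterm : ∀ g : Equiv.Perm (Fin k), wd e ((List.finRange k).map (coch a))
        (push cval (push (fun x : orderedConfig M k => g • x) c')) = ∏ i, a (z i) := by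
      intro g
      have hp : Continuous fun f : Fin k → M => f ∘ g.symm := by fun_prop
      have h5 : push cval (push (fun x : orderedConfig M k => g • x) c') =
          push (fun f : Fin k → M => f ∘ g.symm) (prodCh z) := by
        rw [push_push_continuous (hcov.act g), ← h3, push_push_continuous hval]
        rfl
      rw [h5, wd_push _ _ hp, List.map_map, ← wd_prodCh he hN hz
        ((List.nodup_finRange k).map g.symm.injective) (by simp), List.map_map]
      congr 2
      exact List.map_congr_left fun j _ => LinearMap.ext fun c => congrArg a
        (push_push_continuous hp _ c)
    rw [Finset.sum_congr rfl fun g _ => hterm g, Finset.sum_const, Finset.card_univ,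
      nsmul_eq_mul] at hL
    exact mul_ne_zero (by exact_mod_cast Fintype.card_ne_zero)
      (Finset.prod_ne_zero_iff.2 fun i _ => haz i) hL
  · intro α hα
    obtain ⟨j, -, rfl⟩ := List.mem_map.1 hα
    refine ⟨ha.comp_push _, LinearMap.ext fun c => ?_⟩
    rw [coch, LinearMap.comp_apply, LinearMap.comp_apply,
      ← dd_push (continuous_apply j).continuousOn (A := Set.univ) (by simp)]
    exact LinearMap.congr_fun had _

end

end

section

open Cvx

/-! ### Operators modifying singular simplices -/

section
variable {X Y E : Type} [TopologicalSpace X] [TopologicalSpace Y]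

/-- Chains whose simplices have small image under `F`. -/
def Fsm [PseudoMetricSpace E] (F : X → E) (ε : ℝ) : Submodule ℚ (Ch X) :=
  Finsupp.supported ℚ ℚ {σ | ∀ t t', dist (F (σ.2 t)) (F (σ.2 t')) < ε}

lemma SS_pow_Fsm [PseudoMetricSpace E] {F : X → E} {ε : ℝ} {c : Ch X} (hc : c ∈ Fsm F ε)
    (N : ℕ) : (SS ^ N) c ∈ Fsm F ε := by
  refine map_mem_of_supported (fun σ hσ => ?_) hc
  refine Finsupp.supported_mono (fun τ hτ t t' => ?_)
    (SS_pow_Cin (sx_mem_Cin (σ := σ.2) (A := Set.range σ.2) fun t => ⟨t, rfl⟩) N)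
  obtain ⟨u, hu⟩ := hτ t
  obtain ⟨u', hu'⟩ := hτ t'
  rw [← hu, ← hu']
  exact hσ u u'

theorem exists_SS_Fsm [PseudoMetricSpace E] {F : X → E} (hF : Continuous F) {ε : ℝ} (hε : 0 < ε)
    (c : Ch X) : ∃ N, (SS ^ N) c ∈ Fsm F ε := by
  induction c using Finsupp.induction_linear with
  | zero => exact ⟨0, by simp⟩
  | add x y hx hy =>
    obtain ⟨N, hN⟩ := hx
    obtain ⟨N', hN'⟩ := hy
    refine ⟨N + N', ?_⟩
    rw [map_add]
    refine Submodule.add_mem _ ?_ ?_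
    · rw [add_comm, pow_add]; exact SS_pow_Fsm hN N'
    · rw [pow_add]; exact SS_pow_Fsm hN' N
  | single σ q =>
    obtain ⟨n, σ⟩ := σ
    have hu : UniformContinuous fun t => F (σ t) :=
      CompactSpace.uniformContinuous_of_continuous (hF.comp σ.continuous)
    obtain ⟨δ, hδ, H⟩ := Metric.uniformContinuous_iff.1 hu (ε / 2) (half_pos hε)
    obtain ⟨N, hN⟩ := exists_pow_lt_of_lt_one hδ
      (show (n : ℝ) / (n + 1) < 1 from (div_lt_one (by positivity)).2 (by linarith))
    refine ⟨N, ?_⟩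
    have hs : Finsupp.single ⟨n, σ⟩ q = q • sx σ := by simp [sx]
    rw [hs, map_smul]
    refine Submodule.smul_mem _ _ ?_
    rw [← R_iot, SS_pow_R]
    refine map_mem_of_supported (fun l hl => ?_) (Sl_pow_mesh n N)
    change R σ (ls l) ∈ _
    obtain ⟨-, hl2, hl3⟩ := hl
    obtain ⟨m, v, rfl⟩ := exists_ofFn (l := l) (by rintro rfl; simp at hl2)
    rw [R_ofFn]
    have hball : ∀ t, dist (F (σ (comb v t))) (F (σ (v 0))) < ε / 2 := fun t => by
      refine H (lt_of_le_of_lt ?_ hN)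
      exact comb_mem_convex (convex_closedBall (v 0).1 _)
        (fun i => hl3 _ (List.mem_ofFn.2 ⟨i, rfl⟩) _ (List.mem_ofFn.2 ⟨0, rfl⟩)) t
    refine Finsupp.single_mem_supported _ _ fun t t' => ?_
    change dist (F (σ (comb v t))) (F (σ (comb v t'))) < ε
    have := dist_triangle_right (F (σ (comb v t))) (F (σ (comb v t'))) (F (σ (v 0)))
    linarith [hball t, hball t']

/-- A homotopy of all singular simplices. -/
abbrev SxHtp (X Y : Type) [TopologicalSpace X] [TopologicalSpace Y] : Type :=
  ∀ n : ℕ, C(Dl n, X) → C(Dl n × unitInterval, Y)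

/-- Compatibility with maps of vertices. -/
def SxHtp.Nat (T : SxHtp X Y) : Prop :=
  ∀ (m n : ℕ) (σ : C(Dl n, X)) (v : Fin (m + 1) → Dl n), (∀ i, ∃ j, v i = stdSimplex.vertex j) →
    T m (σ.comp (comb v)) = (T n σ).comp ((comb v).prodMap (ContinuousMap.id _))

/-- The end of a homotopy of simplices. -/
def SxHtp.op (T : SxHtp X Y) (s : unitInterval) : Ch X →ₗ[ℚ] Ch Y :=
  lin fun σ => sx ((T σ.1 σ.2).comp ⟨fun t => (t, s), by fun_prop⟩)

/-- The prism operator of a homotopy of simplices. -/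
def SxHtp.opH (T : SxHtp X Y) : Ch X →ₗ[ℚ] Ch Y :=
  lin fun σ => R (T σ.1 σ.2) (Pl (ls (iot σ.1)))

lemma SxHtp.op_Deg (T : SxHtp X Y) (s : unitInterval) {j : ℤ} {c : Ch X} (hc : c ∈ Deg X j) :
    T.op s c ∈ Deg Y j := by
  refine map_mem_of_Deg (fun n σ hσ => ?_) hc
  rw [op, lin_sx, ← hσ]
  exact sx_mem_Deg _

lemma SxHtp.opH_R {T : SxHtp X Y} (hT : T.Nat) {n : ℕ} (σ : C(Dl n, X)) {l : List (Dl n)}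
    (hl : ∀ x ∈ l, ∃ j, x = stdSimplex.vertex j) :
    T.opH (R σ (ls l)) = R (T n σ) (Pl (ls l)) := by
  rcases eq_or_ne l [] with rfl | hl'
  · simp [Pl]
  · obtain ⟨m, v, rfl⟩ := exists_ofFn hl'
    have h2 := R_lmap (T n σ) (isAff_prodMap (isAff_comb v) isAff_id) (Pl (ls (iot m)))
    have h3 : ⇑((comb v).prodMap (ContinuousMap.id unitInterval)) = Prod.map (comb v) id := rfl
    rw [h3] at h2
    rw [R_ofFn, opH, lin_sx]
    change R (T m (σ.comp (comb v))) (Pl (ls (iot m))) = _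
    rw [hT m n σ v fun i => hl _ (List.mem_ofFn.2 ⟨i, rfl⟩), ← map_iot, ← lmap_ls, ← lmap_Pl, h2]

theorem SxHtp.dd_opH {T : SxHtp X Y} (hT : T.Nat) (c : Ch X) :
    dd (T.opH c) = T.op 1 c - T.op 0 c - T.opH (dd c) :=
  sx_ext (F := dd ∘ₗ T.opH) (G := T.op 1 - T.op 0 - T.opH ∘ₗ dd) (fun n σ => by
    change dd (T.opH (sx σ)) = T.op 1 (sx σ) - T.op 0 (sx σ) - T.opH (dd (sx σ))
    have h2 (s : unitInterval) : R (T n σ) (lmap (fun x => (x, s)) (ls (iot n))) =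
        T.op s (sx σ) := by
      rw [op, lin_sx, ← R_iot]
      exact R_lmap _ (isAff_prodMk_const s) _
    have h3 : T.opH (R σ (bd (ls (iot n)))) = R (T n σ) (Pl (bd (ls (iot n)))) := by
      have h4 : (T.opH ∘ₗ R σ - R (T n σ) ∘ₗ Pl) (bd (ls (iot n))) ∈ (⊥ : Submodule ℚ (Ch Y)) := by
        refine map_mem_of_supported (fun l hl => ?_) (bd_sublist (iot n))
        change T.opH (R σ (ls l)) - R (T n σ) (Pl (ls l)) ∈ _
        rw [SxHtp.opH_R hT σ fun x hx => ?_, sub_self]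
        · exact zero_mem _
        · obtain ⟨j, hj⟩ := List.mem_ofFn.1 (hl.1 hx)
          exact ⟨j, hj.symm⟩
      exact sub_eq_zero.1 h4
    rw [dd_sx, h3, opH, lin_sx, dd_R, bd_Pl, ← h2, ← h2]
    simp only [map_sub]) c

end

/-! ### Small moves in a chart -/

section
variable {n : ℕ} {X : Type} [TopologicalSpace X]

/-- A cut-off function. -/
def cut (r : ℝ) (u : Fin n → ℝ) : ℝ := max 0 (min 1 (r - ‖u‖))

lemma continuous_cut (r : ℝ) : Continuous (cut (n := n) r) := by
  unfold cut
  fun_prop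

lemma cut_nonneg (r : ℝ) (u : Fin n → ℝ) : 0 ≤ cut r u := le_max_left _ _

lemma cut_le (r : ℝ) (u : Fin n → ℝ) : cut r u ≤ 1 := max_le zero_le_one (min_le_left _ _)

lemma cut_one {r : ℝ} {u : Fin n → ℝ} (h : ‖u‖ + 1 ≤ r) : cut r u = 1 := by
  rw [cut, min_eq_left (by linarith), max_eq_right zero_le_one]

lemma cut_zero {r : ℝ} {u : Fin n → ℝ} (h : r ≤ ‖u‖) : cut r u = 0 := by
  rw [cut, max_eq_left]
  exact (min_le_right _ _).trans (by linarith)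

open Classical in
/-- Extension of a map from a chart by a given map outside. -/
def chartExt {Z W : Type} (ψ : (Fin n → ℝ) → X) (f : (Fin n → ℝ) → Z → W) (g : X → Z → W)
    (x : X) (z : Z) : W :=
  if h : ∃ u, ψ u = x then f h.choose z else g x z

lemma chartExt_chart {Z W : Type} {ψ : (Fin n → ℝ) → X} (hψ : Function.Injective ψ)
    (f : (Fin n → ℝ) → Z → W) (g : X → Z → W) (u : Fin n → ℝ) (z : Z) :
    chartExt ψ f g (ψ u) z = f u z := by
  have h : ∃ u', ψ u' = ψ u := ⟨u, rfl⟩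
  rw [chartExt, dif_pos h, hψ h.choose_spec]

lemma chartExt_off {Z W : Type} {ψ : (Fin n → ℝ) → X} (f : (Fin n → ℝ) → Z → W)
    (g : X → Z → W) {x : X} (hx : x ∉ Set.range ψ) (z : Z) : chartExt ψ f g x z = g x z :=
  dif_neg hx

lemma continuous_chartExt [T2Space X] {Z W : Type} [TopologicalSpace Z] [TopologicalSpace W]
    {ψ : (Fin n → ℝ) → X} (hψ : Topology.IsOpenEmbedding ψ) {f : (Fin n → ℝ) → Z → W}
    {g : X → Z → W} (hf : Continuous fun p : (Fin n → ℝ) × Z => f p.1 p.2)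
    (hg : Continuous fun p : X × Z => g p.1 p.2) {r : ℝ}
    (hfg : ∀ u z, r ≤ ‖u‖ → f u z = g (ψ u) z) :
    Continuous fun p : X × Z => chartExt ψ f g p.1 p.2 := by
  have hK : IsClosed (ψ '' Metric.closedBall 0 r) :=
    ((isCompact_closedBall _ _).image hψ.continuous).isClosed
  rw [continuous_iff_continuousAt]
  rintro ⟨x, z⟩
  by_cases hx : x ∈ Set.range ψ
  · obtain ⟨u, rfl⟩ := hx
    have h1 : Topology.IsOpenEmbedding (Prod.map ψ (id : Z → Z)) := hψ.prodMap .id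
    refine (h1.continuousAt_iff (x := (u, z)) (g := fun p : X × Z => chartExt ψ f g p.1 p.2)).1 ?_
    refine ContinuousAt.congr hf.continuousAt (Filter.Eventually.of_forall fun p => ?_)
    exact (chartExt_chart hψ.injective f g p.1 p.2).symm
  · have hx' : x ∈ (ψ '' Metric.closedBall 0 r)ᶜ := fun h => hx (Set.image_subset_range _ _ h)
    refine ContinuousAt.congr hg.continuousAt ?_
    filter_upwards [(hK.isOpen_compl.prod isOpen_univ).mem_nhds
      (show (x, z) ∈ (ψ '' Metric.closedBall 0 r)ᶜ ×ˢ (Set.univ : Set Z) from ⟨hx', trivial⟩)]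
      with p hp
    by_cases hp1 : p.1 ∈ Set.range ψ
    · obtain ⟨u, hu⟩ := hp1
      rw [← hu, chartExt_chart hψ.injective, hfg]
      by_contra hlt
      exact hp.1 ⟨u, by simpa using (not_le.1 hlt).le, hu⟩
    · rw [chartExt_off f g hp1]

/-- Translation inside a chart, cut off far away. -/
def gmove (ψ : (Fin n → ℝ) → X) (x : X) (w : Fin n → ℝ) : X :=
  chartExt ψ (fun u w => ψ (u + cut 3 u • w)) (fun x _ => x) x w

/-- The chart coordinate, cut off far away. -/
def gcoord (ψ : (Fin n → ℝ) → X) (x : X) : Fin n → ℝ :=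
  chartExt ψ (fun u (_ : Unit) => cut 4 u • u) (fun _ _ => 0) x ()

lemma continuous_gmove [T2Space X] {ψ : (Fin n → ℝ) → X} (hψ : Topology.IsOpenEmbedding ψ) :
    Continuous fun p : X × (Fin n → ℝ) => gmove ψ p.1 p.2 := by
  have := continuous_cut (n := n) 3
  have := hψ.continuous
  exact continuous_chartExt (r := 3) hψ (by fun_prop) (by fun_prop)
    fun u z hu => by simp [cut_zero hu]

lemma continuous_gcoord [T2Space X] {ψ : (Fin n → ℝ) → X} (hψ : Topology.IsOpenEmbedding ψ) :
    Continuous (gcoord ψ) := by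
  have := continuous_cut (n := n) 4
  have h := continuous_chartExt (r := 4) hψ
    (f := fun u (_ : Unit) => cut 4 u • u) (g := fun _ _ => 0) (by fun_prop) (by fun_prop)
    fun u z hu => by simp [cut_zero hu]
  exact h.comp (f := fun x : X => (x, ())) (by fun_prop)

lemma gmove_zero {ψ : (Fin n → ℝ) → X} (hψ : Function.Injective ψ) (x : X) :
    gmove ψ x 0 = x := by
  by_cases hx : x ∈ Set.range ψ
  · obtain ⟨u, rfl⟩ := hx
    rw [gmove, chartExt_chart hψ]
    simp
  · rw [gmove, chartExt_off _ _ hx]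

lemma gmove_near {ψ : (Fin n → ℝ) → X} (hψ : Function.Injective ψ) {x : X}
    {w : Fin n → ℝ} (hw : ‖w‖ < 1) (h : gmove ψ x w ∈ ψ '' Metric.closedBall 0 1) :
    gmove ψ x w = ψ (gcoord ψ x + w) := by
  by_cases hx : x ∈ Set.range ψ
  · obtain ⟨u, rfl⟩ := hx
    rw [gmove, chartExt_chart hψ] at h ⊢
    rw [gcoord, chartExt_chart hψ]
    obtain ⟨y, hy, hyu⟩ := h
    obtain rfl := hψ hyu
    have h1 : ‖u + cut 3 u • w‖ ≤ 1 := by simpa using hy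
    have h2 : ‖cut 3 u • w‖ ≤ 1 := by
      rw [norm_smul, Real.norm_of_nonneg (cut_nonneg _ _)]
      exact mul_le_one₀ (cut_le _ _) (norm_nonneg _) hw.le
    have h3 : ‖u‖ ≤ 2 := by
      have := norm_sub_le (u + cut 3 u • w) (cut 3 u • w)
      rw [add_sub_cancel_right] at this
      linarith
    rw [cut_one (by linarith), cut_one (by linarith), one_smul, one_smul]
  · rw [gmove, chartExt_off _ _ hx] at h
    exact absurd (Set.image_subset_range _ _ h) hx

/-- The affine approximation of a map on a simplex. -/
def avg (F : X → Fin n → ℝ) {m : ℕ} (σ : C(Dl m, X)) (t : Dl m) : Fin n → ℝ :=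
  ∑ i, t i • F (σ (stdSimplex.vertex i))

lemma continuous_avg (F : X → Fin n → ℝ) {m : ℕ} (σ : C(Dl m, X)) : Continuous (avg F σ) := by
  refine continuous_finsetSum _ fun i _ => ?_
  have h : Continuous fun t : Dl m => t i := (continuous_apply i).comp continuous_subtype_val
  exact h.smul continuous_const

lemma avg_comb (F : X → Fin n → ℝ) {m k : ℕ} (σ : C(Dl m, X)) (v : Fin (k + 1) → Dl m)
    (hv : ∀ i, ∃ j, v i = stdSimplex.vertex j) (t : Dl k) :
    avg F (σ.comp (comb v)) t = avg F σ (comb v t) := by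
  have h1 : ∀ j, (comb v t) j = ∑ i, t i * (v i) j := fun j => by
    change (∑ i, t i • (v i : Fin _ → ℝ)) j = _
    simp only [Finset.sum_apply, Pi.smul_apply, smul_eq_mul]
  simp only [avg, ContinuousMap.comp_apply, comb_vertex, h1, Finset.sum_smul]
  rw [Finset.sum_comm]
  refine Finset.sum_congr rfl fun i _ => ?_
  obtain ⟨j, hj⟩ := hv i
  rw [hj, Finset.sum_eq_single j]
  · have : (stdSimplex.vertex j : Dl m) j = 1 := by
      change (stdSimplex.vertex j : Dl m).1 j = 1
      simp
    rw [this, mul_one]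
  · intro j' _ hj'
    have : (stdSimplex.vertex j : Dl m) j' = 0 := by
      change (stdSimplex.vertex j : Dl m).1 j' = 0
      simp [hj']
    rw [this, mul_zero, zero_smul]
  · simp

lemma avg_sub_lt {F : X → Fin n → ℝ} {m : ℕ} {σ : C(Dl m, X)} {ε : ℝ}
    (h : ∀ t t', dist (F (σ t)) (F (σ t')) < ε) (t : Dl m) : ‖avg F σ t - F (σ t)‖ < ε := by
  have := (convex_ball (F (σ t)) ε).sum_mem (t := Finset.univ) (w := t.1)
    (z := fun i => F (σ (stdSimplex.vertex i))) (fun i _ => t.2.1 i) t.2.2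
    fun i _ => h _ _
  exact mem_ball_iff_norm.1 this

/-- The homotopy moving simplices to affine ones inside a chart. -/
def gT [T2Space X] {ψ : (Fin n → ℝ) → X} (hψ : Topology.IsOpenEmbedding ψ) (v : Fin n → ℝ) :
    SxHtp X X := fun _ σ =>
  ⟨fun p => gmove ψ (σ p.1) ((p.2 : ℝ) • (avg (gcoord ψ) σ p.1 - gcoord ψ (σ p.1) + v)), by
    have h1 := continuous_gmove hψ
    have h2 := continuous_gcoord hψ
    have h3 := continuous_avg (gcoord ψ) σ
    exact h1.comp (f := fun p : Dl _ × unitInterval => (σ p.1, (p.2 : ℝ) •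
      (avg (gcoord ψ) σ p.1 - gcoord ψ (σ p.1) + v))) (by fun_prop)⟩

lemma gT_nat [T2Space X] {ψ : (Fin n → ℝ) → X} (hψ : Topology.IsOpenEmbedding ψ)
    (v : Fin n → ℝ) : (gT hψ v).Nat := fun m k σ w hw => by
  ext p
  change gmove ψ _ _ = gmove ψ _ _
  rw [avg_comb _ _ _ hw]
  rfl

/-- Moving a cycle into affine position inside a chart. -/
theorem exists_move [T2Space X] {ψ : (Fin n → ℝ) → X} (hψ : Topology.IsOpenEmbedding ψ) {e : ℕ}
    {z : Ch X} (hz : z ∈ Deg X e) (hd : dd z = 0) {K : Set X} (hK : z ∈ Cin K) {δ : ℝ}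
    (hδ : 0 < δ) (hδ1 : δ ≤ 1) : ∃ V : Finset (Fin (e + 1) → Fin n → ℝ), ∀ v, ‖v‖ < δ / 2 →
      ∃ z' ∈ Deg X e, dd z' = 0 ∧ (∀ a : Ch X →ₗ[ℚ] ℚ, a ∘ₗ dd = 0 → a z' = a z) ∧
        z' ∈ Cin {y | ∃ x ∈ K, ∃ w, ‖w‖ < δ ∧ y = gmove ψ x w} ∧
        z' ∈ Cin {y | y ∈ ψ '' Metric.closedBall 0 1 →
          ∃ p ∈ V, ∃ t : Dl e, y = ψ (∑ i, t i • p i + v)} := by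
  classical
  obtain ⟨N, hN⟩ := exists_SS_Fsm (continuous_gcoord hψ) (half_pos hδ) z
  obtain ⟨H, hH, -, -⟩ := exists_SS_homotopy (X := X) N
  have hc1 : (SS ^ N) z ∈ Deg X e := SS_pow_Deg hz N
  have hc2 : dd ((SS ^ N) z) = 0 := by rw [dd_SS_pow, hd, map_zero]
  have hc3 : (SS ^ N) z ∈ Cin K := SS_pow_Cin hK N
  have hc4 : z - (SS ^ N) z = dd (H z) := by rw [← hH z, hd, map_zero, add_zero]
  obtain ⟨c, hc⟩ : ∃ c, c = (SS ^ N) z := ⟨_, rfl⟩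
  rw [← hc] at hc1 hc2 hc3 hc4 hN
  refine ⟨c.support.image fun σ i => if h : σ.1 = e then
    gcoord ψ (σ.2 (stdSimplex.vertex (Fin.cast (by rw [h]) i))) else 0, fun v hv => ?_⟩
  have h0 : (gT hψ v).op 0 c = c := sx_ext (F := (gT hψ v).op 0) (G := LinearMap.id)
    (fun m σ => by
      rw [SxHtp.op, lin_sx, LinearMap.id_apply]
      congr 1
      ext t
      change gmove ψ (σ t) ((0 : ℝ) • _) = σ t
      rw [zero_smul, gmove_zero hψ.injective]) c
  have h1 := SxHtp.dd_opH (gT_nat hψ v) c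
  rw [h0, hc2, map_zero, sub_zero] at h1
  have hsupp : ∀ A : Set X, (∀ σ : C(Dl e, X), (⟨e, σ⟩ : Sx X) ∈ c.support → (∀ t, σ t ∈ K) →
      (∀ t, ‖avg (gcoord ψ) σ t - gcoord ψ (σ t) + v‖ < δ) →
      ∀ t, gmove ψ (σ t) (avg (gcoord ψ) σ t - gcoord ψ (σ t) + v) ∈ A) →
      (gT hψ v).op 1 c ∈ Cin A := fun A hA => by
    refine map_mem_of_supported (s := (c.support : Set (Sx X))) (fun σ hσ => ?_)
      ((Finsupp.mem_supported ℚ c).2 subset_rfl)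
    obtain ⟨m, σ⟩ := σ
    have hm : m = e := by exact_mod_cast hc1 hσ
    subst hm
    change (gT hψ v).op 1 (sx σ) ∈ Cin A
    rw [SxHtp.op, lin_sx]
    refine sx_mem_Cin fun t => ?_
    change gmove ψ (σ t) ((1 : ℝ) • _) ∈ A
    rw [one_smul]
    refine hA σ hσ (hc3 hσ) (fun t => ?_) t
    have := norm_add_le (avg (gcoord ψ) σ t - gcoord ψ (σ t)) v
    have h5 := avg_sub_lt (F := gcoord ψ) (σ := σ) (hN hσ) t
    linarith
  refine ⟨(gT hψ v).op 1 c, SxHtp.op_Deg _ _ hc1, ?_, fun a ha => ?_, ?_, ?_⟩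
  · have := congrArg dd h1
    rw [dd_dd, map_sub, hc2, sub_zero] at this
    exact this.symm
  · have h2 := LinearMap.congr_fun ha (H z)
    have h3 := LinearMap.congr_fun ha ((gT hψ v).opH c)
    rw [LinearMap.comp_apply, ← hc4, map_sub] at h2
    rw [LinearMap.comp_apply, h1, map_sub] at h3
    simp only [LinearMap.zero_apply] at h2 h3
    linarith
  · exact hsupp _ fun σ _ hσK hσv t => ⟨_, hσK t, _, hσv t, rfl⟩
  · refine hsupp _ fun σ hσ _ hσv t hy => ⟨_, Finset.mem_image_of_mem _ hσ, t, ?_⟩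
    rw [gmove_near hψ.injective ((hσv t).trans_le hδ1) hy]
    simp only [dif_pos]
    congr 1
    rw [avg]
    simp only [Fin.cast_eq_self]
    abel

end

end

section

open Cvx

/-! ### General position -/

section
variable {n : ℕ}

lemma volume_affine_simplices {e : ℕ} (he : 2 * e < n) (p q : Fin (e + 1) → Fin n → ℝ) :
    MeasureTheory.volume {x : Fin n → ℝ | ∃ t t' : Dl e, x = ∑ i, t i • p i - ∑ i, t' i • q i} =
      0 := by
  obtain ⟨L, hL⟩ : ∃ L : (Fin e → ℝ) × (Fin e → ℝ) →ₗ[ℝ] (Fin n → ℝ), ∀ x, L x =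
      ∑ i, x.1 i • (p i.succ - p 0) - ∑ i, x.2 i • (q i.succ - q 0) :=
    ⟨((Fintype.linearCombination ℝ fun i : Fin e => p i.succ - p 0).comp (LinearMap.fst _ _ _)) -
      ((Fintype.linearCombination ℝ fun i : Fin e => q i.succ - q 0).comp (LinearMap.snd _ _ _)),
      fun x => by simp [Fintype.linearCombination_apply]⟩
  have hsum : ∀ (r : Fin (e + 1) → Fin n → ℝ) (t : Dl e),
      ∑ i, t i • r i = r 0 + ∑ i : Fin e, t i.succ • (r i.succ - r 0) := fun r t => by
    have h1 : ∑ i, t i = 1 := t.2.2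
    rw [Fin.sum_univ_succ] at h1 ⊢
    simp only [smul_sub, Finset.sum_sub_distrib]
    rw [← Finset.sum_smul, eq_sub_of_add_eq h1, sub_smul, one_smul]
    abel
  have hr : L.range ≠ ⊤ := fun h => by
    have h1 := LinearMap.finrank_range_le L
    rw [h, finrank_top] at h1
    simp at h1
    omega
  have h0 := MeasureTheory.Measure.addHaar_submodule MeasureTheory.volume _ hr
  rw [← MeasureTheory.measure_preimage_add MeasureTheory.volume (-(p 0 - q 0))] at h0
  refine MeasureTheory.measure_mono_null ?_ h0
  rintro x ⟨t, t', rfl⟩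
  refine ⟨(fun i => t i.succ, fun i => t' i.succ), ?_⟩
  rw [hL, hsum p, hsum q]
  dsimp only
  abel

lemma exists_avoid {e : ℕ} (he : 2 * e < n) (V W : Finset (Fin (e + 1) → Fin n → ℝ)) {ε : ℝ}
    (hε : 0 < ε) : ∃ v : Fin n → ℝ, ‖v‖ < ε ∧ ∀ p ∈ V, ∀ q ∈ W, ∀ t t' : Dl e,
      ∑ i, t i • p i ≠ ∑ i, t' i • q i + v := by
  have h0 : MeasureTheory.volume (⋃ p ∈ V, ⋃ q ∈ W,
      {x : Fin n → ℝ | ∃ t t' : Dl e, x = ∑ i, t i • p i - ∑ i, t' i • q i}) = 0 := by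
    refine (MeasureTheory.measure_biUnion_null_iff V.countable_toSet).2 fun p _ =>
      (MeasureTheory.measure_biUnion_null_iff W.countable_toSet).2 fun q _ =>
      volume_affine_simplices he p q
  have h1 : ¬ Metric.ball (0 : Fin n → ℝ) ε ⊆ ⋃ p ∈ V, ⋃ q ∈ W,
      {x : Fin n → ℝ | ∃ t t' : Dl e, x = ∑ i, t i • p i - ∑ i, t' i • q i} := fun h =>
    (Metric.isOpen_ball.measure_pos MeasureTheory.volume ⟨0, Metric.mem_ball_self hε⟩).ne'
      (MeasureTheory.measure_mono_null h h0)
  obtain ⟨v, hv, hv'⟩ := Set.not_subset.1 h1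
  refine ⟨v, by simpa using hv, fun p hp q hq t t' h => hv' ?_⟩
  simp only [Set.mem_iUnion]
  exact ⟨p, hp, q, hq, t, t', by rw [h]; abel⟩

lemma eventually_disjoint {M : Type} [TopologicalSpace M] [T2Space M]
    {Γ : M → (Fin n → ℝ) → M} (hΓ : Continuous fun p : M × (Fin n → ℝ) => Γ p.1 p.2)
    (hΓ0 : ∀ x, Γ x 0 = x) {K K' C : Set M} (hK : IsCompact K) (hK' : IsCompact K')
    (hC : IsClosed C) (h : ∀ x ∈ K, x ∈ K' → x ∉ C) : ∀ᶠ δ : ℝ in nhdsWithin 0 (Set.Ioi 0),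
      ∀ x ∈ K, ∀ x' ∈ K', ∀ w w', ‖w‖ < δ → ‖w'‖ < δ → Γ x w = Γ x' w' → Γ x w ∉ C := by
  have hev : ∀ᶠ w : (Fin n → ℝ) × (Fin n → ℝ) in nhds 0, ∀ x ∈ K ×ˢ K',
      Γ x.1 w.1 = Γ x.2 w.2 → Γ x.1 w.1 ∉ C := by
    refine (hK.prod hK').eventually_forall_of_forall_eventually fun x hx => ?_
    have ho : IsClosed {q : ((Fin n → ℝ) × (Fin n → ℝ)) × (M × M) |
        Γ q.2.1 q.1.1 = Γ q.2.2 q.1.2 ∧ Γ q.2.1 q.1.1 ∈ C} := by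
      have h1 : Continuous fun q : ((Fin n → ℝ) × (Fin n → ℝ)) × (M × M) => Γ q.2.1 q.1.1 :=
        hΓ.comp (f := fun q : ((Fin n → ℝ) × (Fin n → ℝ)) × (M × M) => (q.2.1, q.1.1))
          (by fun_prop)
      have h2 : Continuous fun q : ((Fin n → ℝ) × (Fin n → ℝ)) × (M × M) => Γ q.2.2 q.1.2 :=
        hΓ.comp (f := fun q : ((Fin n → ℝ) × (Fin n → ℝ)) × (M × M) => (q.2.2, q.1.2))
          (by fun_prop)
      exact (isClosed_eq h1 h2).inter (hC.preimage h1)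
    have hm := ho.isOpen_compl.mem_nhds (x := ((0 : (Fin n → ℝ) × (Fin n → ℝ)), x)) (by
      rintro ⟨h1, h2⟩
      simp only [Prod.fst_zero, Prod.snd_zero, hΓ0] at h1 h2
      exact h x.1 hx.1 (h1 ▸ hx.2) h2)
    filter_upwards [hm] with q hq h1 h2
    exact hq ⟨h1, h2⟩
  obtain ⟨δ, hδ, hball⟩ := Metric.eventually_nhds_iff_ball.1 hev
  filter_upwards [Ioo_mem_nhdsGT hδ] with r hr x hx x' hx' w w' hw hw'
  refine hball (w, w') ?_ (x, x') ⟨hx, hx'⟩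
  rw [mem_ball_zero_iff, Prod.norm_def]
  exact max_lt (hw.trans hr.2) (hw'.trans hr.2)

theorem exists_disjoint_cycles {M : Type} [TopologicalSpace M] [T2Space M] (𝒜 : Atl n M) {e : ℕ}
    (he : 2 * e < n) {z : Ch M} (hz : z ∈ Deg M e) (hd : dd z = 0) (k : ℕ) :
    ∃ (zs : Fin k → Ch M) (K : Fin k → Set M), (∀ i, zs i ∈ Deg M e) ∧ (∀ i, dd (zs i) = 0) ∧
      (∀ i, ∀ a : Ch M →ₗ[ℚ] ℚ, a ∘ₗ dd = 0 → a (zs i) = a z) ∧ (∀ i, zs i ∈ Cin (K i)) ∧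
      ∀ i j, i ≠ j → Disjoint (K i) (K j) := by
  classical
  have := 𝒜.fin
  have key : ∀ S : Finset (Fin k × Fin k × 𝒜.ι), ∃ (zs : Fin k → Ch M) (K : Fin k → Set M),
      (∀ i, zs i ∈ Deg M e) ∧ (∀ i, dd (zs i) = 0) ∧
      (∀ i, ∀ a : Ch M →ₗ[ℚ] ℚ, a ∘ₗ dd = 0 → a (zs i) = a z) ∧ (∀ i, zs i ∈ Cin (K i)) ∧
      (∀ i, IsCompact (K i)) ∧ ∀ c ∈ S, c.1 ≠ c.2.1 → ∀ x ∈ K c.1, x ∈ K c.2.1 →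
        x ∉ 𝒜.ψ c.2.2 '' Metric.closedBall 0 1 := by
    intro S
    induction S using Finset.induction_on with
    | empty =>
      obtain ⟨L, hL, hzL, -⟩ := exists_support z
      exact ⟨fun _ => z, fun _ => L, fun _ => hz, fun _ => hd, fun _ _ _ => rfl, fun _ => hzL,
        fun _ => hL, by simp⟩
    | insert c S hcS ih =>
      obtain ⟨zs, K, h1, h2, h3, h4, h5, h6⟩ := ih
      obtain ⟨p, q, s⟩ := c
      by_cases hpq : p = q
      · refine ⟨zs, K, h1, h2, h3, h4, h5, fun c hc hne => ?_⟩
        rcases Finset.mem_insert.1 hc with rfl | hc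
        · exact absurd hpq hne
        · exact h6 c hc hne
      have hψ := 𝒜.emb s
      have hcl : ∀ s, IsClosed (𝒜.ψ s '' Metric.closedBall 0 1) := fun s =>
        ((isCompact_closedBall _ _).image (𝒜.emb s).continuous).isClosed
      have hev : ∀ᶠ δ : ℝ in nhdsWithin 0 (Set.Ioi 0), ∀ c ∈ S, c.1 ≠ c.2.1 →
          ∀ x ∈ K c.1, ∀ x' ∈ K c.2.1, ∀ w w', ‖w‖ < δ → ‖w'‖ < δ →
            gmove (𝒜.ψ s) x w = gmove (𝒜.ψ s) x' w' →
            gmove (𝒜.ψ s) x w ∉ 𝒜.ψ c.2.2 '' Metric.closedBall 0 1 := by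
        rw [Filter.eventually_all_finset]
        intro c hc
        by_cases hne : c.1 = c.2.1
        · exact Filter.Eventually.of_forall fun _ h => absurd hne h
        filter_upwards [eventually_disjoint (continuous_gmove hψ) (gmove_zero hψ.injective)
          (h5 c.1) (h5 c.2.1) (hcl c.2.2) (h6 c hc hne)] with δ hδ _
        exact hδ
      obtain ⟨δ, hδ, hδ0, hδ1⟩ :=
        (hev.and (Ioo_mem_nhdsGT (zero_lt_one (α := ℝ)))).exists
      obtain ⟨V, hV⟩ := exists_move hψ (h1 p) (h2 p) (h4 p) hδ0 hδ1.le
      obtain ⟨W, hW⟩ := exists_move hψ (h1 q) (h2 q) (h4 q) hδ0 hδ1.le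
      obtain ⟨v, hv, hav⟩ := exists_avoid he V W (half_pos hδ0)
      obtain ⟨zp, p1, p2, p3, p4, p5⟩ := hV 0 (by simpa using half_pos hδ0)
      obtain ⟨zq, q1, q2, q3, q4, q5⟩ := hW v hv
      obtain ⟨Kp, cp, cp1, cp2⟩ := exists_support zp
      obtain ⟨Kq, cq, cq1, cq2⟩ := exists_support zq
      have hKi : ∀ i, ∀ y ∈ (if i = p then Kp else if i = q then Kq else K i),
          ∃ x ∈ K i, ∃ w, ‖w‖ < δ ∧ y = gmove (𝒜.ψ s) x w := by
        intro i y hy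
        split_ifs at hy with hp hq
        · subst hp; exact cp2 _ p4 hy
        · subst hq; exact cq2 _ q4 hy
        · exact ⟨y, hy, 0, by simpa using hδ0, (gmove_zero hψ.injective y).symm⟩
      refine ⟨fun i => if i = p then zp else if i = q then zq else zs i,
        fun i => if i = p then Kp else if i = q then Kq else K i, ?_, ?_, ?_, ?_, ?_, ?_⟩
      · intro i; dsimp only; split_ifs; exacts [p1, q1, h1 i]
      · intro i; dsimp only; split_ifs; exacts [p2, q2, h2 i]
      · intro i a ha
        dsimp only
        split_ifs
        exacts [(p3 a ha).trans (h3 p a ha), (q3 a ha).trans (h3 q a ha), h3 i a ha]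
      · intro i; dsimp only; split_ifs; exacts [cp1, cq1, h4 i]
      · intro i; dsimp only; split_ifs; exacts [cp, cq, h5 i]
      · intro c hc hne y hy hy' hyC
        rcases Finset.mem_insert.1 hc with rfl | hc
        · dsimp only at hy hy' hyC
          rw [if_pos rfl] at hy
          rw [if_neg (Ne.symm hpq), if_pos rfl] at hy'
          obtain ⟨a, ha, t, rfl⟩ := cp2 _ p5 hy hyC
          obtain ⟨b, hb, t', hbt⟩ := cq2 _ q5 hy' hyC
          refine hav a ha b hb t t' ?_
          have := hψ.injective hbt
          rwa [add_zero] at this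
        · obtain ⟨x, hx, w, hw, rfl⟩ := hKi _ y hy
          obtain ⟨x', hx', w', hw', hxx⟩ := hKi _ _ hy'
          exact hδ c hc hne x hx x' hx' w w' hw hw' hxx hyC
  obtain ⟨zs, K, h1, h2, h3, h4, h5, h6⟩ := key Finset.univ
  refine ⟨zs, K, h1, h2, h3, h4, fun i j hij => Set.disjoint_left.2 fun x hx hx' => ?_⟩
  obtain ⟨s, v, hv, rfl⟩ := 𝒜.cov x
  exact h6 (i, j, s) (Finset.mem_univ _) hij _ hx hx' ⟨v, by simpa using hv.le, rfl⟩

/-- Even cycles of small degree give cycles in configuration spaces. -/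
theorem exists_cycle_config {M : Type} [TopologicalSpace M] [T2Space M] (𝒜 : Atl n M) {e : ℕ}
    (hee : Even e) (he : 2 * e < n) {z : Ch M} (hz : z ∈ Deg M e) (hd : dd z = 0)
    (hb : ¬ RB e Set.univ ∅ z) (k : ℕ) : ∃ c ∈ Deg (unorderedConfig M k) (e * k : ℕ),
      dd c = 0 ∧ ¬ RB (e * k : ℕ) Set.univ ∅ c := by
  obtain ⟨a, ha, had, hN, haz⟩ := exists_normalized_cocycle hz hd hb
  obtain ⟨zs, K, h1, h2, h3, h4, h5⟩ := exists_disjoint_cycles 𝒜 he hz hd k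
  exact exists_cycle_unordered hee ha had hN h1 h2 (fun i => by rwa [h3 i a had]) h4 h5

end

end

section

open Cvx

/-! ### The diagonal pair of a manifold -/

section
variable {X : Type} [TopologicalSpace X] {M : Type} [TopologicalSpace M] {n : ℕ}

/-- The complement of the diagonal. -/
def offd (M : Type) : Set (M × M) := {p | p.1 ≠ p.2}

lemma isOpen_offd [T2Space M] : IsOpen (offd M) := isClosed_diagonal.isOpen_compl

/-- The part of the complement of the diagonal lying over `V`. -/
def offOn (V : Set M) : Set (M × M) := offd M ∩ V ×ˢ Set.univ

lemma isOpen_offOn [T2Space M] {V : Set M} (hV : IsOpen V) : IsOpen (offOn V) :=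
  isOpen_offd.inter (hV.prod isOpen_univ)

/-- Finite combinations of fibrewise copies of a chain. -/
def slice (μ : Ch M) : (M →₀ ℚ) →ₗ[ℚ] Ch (M × M) :=
  Finsupp.linearCombination ℚ fun x => push (fun y => (x, y)) μ

/-- The sum of the coefficients. -/
def csum (M : Type) : (M →₀ ℚ) →ₗ[ℚ] ℚ := Finsupp.linearCombination ℚ fun _ => 1

lemma slice_single (μ : Ch M) (x : M) : slice μ (Finsupp.single x 1) = push (fun y => (x, y)) μ := by
  simp [slice]

lemma csum_single (x : M) : csum M (Finsupp.single x 1) = 1 := by simp [csum]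

lemma supported_induction {V : Set M} {p : (M →₀ ℚ) → Prop} (h1 : ∀ x ∈ V, p (Finsupp.single x 1))
    (h0 : p 0) (ha : ∀ f g, p f → p g → p (f + g)) (hs : ∀ (q : ℚ) f, p f → p (q • f))
    {f : M →₀ ℚ} (hf : f ∈ Finsupp.supported ℚ ℚ V) : p f := by
  rw [Finsupp.supported_eq_span_single] at hf
  refine Submodule.span_induction (p := fun f _ => p f) ?_ h0 (fun f g _ _ => ha f g)
    (fun q f _ => hs q f) hf
  rintro _ ⟨x, hx, rfl⟩
  exact h1 x hx

lemma RB_supported {V : Set M} {j : ℤ} {W A : Set X} (G : (M →₀ ℚ) →ₗ[ℚ] Ch X)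
    (h : ∀ x ∈ V, RB j W A (G (Finsupp.single x 1))) {f : M →₀ ℚ}
    (hf : f ∈ Finsupp.supported ℚ ℚ V) : RB j W A (G f) :=
  supported_induction (p := fun f => RB j W A (G f)) h (by simpa using RB_of_mem (zero_mem _))
    (fun f g hf hg => by rw [map_add]; exact hf.add hg)
    (fun q f hf => by rw [map_smul]; exact hf.smul q) hf

lemma mem_supported_map {V : Set M} (G : (M →₀ ℚ) →ₗ[ℚ] Ch X) (S : Submodule ℚ (Ch X))
    (h : ∀ x ∈ V, G (Finsupp.single x 1) ∈ S) {f : M →₀ ℚ}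
    (hf : f ∈ Finsupp.supported ℚ ℚ V) : G f ∈ S :=
  supported_induction (p := fun f => G f ∈ S) h (by simp)
    (fun f g hf hg => by rw [map_add]; exact add_mem hf hg)
    (fun q f hf => by rw [map_smul]; exact S.smul_mem q hf) hf

lemma slice_Deg {μ : Ch M} {j : ℤ} (hμ : μ ∈ Deg M j) (f : M →₀ ℚ) : slice μ f ∈ Deg (M × M) j :=
  mem_supported_map (V := Set.univ) _ _ (fun x _ => by rw [slice_single]; exact push_Deg _ hμ)
    (by simp)

lemma slice_Cin {μ : Ch M} {V B : Set M} (hμ : μ ∈ Cin B) {f : M →₀ ℚ}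
    (hf : f ∈ Finsupp.supported ℚ ℚ V) : slice μ f ∈ Cin (V ×ˢ B) :=
  mem_supported_map _ _ (fun x hx => by
    rw [slice_single]
    exact push_Cin (f := fun y => (x, y)) (A := B) (B := V ×ˢ B) (fun y hy => ⟨hx, hy⟩) hμ) hf

lemma dd_slice (μ : Ch M) (f : M →₀ ℚ) : dd (slice μ f) = slice (dd μ) f := by
  have : dd (slice μ f) - slice (dd μ) f ∈ (⊥ : Submodule ℚ (Ch (M × M))) :=
    mem_supported_map (V := Set.univ) (dd ∘ₗ slice μ - slice (dd μ)) ⊥ (fun x _ => by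
      simp only [LinearMap.sub_apply, LinearMap.comp_apply, slice_single, Submodule.mem_bot]
      rw [dd_push (A := Set.univ) (by fun_prop) (by simp), sub_self]) (by simp)
  exact sub_eq_zero.1 this

lemma slice_sub (μ ν : Ch M) (f : M →₀ ℚ) : slice (μ - ν) f = slice μ f - slice ν f := by
  have : slice (μ - ν) f - (slice μ f - slice ν f) ∈ (⊥ : Submodule ℚ (Ch (M × M))) :=
    mem_supported_map (V := Set.univ) (slice (μ - ν) - (slice μ - slice ν)) ⊥ (fun x _ => by
      simp only [LinearMap.sub_apply, slice_single, Submodule.mem_bot, map_sub, sub_self]) (by simp)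
  exact sub_eq_zero.1 this

lemma GV_replace {j : ℤ} {W A : Set X} {S : Set (Ch X)} {F : Submodule ℚ (Ch X)}
    (h : GV j W A (Submodule.span ℚ S))
    (hS : ∀ s ∈ S, ∃ f ∈ F, f ∈ Deg X j ∧ RB j W A (s - f)) : GV j W A F := by
  have key : ∀ s ∈ Submodule.span ℚ S, ∃ f ∈ F, f ∈ Deg X j ∧ RB j W A (s - f) := by
    intro s hs
    induction hs using Submodule.span_induction with
    | mem s hs => exact hS s hs
    | zero => exact ⟨0, zero_mem _, zero_mem _, by simpa using RB_of_mem (zero_mem _)⟩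
    | add x y _ _ hx hy =>
      obtain ⟨f, h1, h2, h3⟩ := hx
      obtain ⟨g, k1, k2, k3⟩ := hy
      exact ⟨f + g, add_mem h1 k1, add_mem h2 k2, by rw [add_sub_add_comm]; exact h3.add k3⟩
    | smul q x _ hx =>
      obtain ⟨f, h1, h2, h3⟩ := hx
      exact ⟨q • f, F.smul_mem q h1, Submodule.smul_mem _ q h2, by rw [← smul_sub]; exact h3.smul q⟩
  intro c hc hcW hcA
  obtain ⟨e, he, heW, s, hs, -, hr⟩ := h c hc hcW hcA
  obtain ⟨f, hf, hfd, e', he', heW', hr'⟩ := key s hs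
  refine ⟨e + e', add_mem he he', add_mem heW heW', f, hf, hfd, ?_⟩
  convert add_mem hr hr' using 1
  rw [map_add]
  abel

lemma offd_chart [T2Space M] {ψ : (Fin n → ℝ) → M} (hψ : Topology.IsOpenEmbedding ψ) {V : Set M}
    (oV : IsOpen V) (hV : V ⊆ Set.range ψ) :
    (∀ j : ℤ, j < n → HV j (V ×ˢ Set.univ) (offOn V)) ∧
      GV n (V ×ˢ Set.univ) (offOn V) (Submodule.span ℚ
        {s | ∃ z, ψ z ∈ V ∧ s = push (fun v => (ψ z, ψ (v + z))) (nu n)}) := by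
  rcases V.eq_empty_or_nonempty with rfl | ⟨x, hx⟩
  · have h : offOn (∅ : Set M) = ∅ ×ˢ Set.univ := by simp [offOn]
    rw [h]
    exact ⟨fun j _ => GV_self _ _ _, GV_self _ _ _⟩
  obtain ⟨z₀, rfl⟩ := hV hx
  have oZ : IsOpen (ψ ⁻¹' V) := oV.preimage hψ.continuous
  have : Nonempty (↥(ψ ⁻¹' V) × (Fin n → ℝ)) := ⟨⟨⟨z₀, hx⟩, 0⟩⟩
  obtain ⟨f, hf⟩ : ∃ f : ↥(ψ ⁻¹' V) × (Fin n → ℝ) → M × M, f = fun p => (ψ p.1, ψ (p.2 + p.1)) :=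
    ⟨_, rfl⟩
  have hemb : Topology.IsOpenEmbedding f := by
    let sh : (Fin n → ℝ) × (Fin n → ℝ) ≃ₜ (Fin n → ℝ) × (Fin n → ℝ) :=
      { toFun := fun p => (p.1, p.2 + p.1)
        invFun := fun p => (p.1, p.2 - p.1)
        left_inv := fun p => by simp
        right_inv := fun p => by simp
        continuous_toFun := by fun_prop
        continuous_invFun := by fun_prop }
    have := ((hψ.prodMap hψ).comp sh.isOpenEmbedding).comp
      (oZ.isOpenEmbedding_subtypeVal.prodMap (Topology.IsOpenEmbedding.id (X := Fin n → ℝ)))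
    rw [hf]
    exact this
  have him : f '' Set.univ = V ×ˢ Set.range ψ := by
    rw [hf]
    ext ⟨a, b⟩
    constructor
    · rintro ⟨⟨z, v⟩, -, h⟩
      simp only [Prod.mk.injEq] at h
      obtain ⟨rfl, rfl⟩ := h
      exact ⟨z.2, ⟨_, rfl⟩⟩
    · rintro ⟨ha, hb⟩
      obtain ⟨z, rfl⟩ := hV ha
      obtain ⟨w, rfl⟩ := hb
      exact ⟨⟨⟨z, ha⟩, w - z⟩, trivial, by simp⟩
  have hima : f '' {q | q.2 ≠ 0} = offOn V ∩ V ×ˢ Set.range ψ := by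
    rw [hf]
    ext ⟨a, b⟩
    constructor
    · rintro ⟨⟨z, v⟩, hv, h⟩
      simp only [Prod.mk.injEq] at h
      obtain ⟨rfl, rfl⟩ := h
      refine ⟨⟨fun h => hv ?_, z.2, trivial⟩, z.2, ⟨_, rfl⟩⟩
      have := hψ.injective h
      simpa using this
    · rintro ⟨⟨h1, -⟩, ha, hb⟩
      obtain ⟨z, rfl⟩ := hV ha
      obtain ⟨w, rfl⟩ := hb
      refine ⟨⟨⟨z, ha⟩, w - z⟩, fun h => h1 ?_, by simp⟩
      have : w = z := sub_eq_zero.1 h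
      simp [this]
  have oR : IsOpen (V ×ˢ Set.range ψ) := oV.prod hψ.isOpen_range
  have hU : offOn V ∪ V ×ˢ Set.range ψ = V ×ˢ Set.univ := by
    ext ⟨a, b⟩
    simp only [offOn, offd, Set.mem_union, Set.mem_inter_iff, Set.mem_prod, Set.mem_univ, and_true,
      Set.mem_ofPred_eq]
    refine ⟨fun h => by tauto, fun h => ?_⟩
    by_cases hab : a = b
    · subst hab
      exact Or.inr ⟨h, hV h⟩
    · exact Or.inl ⟨hab, h⟩
  constructor
  · intro j hj
    have := HV_emb hemb (HV_euclid_lt ↥(ψ ⁻¹' V) n j hj)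
    rw [him, hima] at this
    have := GV_excision oR (isOpen_offOn oV) this
    rwa [hU] at this
  · have := GV_emb hemb (GV_euclid ↥(ψ ⁻¹' V) n)
    rw [him, hima] at this
    have := GV_excision oR (isOpen_offOn oV) this
    rw [hU] at this
    refine this.mono ?_
    rw [nuSpan, Submodule.map_span_le]
    rintro _ ⟨z, rfl⟩
    refine Submodule.subset_span ⟨z, z.2, ?_⟩
    have h1 := push_push_continuous (f := fun v : Fin n → ℝ => (z, v)) (by fun_prop) f (nu n)
    rw [h1, hf]

variable [T2Space M] [ConnectedSpace M] {μ : Ch M}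

/-- The span of the fibrewise copies of `μ` over `V`. -/
def muSpan (μ : Ch M) (V : Set M) : Submodule ℚ (Ch (M × M)) :=
  (Finsupp.supported ℚ ℚ V).map (slice μ)

lemma GV_offd_chart (𝒜 : Atl n M) (hμ : μ ∈ Deg M n) (hdμ : dd μ = 0) (hb : ¬ RB n Set.univ ∅ μ)
    {ψ : (Fin n → ℝ) → M} (hψ : Topology.IsOpenEmbedding ψ) {V : Set M}
    (oV : IsOpen V) (hV : V ⊆ Set.range ψ) :
    GV n (V ×ˢ Set.univ) (offOn V) (muSpan μ V) := by
  refine GV_replace (offd_chart hψ oV hV).2 ?_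
  rintro _ ⟨z, hz, rfl⟩
  obtain ⟨e, he, -, f, hf, -, hr⟩ := GV_chart_point hψ z (GV_point z) μ hμ (by simp) (by simp [hdμ])
  rw [Submodule.map_span, Set.image_singleton, Submodule.mem_span_singleton] at hf
  obtain ⟨q, rfl⟩ := hf
  have hp := push_push_continuous (f := fun v : Fin n → ℝ => v + z) (by fun_prop) ψ (nu n)
  rw [hp] at hr
  have hq : q ≠ 0 := by
    rintro rfl
    exact 𝒜.not_RB_point hμ hdμ hb (ψ z) ⟨e, he, by simp, by simpa using hr⟩
  have h1 : RB n Set.univ {ψ z}ᶜ (push (fun v => ψ (v + z)) (nu n) - q⁻¹ • μ) := by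
    have h2 : RB n Set.univ {ψ z}ᶜ (μ - q • push (fun v => ψ (v + z)) (nu n)) :=
      ⟨e, he, by simp, by rwa [sub_right_comm]⟩
    have := (h2.smul q⁻¹).neg
    rwa [smul_sub, smul_smul, inv_mul_cancel₀ hq, one_smul, neg_sub] at this
  refine ⟨slice μ (Finsupp.single (ψ z) q⁻¹), ⟨_, Finsupp.single_mem_supported ℚ _ hz, rfl⟩,
    slice_Deg hμ _, ?_⟩
  have h3 : slice μ (Finsupp.single (ψ z) q⁻¹) = push (fun y => (ψ z, y)) (q⁻¹ • μ) := by
    rw [map_smul]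
    simp [slice]
  have h4 := push_push_continuous (f := fun v : Fin n → ℝ => ψ (v + z))
    (hψ.continuous.comp (by fun_prop)) (fun y : M => (ψ z, y)) (nu n)
  rw [h3, ← h4, ← map_sub]
  exact h1.push (f := fun y => (ψ z, y)) (W' := V ×ˢ Set.univ) (A' := offOn V) (by fun_prop)
    (fun y _ => ⟨hz, trivial⟩) (fun y hy => ⟨fun h => hy (Eq.symm h), hz, trivial⟩)

lemma offOn_union (V₁ V₂ : Set M) : offOn (V₁ ∪ V₂) = offOn V₁ ∪ offOn V₂ := by
  rw [offOn, Set.union_prod, Set.inter_union_distrib_left]; rfl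

lemma offOn_inter (V₁ V₂ : Set M) : offOn (V₁ ∩ V₂) = offOn V₁ ∩ offOn V₂ := by
  ext ⟨a, b⟩
  simp only [offOn, Set.mem_inter_iff, Set.mem_prod]
  tauto

lemma prod_univ_inter (V₁ V₂ : Set M) :
    (V₁ ∩ V₂) ×ˢ (Set.univ : Set M) = V₁ ×ˢ Set.univ ∩ V₂ ×ˢ Set.univ := by
  ext ⟨a, b⟩
  simp only [Set.mem_inter_iff, Set.mem_prod]
  tauto

lemma csum_chart (𝒜 : Atl n M) (hμ : μ ∈ Deg M n) (hdμ : dd μ = 0) (hb : ¬ RB n Set.univ ∅ μ)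
    {ψ : (Fin n → ℝ) → M} (hψ : Topology.IsOpenEmbedding ψ) {V : Set M} (oV : IsOpen V)
    (hV : V ⊆ ψ '' Metric.ball 0 1) {f : M →₀ ℚ} (hf : f ∈ Finsupp.supported ℚ ℚ V)
    (hR : RB n (V ×ˢ Set.univ) (offOn V) (slice μ f)) : csum M f = 0 := by
  obtain ⟨b, hbd, hdb, -, -, hbμ⟩ := chart_transfer hψ (isCompact_closedBall (0 : Fin n → ℝ) 1) hμ
    (by simp [hdμ])
  have hVr : V ⊆ Set.range ψ := hV.trans (Set.image_subset_range _ _)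
  have hd : RB n (V ×ˢ Set.univ) (offOn V) (slice (μ - push ψ b) f) := by
    refine RB_supported _ (fun x hx => ?_) hf
    rw [slice_single]
    refine hbμ.push (f := fun y => (x, y)) (W' := V ×ˢ Set.univ) (A' := offOn V) (by fun_prop)
      (fun y _ => ⟨hx, trivial⟩) (fun y hy => ⟨fun h => hy ?_, hx, trivial⟩)
    have h : x = y := h
    subst h
    exact Set.image_mono Metric.ball_subset_closedBall (hV hx)
  rw [slice_sub] at hd
  have h1 := hR.sub hd
  rw [sub_sub_cancel] at h1
  have hU : V ×ˢ Set.range ψ ∪ offOn V = V ×ˢ Set.univ := by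
    ext ⟨a, c⟩
    simp only [offOn, offd, Set.mem_union, Set.mem_inter_iff, Set.mem_prod, Set.mem_univ, and_true,
      Set.mem_ofPred_eq]
    refine ⟨fun h => by tauto, fun h => ?_⟩
    by_cases hac : a = c
    · subst hac
      exact Or.inl ⟨h, hVr h⟩
    · exact Or.inr ⟨hac, h⟩
  have hbr : push ψ b ∈ Cin (Set.range ψ) :=
    push_Cin (f := ψ) (A := Set.univ) (B := Set.range ψ) (fun y _ => ⟨y, rfl⟩) (by simp)
  have hdpb : dd (push ψ b) ∈ Cin (ψ '' Metric.closedBall 0 1)ᶜ := by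
    rw [dd_push (A := Set.univ) hψ.continuous.continuousOn (by simp)]
    refine push_Cin (f := ψ) (A := (Metric.closedBall 0 1)ᶜ) (fun y hy => ?_) hdb
    rintro ⟨w, hw, h⟩
    exact hy (hψ.injective h ▸ hw)
  have h2 := RB_excise (oV.prod hψ.isOpen_range) (isOpen_offOn oV) hU
    (slice_Deg (push_Deg ψ hbd) f) (slice_Cin hbr hf) (by
      rw [dd_slice]
      refine mem_supported_map _ _ (fun x hx => ?_) hf
      rw [slice_single]
      refine push_Cin (f := fun y => (x, y)) (B := offOn V) (fun y hy => ?_) hdpb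
      refine ⟨fun h => hy ?_, hx, trivial⟩
      have h : x = y := h
      subst h
      exact Set.image_mono Metric.ball_subset_closedBall (hV hx)) h1
  obtain ⟨g, hg⟩ : ∃ g : M × M → (Fin n → ℝ), g = fun p => Function.invFun ψ p.2 - Function.invFun ψ p.1 :=
    ⟨_, rfl⟩
  have hgc : ContinuousOn g (V ×ˢ Set.range ψ) := by
    rw [hg]
    refine ContinuousOn.sub ?_ ?_
    · exact (continuousOn_invFun hψ).comp continuousOn_snd fun p hp => hp.2
    · exact (continuousOn_invFun hψ).comp continuousOn_fst fun p hp => hVr hp.1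
  have h3 := h2.push (W' := Set.univ) (A' := {0}ᶜ) hgc (fun _ _ => trivial) (by
    rintro p ⟨⟨hp, -⟩, hp1, hp2⟩ h
    refine hp ?_
    have h : Function.invFun ψ p.2 - Function.invFun ψ p.1 = 0 := by rw [hg] at h; exact h
    rw [← emb_invFun (hVr hp1), ← emb_invFun hp2, sub_eq_zero.1 h])
  have h4 : RB n Set.univ {0}ᶜ (push g (slice (push ψ b) f) - csum M f • b) := by
    refine RB_supported (V := V) (push g ∘ₗ slice (push ψ b) - (csum M).smulRight b) (fun x hx => ?_) hf
    obtain ⟨w, hw, rfl⟩ := hV hx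
    simp only [LinearMap.sub_apply, LinearMap.comp_apply, slice_single, LinearMap.smulRight_apply,
      csum_single, one_smul]
    have e1 := push_push_continuous (f := ψ) hψ.continuous (fun y => (ψ w, y)) b
    have e2 := push_push_continuous (f := fun v => (ψ w, ψ v)) (by have := hψ.continuous; fun_prop) g b
    rw [e1, e2]
    have e3 : (fun x => g (ψ w, ψ x)) = fun v => v - w := by
      funext v
      rw [hg]
      simp only [invFun_emb hψ]
    rw [e3]
    have e4 := RB_homotopy (W := Set.univ) (W' := Set.univ) (A' := {0}ᶜ) hbd (by simp) hdb
      (H := fun v t => v - (t : ℝ) • w) (by fun_prop) (fun _ _ _ => trivial) (by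
        intro v hv t h
        refine hv ?_
        have h : v = (t : ℝ) • w := sub_eq_zero.1 h
        rw [mem_closedBall_zero_iff, h, norm_smul, Real.norm_eq_abs, abs_of_nonneg t.2.1]
        exact mul_le_one₀ t.2.2 (norm_nonneg _) (mem_ball_zero_iff.1 hw).le)
    simpa [push_id] using e4
  by_contra hne
  have h5 : RB n Set.univ {0}ᶜ b := by
    have := (h3.sub h4).smul (csum M f)⁻¹
    rwa [sub_sub_cancel, smul_smul, inv_mul_cancel₀ hne, one_smul] at this
  have h6 : RB n Set.univ {ψ 0}ᶜ (push ψ b) :=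
    h5.push hψ.continuous.continuousOn (fun _ _ => trivial) fun y hy h => hy (hψ.injective h)
  have h7 := (hbμ.mono subset_rfl (A' := {ψ 0}ᶜ) (by
    rw [Set.compl_subset_compl, Set.singleton_subset_iff]
    exact ⟨0, by simp, rfl⟩)).add h6
  rw [sub_add_cancel] at h7
  exact 𝒜.not_RB_point hμ hdμ hb _ h7

lemma csum_union (hμ : μ ∈ Deg M n) (hdμ : dd μ = 0) {V₁ V₂ : Set M} (o₁ : IsOpen V₁)
    (o₂ : IsOpen V₂)
    (h₁ : ∀ f ∈ Finsupp.supported ℚ ℚ V₁, RB n (V₁ ×ˢ Set.univ) (offOn V₁) (slice μ f) → csum M f = 0)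
    (h₂ : ∀ f ∈ Finsupp.supported ℚ ℚ V₂, RB n (V₂ ×ˢ Set.univ) (offOn V₂) (slice μ f) → csum M f = 0)
    (h : GV n ((V₁ ∩ V₂) ×ˢ Set.univ) (offOn (V₁ ∩ V₂)) (muSpan μ (V₁ ∩ V₂)))
    {f : M →₀ ℚ} (hf : f ∈ Finsupp.supported ℚ ℚ (V₁ ∪ V₂))
    (hR : RB n ((V₁ ∪ V₂) ×ˢ Set.univ) (offOn (V₁ ∪ V₂)) (slice μ f)) : csum M f = 0 := by
  obtain ⟨f₁, hf₁, f₂, hf₂, rfl⟩ : ∃ f₁ ∈ Finsupp.supported ℚ ℚ V₁, ∃ f₂ ∈ Finsupp.supported ℚ ℚ V₂,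
      f₁ + f₂ = f := by
    rw [Finsupp.supported_union, Submodule.mem_sup] at hf
    exact hf
  obtain ⟨e, he, heW, hr⟩ := hR
  obtain ⟨W₁, hW₁⟩ : ∃ W, W = V₁ ×ˢ (Set.univ : Set M) := ⟨_, rfl⟩
  obtain ⟨W₂, hW₂⟩ : ∃ W, W = V₂ ×ˢ (Set.univ : Set M) := ⟨_, rfl⟩
  have oW₁ : IsOpen W₁ := hW₁ ▸ o₁.prod isOpen_univ
  have oW₂ : IsOpen W₂ := hW₂ ▸ o₂.prod isOpen_univ
  have hA₁ : offOn V₁ ⊆ W₁ := by rw [hW₁]; exact Set.inter_subset_right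
  have hA₂ : offOn V₂ ⊆ W₂ := by rw [hW₂]; exact Set.inter_subset_right
  rw [Set.union_prod, ← hW₁, ← hW₂] at heW
  rw [offOn_union] at hr
  rw [prod_univ_inter, ← hW₁, ← hW₂, offOn_inter] at h
  rw [← hW₁] at h₁
  rw [← hW₂] at h₂
  obtain ⟨N₁, hN₁⟩ := small_chains oW₁ oW₂ heW
  obtain ⟨N₂, hN₂⟩ := small_chains (isOpen_offOn o₁) (isOpen_offOn o₂) hr
  obtain ⟨N, hN1, hN2⟩ : ∃ N, N₁ ≤ N ∧ N₂ ≤ N := ⟨max N₁ N₂, le_max_left _ _, le_max_right _ _⟩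
  obtain ⟨H, H1, H2, H3⟩ := exists_SS_homotopy (X := M × M) N
  obtain ⟨e₁, e₂, he₁, he₂, hes, -, hed⟩ := split_sup (hN₁ N hN1)
  obtain ⟨r₁, r₂, hr₁, hr₂, hrs, -, hrd⟩ := split_sup (hN₂ N hN2)
  obtain ⟨d₁, d₂⟩ := hed _ (SS_pow_Deg he N)
  have hΘ : ∀ g, slice μ g ∈ Deg (M × M) n := slice_Deg hμ
  have hdΘ : ∀ g, dd (slice μ g) = 0 := fun g => by rw [dd_slice, hdμ]; simp [slice, Finsupp.linearCombination_apply]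
  have hde : dd e ∈ Deg (M × M) n := by simpa using dd_Deg he
  obtain ⟨k₁, k₂⟩ := hrd n (SS_pow_Deg (sub_mem (hΘ _) hde) N)
  have hu : (Set.univ : Set M).MapsTo id Set.univ := fun _ _ => trivial
  have c₁ : slice μ f₁ ∈ Cin W₁ := hW₁ ▸ slice_Cin (by simp) hf₁
  have c₂ : slice μ f₂ ∈ Cin W₂ := hW₂ ▸ slice_Cin (by simp) hf₂
  have s₁ := H1 (slice μ f₁)
  have s₂ := H1 (slice μ f₂)
  rw [hdΘ, map_zero, add_zero] at s₁ s₂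
  have key : slice μ f₁ - dd (H (slice μ f₁)) - dd e₁ - r₁ =
      -(slice μ f₂ - dd (H (slice μ f₂)) - dd e₂ - r₂) := by
    rw [s₁, s₂, eq_neg_iff_add_eq_zero]
    have : (SS ^ N) (slice μ f₁) + (SS ^ N) (slice μ f₂) = dd e₁ + dd e₂ + (r₁ + r₂) := by
      rw [← map_add, ← map_add, ← map_add dd, ← hes, ← hrs, dd_SS_pow, ← map_add]
      congr 1
      abel
    rw [← sub_eq_zero.2 this]
    abel
  obtain ⟨g, hg⟩ : ∃ g, g = slice μ f₁ - dd (H (slice μ f₁)) - dd e₁ - r₁ := ⟨_, rfl⟩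
  have hg' : g = -(slice μ f₂ - dd (H (slice μ f₂)) - dd e₂ - r₂) := hg.trans key
  have dH : ∀ g, dd (H (slice μ g)) ∈ Deg (M × M) n := fun g => by
    simpa using dd_Deg (H3 _ _ (hΘ g))
  have gD : g ∈ Deg (M × M) n := by
    rw [hg]
    exact sub_mem (sub_mem (sub_mem (hΘ _) (dH _)) (by simpa using dd_Deg d₁)) k₁
  have g1 : g ∈ Cin W₁ := by
    rw [hg]
    exact sub_mem (sub_mem (sub_mem c₁ (dd_Cin (H2 _ _ c₁))) (dd_Cin he₁)) (Cin_mono hA₁ hr₁)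
  have g2 : g ∈ Cin W₂ := by
    rw [hg']
    exact neg_mem (sub_mem (sub_mem (sub_mem c₂ (dd_Cin (H2 _ _ c₂))) (dd_Cin he₂)) (Cin_mono hA₂ hr₂))
  have g3 : dd g ∈ Cin (offOn V₁) := by
    rw [hg]
    simp only [map_sub, dd_dd, hdΘ, sub_zero, zero_sub]
    exact neg_mem (dd_Cin hr₁)
  have g4 : dd g ∈ Cin (offOn V₂) := by
    rw [hg']
    simp only [map_sub, map_neg, dd_dd, hdΘ, sub_zero, zero_sub, neg_neg]
    exact dd_Cin hr₂
  obtain ⟨e', he', heW', _, ⟨f', hf', rfl⟩, -, ha'⟩ := h g gD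
    ((Cin_inter W₁ W₂) ▸ Submodule.mem_inf.2 ⟨g1, g2⟩)
    ((Cin_inter (offOn V₁) (offOn V₂)) ▸ Submodule.mem_inf.2 ⟨g3, g4⟩)
  have hf'1 : f' ∈ Finsupp.supported ℚ ℚ V₁ := Finsupp.supported_mono Set.inter_subset_left hf'
  have hf'2 : f' ∈ Finsupp.supported ℚ ℚ V₂ := Finsupp.supported_mono Set.inter_subset_right hf'
  have z₁ : csum M (f₁ - f') = 0 := by
    refine h₁ _ (sub_mem hf₁ hf'1) ⟨H (slice μ f₁) + e₁ + e', add_mem (add_mem (H3 _ _ (hΘ _)) d₁) he',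
      add_mem (add_mem (H2 _ _ c₁) he₁) (Cin_mono Set.inter_subset_left heW'), ?_⟩
    have : slice μ (f₁ - f') - dd (H (slice μ f₁) + e₁ + e') = r₁ + (g - dd e' - slice μ f') := by
      rw [hg]
      simp only [map_sub, map_add]
      abel
    rw [this]
    exact add_mem hr₁ (Cin_mono Set.inter_subset_left ha')
  have z₂ : csum M (f₂ + f') = 0 := by
    refine h₂ _ (add_mem hf₂ hf'2) ⟨H (slice μ f₂) + e₂ - e', sub_mem (add_mem (H3 _ _ (hΘ _)) d₂) he',
      sub_mem (add_mem (H2 _ _ c₂) he₂) (Cin_mono Set.inter_subset_right heW'), ?_⟩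
    have : slice μ (f₂ + f') - dd (H (slice μ f₂) + e₂ - e') = r₂ - (g - dd e' - slice μ f') := by
      rw [hg']
      simp only [map_sub, map_add]
      abel
    rw [this]
    exact sub_mem hr₂ (Cin_mono Set.inter_subset_right ha')
  have := congrArg₂ (· + ·) z₁ z₂
  simp only [map_sub, map_add, add_zero] at this ⊢
  rw [← this]
  ring

theorem csum_eq_zero (𝒜 : Atl n M) (hμ : μ ∈ Deg M n) (hdμ : dd μ = 0) (hb : ¬ RB n Set.univ ∅ μ)
    (s : Finset 𝒜.ι) : ∀ V : Set M, IsOpen V → (V ⊆ ⋃ i ∈ s, 𝒜.ψ i '' Metric.ball 0 1) →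
    ∀ f ∈ Finsupp.supported ℚ ℚ V, RB n (V ×ˢ Set.univ) (offOn V) (slice μ f) → csum M f = 0 := by
  classical
  induction s using Finset.induction_on with
  | empty =>
    intro V _ hV f hf _
    have : V = ∅ := Set.subset_empty_iff.1 (by simpa using hV)
    subst this
    have : f = 0 := by simpa using hf
    simp [this]
  | insert a s ha ih =>
    intro V oV hV f hf hR
    have oB : IsOpen (𝒜.ψ a '' Metric.ball 0 1) := (𝒜.emb a).isOpenMap _ Metric.isOpen_ball
    have oS : IsOpen (⋃ i ∈ s, 𝒜.ψ i '' Metric.ball 0 1) :=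
      isOpen_biUnion fun i _ => (𝒜.emb i).isOpenMap _ Metric.isOpen_ball
    have hVu : V ∩ 𝒜.ψ a '' Metric.ball 0 1 ∪ V ∩ ⋃ i ∈ s, 𝒜.ψ i '' Metric.ball 0 1 = V := by
      rw [← Set.inter_union_distrib_left]
      rw [Finset.set_biUnion_insert] at hV
      exact Set.inter_eq_left.2 hV
    refine csum_union hμ hdμ (oV.inter oB) (oV.inter oS)
      (fun f hf hR => csum_chart 𝒜 hμ hdμ hb (𝒜.emb a) (oV.inter oB) Set.inter_subset_right hf hR)
      (ih _ (oV.inter oS) Set.inter_subset_right) ?_ (hVu.symm ▸ hf) (hVu.symm ▸ hR)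
    refine GV_offd_chart 𝒜 hμ hdμ hb (𝒜.emb a) ((oV.inter oB).inter (oV.inter oS)) ?_
    exact fun x hx => Set.image_subset_range _ _ hx.1.2

end

end

section

open Cvx

/-! ### The Thom class of the diagonal -/

section
variable {X : Type} [TopologicalSpace X] {M : Type} [TopologicalSpace M] {n : ℕ}

theorem exists_thom [T2Space M] [ConnectedSpace M] (𝒜 : Atl n M) {μ : Ch M} (hμ : μ ∈ Deg M n)
    (hdμ : dd μ = 0) (hb : ¬ RB n Set.univ ∅ μ) :
    ∃ u : Ch (M × M) →ₗ[ℚ] ℚ, HDeg n u ∧ u ∘ₗ dd = 0 ∧ (∀ x ∈ Cin (offd M), u x = 0) ∧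
      ∃ q : ℚ, q ≠ 0 ∧ ∀ x, u (push (fun y => (x, y)) μ) = q := by
  obtain ⟨x₀⟩ : Nonempty M := inferInstance
  have hcov : (Set.univ : Set M) ⊆ ⋃ i ∈ (Finset.univ : Finset 𝒜.ι), 𝒜.ψ i '' Metric.ball 0 1 := by
    intro x _
    obtain ⟨s, v, hv, rfl⟩ := 𝒜.cov x
    exact Set.mem_biUnion (Finset.mem_univ s) ⟨v, by simpa using hv, rfl⟩
  have hnb : ¬ RB n Set.univ (offd M) (slice μ (Finsupp.single x₀ 1)) := by
    intro h
    have h' := csum_eq_zero 𝒜 hμ hdμ hb Finset.univ Set.univ isOpen_univ hcov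
      (Finsupp.single x₀ 1) (by simp) (by simpa [offOn] using h)
    rw [csum_single] at h'
    exact one_ne_zero h'
  obtain ⟨u, h1, h2, h3, h4⟩ := exists_cocycle (slice_Deg hμ _) hnb
  rw [slice_single] at h4
  refine ⟨u, h1, h2, h3, _, h4, fun x => ?_⟩
  have hlc : IsLocallyConstant fun x : M => u (push (fun y => (x, y)) μ) := by
    rw [IsLocallyConstant.iff_eventually_eq]
    intro x
    obtain ⟨s, v, -, rfl⟩ := 𝒜.cov x
    have hN : Set.range (𝒜.ψ s) ∈ nhds (𝒜.ψ s v) := (𝒜.emb s).isOpen_range.mem_nhds ⟨v, rfl⟩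
    filter_upwards [hN]
    rintro _ ⟨w, rfl⟩
    have hc := (𝒜.emb s).continuous
    obtain ⟨H, hH⟩ : ∃ H : M → unitInterval → M × M,
        H = fun (y : M) (t : unitInterval) => (𝒜.ψ s (v + (t : ℝ) • (w - v)), y) := ⟨_, rfl⟩
    have h := dd_hP (A := Set.univ) (c := μ) (H := H) (by rw [hH]; fun_prop) (by simp)
    have h' := LinearMap.congr_fun h2 (hP H μ)
    rw [hdμ, map_zero, add_zero] at h
    rw [LinearMap.comp_apply, h, map_sub, hH] at h'
    simpa [sub_eq_zero] using h'
  exact hlc.apply_eq_of_preconnectedSpace x x₀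

lemma exists_diagonal_homotopy_aux [T2Space M] (𝒜 : Atl n M) (s : Finset 𝒜.ι) :
    ∃ G : M × M → M, Continuous G ∧ (∀ x, G (x, x) = x) ∧ ∃ N : Set (M × M), IsOpen N ∧
      (∀ i ∈ s, ∀ v, ‖v‖ < 1 → (𝒜.ψ i v, 𝒜.ψ i v) ∈ N) ∧ (∀ p ∈ N, G p = p.2) ∧
      ∀ (p : ℕ) (a : Ch M →ₗ[ℚ] ℚ), HDeg (p + 1) a → a ∘ₗ dd = 0 →
        ∃ η : Ch (M × M) →ₗ[ℚ] ℚ, HDeg p η ∧ η ∘ₗ dd = a ∘ₗ push G - a ∘ₗ push Prod.fst := by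
  classical
  induction s using Finset.induction_on with
  | empty =>
    refine ⟨Prod.fst, continuous_fst, fun _ => rfl, ∅, isOpen_empty, by simp, by simp, ?_⟩
    intro p a _ _
    exact ⟨0, fun _ _ _ => rfl, by simp⟩
  | insert i s hi ih =>
    obtain ⟨G, hG, hGd, N, oN, hN, hGN, hη⟩ := ih
    have hψ := 𝒜.emb i
    have h1 := continuous_gmove hψ
    have h2 := continuous_gcoord hψ
    obtain ⟨H, hH⟩ : ∃ H : M × M → unitInterval → M, H = fun (p : M × M) (t : unitInterval) =>
      gmove (𝒜.ψ i) (G p) ((t : ℝ) • (gcoord (𝒜.ψ i) p.2 - gcoord (𝒜.ψ i) (G p))) := ⟨_, rfl⟩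
    have hHc : Continuous fun p : (M × M) × unitInterval => H p.1 p.2 := by
      rw [hH]
      exact h1.comp (f := fun p : (M × M) × unitInterval => (G p.1,
        (p.2 : ℝ) • (gcoord (𝒜.ψ i) p.1.2 - gcoord (𝒜.ψ i) (G p.1)))) (by fun_prop)
    have hH0 : (fun p => H p 0) = G := by
      funext p
      simp [hH, gmove_zero hψ.injective]
    have hH1 : ∀ p, H p 1 = gmove (𝒜.ψ i) (G p) (gcoord (𝒜.ψ i) p.2 - gcoord (𝒜.ψ i) (G p)) := by
      intro p
      simp [hH]
    have hGs : ∀ p, G p = p.2 → H p 1 = p.2 := fun p hp => by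
      rw [hH1, hp, sub_self, gmove_zero hψ.injective]
    have oB : IsOpen (𝒜.ψ i '' Metric.ball 0 1) := hψ.isOpenMap _ Metric.isOpen_ball
    refine ⟨fun p => H p 1, hHc.comp (f := fun p : M × M => (p, (1 : unitInterval))) (by fun_prop),
      fun x => hGs (x, x) (hGd x),
      N ∪ (G ⁻¹' (𝒜.ψ i '' Metric.ball 0 1) ∩ Prod.snd ⁻¹' (𝒜.ψ i '' Metric.ball 0 1)),
      oN.union ((oB.preimage hG).inter (oB.preimage continuous_snd)), ?_, ?_, ?_⟩
    · intro j hj v hv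
      rcases Finset.mem_insert.1 hj with rfl | hj
      · refine Or.inr ⟨?_, ⟨v, by simpa using hv, rfl⟩⟩
        rw [Set.mem_preimage, hGd]
        exact ⟨v, by simpa using hv, rfl⟩
      · exact Or.inl (hN j hj v hv)
    · rintro ⟨x, y⟩ (hp | ⟨⟨u, hu, hGu⟩, ⟨v, hv, hpv⟩⟩)
      · exact hGs _ (hGN _ hp)
      · have hpv : 𝒜.ψ i v = y := hpv
        subst hpv
        rw [mem_ball_zero_iff] at hu hv
        change H _ 1 = 𝒜.ψ i v
        rw [hH1, ← hGu]
        simp only [gmove, gcoord, chartExt_chart hψ.injective]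
        rw [cut_one (by linarith : ‖u‖ + 1 ≤ 3), cut_one (by linarith : ‖u‖ + 1 ≤ 4),
          cut_one (by linarith : ‖v‖ + 1 ≤ 4)]
        simp
    · intro p a ha had
      obtain ⟨η, hη1, hη2⟩ := hη p a ha had
      refine ⟨η + a ∘ₗ hP H, fun m σ hm => ?_, LinearMap.ext fun c => ?_⟩
      · rw [LinearMap.add_apply, hη1 m σ hm, zero_add]
        exact ha.eq_zero (j := (m : ℤ) + 1) (by push_cast; omega) (hP_Deg H (sx_mem_Deg σ))
      · have e1 := LinearMap.congr_fun hη2 c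
        have e2 := dd_hP (A := Set.univ) (c := c) (H := H) hHc.continuousOn (by simp)
        have e3 := LinearMap.congr_fun had (hP H c)
        have e4 := congrArg a e2
        rw [map_add, map_sub, hH0] at e4
        simp only [LinearMap.comp_apply, LinearMap.add_apply, LinearMap.sub_apply,
          LinearMap.zero_apply] at e1 e3 ⊢
        rw [e3] at e4
        linarith

/-- Near the diagonal, the first projection can be deformed to the second one. -/
theorem exists_diagonal_homotopy [T2Space M] (𝒜 : Atl n M) :
    ∃ G : M × M → M, Continuous G ∧ ∃ N : Set (M × M), IsOpen N ∧ N ∪ offd M = Set.univ ∧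
      (∀ p ∈ N, G p = p.2) ∧
      ∀ (p : ℕ) (a : Ch M →ₗ[ℚ] ℚ), HDeg (p + 1) a → a ∘ₗ dd = 0 →
        ∃ η : Ch (M × M) →ₗ[ℚ] ℚ, HDeg p η ∧ η ∘ₗ dd = a ∘ₗ push G - a ∘ₗ push Prod.fst := by
  obtain ⟨G, hG, -, N, oN, hN, h⟩ := exists_diagonal_homotopy_aux 𝒜 Finset.univ
  refine ⟨G, hG, N, oN, Set.eq_univ_of_forall fun p => ?_, h⟩
  obtain ⟨x, y⟩ := p
  by_cases hxy : x = y
  · subst hxy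
    obtain ⟨i, v, hv, rfl⟩ := 𝒜.cov x
    exact Or.inl (hN i (Finset.mem_univ i) v hv)
  · exact Or.inr hxy

lemma cup_sub_left (p : ℕ) (α α' β : Ch X →ₗ[ℚ] ℚ) (c : Ch X) :
    cup p (α - α') β c = cup p α β c - cup p α' β c :=
  sx_ext (F := cup p (α - α') β) (G := cup p α β - cup p α' β) (fun n σ => by
    rw [LinearMap.sub_apply]
    simp only [cup, lin_sx, lcup, pull, LinearMap.sub_apply]
    ring) c

lemma cup_Cin_left (p : ℕ) {α : Ch X →ₗ[ℚ] ℚ} (β : Ch X →ₗ[ℚ] ℚ) {A : Set X}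
    (hα : ∀ x ∈ Cin A, α x = 0) {c : Ch X} (hc : c ∈ Cin A) : cup p α β c = 0 :=
  eq_of_Cin (F := cup p α β) (G := 0) (fun n σ h => by
    rw [cup, lin_sx, lcup, pull, hα _ (R_mem_Cin h _), zero_mul, LinearMap.zero_apply]) hc

lemma cup_Cin_right (p : ℕ) (α : Ch X →ₗ[ℚ] ℚ) {β : Ch X →ₗ[ℚ] ℚ} {A : Set X}
    (hβ : ∀ x ∈ Cin A, β x = 0) {c : Ch X} (hc : c ∈ Cin A) : cup p α β c = 0 :=
  eq_of_Cin (F := cup p α β) (G := 0) (fun n σ h => by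
    rw [cup, lin_sx, lcup, pull, pull, hβ _ (R_mem_Cin h _), mul_zero, LinearMap.zero_apply]) hc

lemma cup_comp_dd {p : ℕ} {α β : Ch X →ₗ[ℚ] ℚ} (hα : HDeg p α) (h : α ∘ₗ dd = 0)
    (h' : β ∘ₗ dd = 0) (c : Ch X) : cup p α β (dd c) = 0 := by
  rw [cup_dd hα, h, h', cup_zero_left, cup_zero_right, mul_zero, add_zero]

lemma comp_push_dd {Y : Type} [TopologicalSpace Y] {α : Ch Y →ₗ[ℚ] ℚ} (h : α ∘ₗ dd = 0)
    {f : X → Y} (hf : Continuous f) : (α ∘ₗ push f) ∘ₗ dd = 0 := LinearMap.ext fun c => by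
  have := LinearMap.congr_fun h (push f c)
  rw [LinearMap.comp_apply, dd_push (A := Set.univ) hf.continuousOn (by simp)] at this
  exact this

/-- The Thom class does not distinguish the two projections. -/
theorem cup_fst_eq_cup_snd [T2Space M] (𝒜 : Atl n M) {u : Ch (M × M) →ₗ[ℚ] ℚ} (hu : u ∘ₗ dd = 0)
    (huo : ∀ x ∈ Cin (offd M), u x = 0) {p : ℕ} {a : Ch M →ₗ[ℚ] ℚ} (ha : HDeg (p + 1) a)
    (had : a ∘ₗ dd = 0) {c : Ch (M × M)} (hc : dd c = 0) :
    cup (p + 1) (a ∘ₗ push Prod.fst) u c = cup (p + 1) (a ∘ₗ push Prod.snd) u c := by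
  obtain ⟨G, hG, N, oN, hNu, hGN, hη⟩ := exists_diagonal_homotopy 𝒜
  obtain ⟨η, hη1, hη2⟩ := hη p a ha had
  have h1 := cup_dd hη1 u c
  rw [hc, map_zero, hη2, hu, cup_zero_right, mul_zero, add_zero, cup_sub_left] at h1
  have h2 : cup (p + 1) (a ∘ₗ push G - a ∘ₗ push Prod.snd) u c = 0 := by
    obtain ⟨γ, hγ⟩ : ∃ γ, γ = a ∘ₗ push G - a ∘ₗ push Prod.snd := ⟨_, rfl⟩
    rw [← hγ]
    have d1 : HDeg (p + 1) γ := fun m σ hm => by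
      rw [hγ, LinearMap.sub_apply, ha.comp_push G m σ hm, ha.comp_push Prod.snd m σ hm, sub_zero]
    have d2 : γ ∘ₗ dd = 0 := by
      rw [hγ, LinearMap.sub_comp, comp_push_dd had hG, comp_push_dd had continuous_snd, sub_zero]
    have d3 : ∀ x ∈ Cin N, γ x = 0 := fun x hx => by
      rw [hγ, LinearMap.sub_apply, LinearMap.comp_apply, LinearMap.comp_apply,
        push_congr hGN hx, sub_self]
    obtain ⟨k, hk⟩ := small_chains oN isOpen_offd (c := c) (by rw [hNu]; simp)
    obtain ⟨H, H1, -, -⟩ := exists_SS_homotopy (X := M × M) k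
    obtain ⟨c₁, c₂, hc₁, hc₂, hcs, -, -⟩ := split_sup (hk k le_rfl)
    have h := H1 c
    rw [hc, map_zero, add_zero, eq_sub_iff_add_eq, hcs] at h
    rw [← h, map_add, map_add, cup_comp_dd d1 d2 hu, cup_Cin_left _ _ d3 hc₁,
      cup_Cin_right _ _ huo hc₂]
    simp
  rw [cup_sub_left] at h2
  linarith

end

end

section

open Cvx

/-! ### Poincaré duality, nonvanishing of the complementary Betti number -/

section
variable {X Y : Type} [TopologicalSpace X] [TopologicalSpace Y] {M : Type} [TopologicalSpace M] {n : ℕ}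

/-- The cap product with a cochain of degree `p`. -/
def cap (p : ℕ) (a : Ch X →ₗ[ℚ] ℚ) : Ch X →ₗ[ℚ] Ch X :=
  lin fun σ => pull a σ.2 ((iot σ.1).take (p + 1)) • R σ.2 (ls ((iot σ.1).drop p))

lemma cap_sx (p : ℕ) (a : Ch X →ₗ[ℚ] ℚ) {m : ℕ} (σ : C(Dl m, X)) : cap p a (sx σ) =
    pull a σ ((iot m).take (p + 1)) • R σ (ls ((iot m).drop p)) := lin_sx _ σ

lemma apply_cap (p : ℕ) (a w : Ch X →ₗ[ℚ] ℚ) (c : Ch X) : w (cap p a c) = cup p a w c :=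
  sx_ext (F := w ∘ₗ cap p a) (G := cup p a w) (fun m σ => by
    rw [LinearMap.comp_apply, cap_sx, map_smul, cup, lin_sx, lcup, smul_eq_mul]
    rfl) c

lemma cap_Deg {p : ℕ} (a : Ch X →ₗ[ℚ] ℚ) (hpn : p ≤ n) {c : Ch X} (hc : c ∈ Deg X n) :
    cap p a c ∈ Deg X (n - p : ℕ) := by
  refine map_mem_of_Deg (F := cap p a) (fun m σ hm => ?_) hc
  have hm : m = n := by exact_mod_cast hm
  subst hm
  rw [cap_sx]
  refine Submodule.smul_mem _ _ ?_
  have h := R_mem_Deg σ (ls_mem_LDeg ((iot m).drop p))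
  rwa [show (((iot m).drop p).length : ℤ) - 1 = (m - p : ℕ) by simp [iot]; omega] at h

lemma dd_cap {p : ℕ} {a : Ch X →ₗ[ℚ] ℚ} (ha : HDeg p a) (had : a ∘ₗ dd = 0) {c : Ch X}
    (hc : dd c = 0) : dd (cap p a c) = 0 := by
  refine Finsupp.ext fun σ => ?_
  have h := cup_dd ha (Finsupp.lapply σ) c
  rw [hc, map_zero, had, cup_zero_left, zero_add, ← apply_cap] at h
  exact (mul_eq_zero.1 h.symm).resolve_left (pow_ne_zero _ (by norm_num))

lemma cup_snd_crs {p d : ℕ} {a : Ch Y →ₗ[ℚ] ℚ} (ha : Nrm a) (u : Ch (X × Y) →ₗ[ℚ] ℚ) {c : Ch X}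
    (hc : c ∈ Deg X d) {c' : Ch Y} (hc' : c' ∈ Deg Y n) (hpn : p ≤ n) :
    cup p (a ∘ₗ push Prod.snd) u (crs c c') = (-1) ^ (p * d) * u (crs c (cap p a c')) := by
  refine crs_ext (F := crs.compr₂ (cup p (a ∘ₗ push Prod.snd) u))
      (G := ((-1 : ℚ) ^ (p * d)) • (crs.compl₂ (cap p a)).compr₂ u) (fun m σ k τ hm hk => ?_) hc hc'
  have hm : m = d := by exact_mod_cast hm
  have hk : k = n := by exact_mod_cast hk
  change cup p (a ∘ₗ push Prod.snd) u (crs (sx σ) (sx τ)) =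
    (-1 : ℚ) ^ (p * d) • u (crs (sx σ) (cap p a (sx τ)))
  have e : crs (sx σ) (R τ (ls ((iot k).drop p))) = R (σ.prodMap τ) (shl (iot m) ((iot k).drop p)) := by
    rw [← R_iot σ, crs_R, shu_ls]
  rw [cap_sx, map_smul, map_smul, e, crs_sx, cup_R, pull_push_snd, shu_ls,
    lin_take_snd_shl (d := d) (ha.pull τ) _ (by simp [iot, hm]) (by simp [iot]; omega), lin_pull]
  simp only [smul_eq_mul]

lemma cup_fst_crs {p : ℕ} {a : Ch X →ₗ[ℚ] ℚ} (ha : Nrm a) (u : Ch (X × Y) →ₗ[ℚ] ℚ) {q : ℚ}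
    {c : Ch X} (hc : c ∈ Deg X p) {c' : Ch Y} (hq : ∀ x, u (push (fun y => (x, y)) c') = q) :
    cup p (a ∘ₗ push Prod.fst) u (crs c c') = a c * q := by
  refine eq_of_Deg (F := cup p (a ∘ₗ push Prod.fst) u ∘ₗ crs.flip c') (G := (LinearMap.mul ℚ ℚ).flip q ∘ₗ a)
    (fun m σ hm => ?_) hc
  have hm : m = p := by exact_mod_cast hm
  change cup p (a ∘ₗ push Prod.fst) u (crs (sx σ) c') = a (sx σ) * q
  obtain ⟨v, hv⟩ : ∃ v, (iot m).drop p = [v] := List.length_eq_one_iff.1 (by simp [iot, hm])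
  rw [← hq (σ v)]
  refine sx_ext (F := cup p (a ∘ₗ push Prod.fst) u ∘ₗ crs (sx σ))
    (G := a (sx σ) • (u ∘ₗ push fun y => (σ v, y))) (fun k τ => ?_) c'
  change cup p (a ∘ₗ push Prod.fst) u (crs (sx σ) (sx τ)) = a (sx σ) • u (push _ (sx τ))
  have h1 : (iot m).take (p + 1) = iot m := List.take_of_length_le (by simp [iot, hm])
  rw [crs_sx, cup_R, pull_push_fst, shu_ls, lin_take_fst_shl (ha.pull σ) _ (by simp [iot, hm]), h1,
    hv, shl_singleton, map_sub, map_smul, lin_ls, pull_nil, smul_zero, sub_zero, lin_pull, pull,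
    R_iot, smul_eq_mul, ← R_iot τ,
    push_R (f := fun y => (σ v, y)) (g := τ) (by have := τ.continuous; fun_prop)]
  congr 2
  exact R_lmap (σ.prodMap τ) (φ := (⟨Prod.mk v, by fun_prop⟩ : C(Dl k, Dl m × Dl k)))
    (fun _ t => Prod.ext (comb_const v t).symm rfl) (ls (iot k))

theorem exists_dual_cycle [T2Space M] [ConnectedSpace M] (𝒜 : Atl n M) {μ : Ch M}
    (hμ : μ ∈ Deg M n) (hdμ : dd μ = 0) (hb : ¬ RB n Set.univ ∅ μ) {d : ℕ} (hd : d ≠ 0)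
    (hdn : d ≤ n) {z : Ch M} (hz : z ∈ Deg M d) (hdz : dd z = 0) (hzb : ¬ RB d Set.univ ∅ z) :
    ∃ c ∈ Deg M (n - d : ℕ), dd c = 0 ∧ ¬ RB (n - d : ℕ) Set.univ ∅ c := by
  obtain ⟨p, rfl⟩ := Nat.exists_eq_succ_of_ne_zero hd
  obtain ⟨u, -, hu2, hu3, q, hq, huq⟩ := exists_thom 𝒜 hμ hdμ hb
  obtain ⟨a, ha1, ha2, ha3, haz⟩ := exists_normalized_cocycle hz hdz hzb
  refine ⟨cap (p + 1) a μ, cap_Deg a hdn hμ, dd_cap ha1 ha2 hdμ, ?_⟩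
  rintro ⟨b, -, -, hb⟩
  rw [Cin_empty, Submodule.mem_bot, sub_eq_zero] at hb
  have hc : dd (crs z μ) = 0 := by rw [dd_crs hz, hdz, hdμ]; simp
  have h1 := cup_fst_eq_cup_snd 𝒜 hu2 hu3 ha1 ha2 hc
  rw [cup_fst_crs ha3 u hz huq, cup_snd_crs ha3 u hz hμ hdn, hb] at h1
  have h2 := LinearMap.congr_fun hu2 (crs z b)
  rw [LinearMap.comp_apply, dd_crs hz, hdz, map_zero, LinearMap.zero_apply, zero_add, map_smul,
    LinearMap.zero_apply, smul_eq_mul] at h2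
  rw [(mul_eq_zero.1 h2).resolve_left (pow_ne_zero _ (by norm_num)), mul_zero] at h1
  exact mul_ne_zero haz hq h1

end

end

section

open Cvx

theorem exists_cycle_of_betti_ne_zero {X : Type} [TopologicalSpace X] {d : ℕ}
    (h : bettiQ X d ≠ 0) : ∃ c ∈ Deg X d, dd c = 0 ∧ ¬ RB d Set.univ ∅ c :=
  (nontrivial_cohomology_iff X d).1 (Module.nontrivial_of_finrank_pos (R := ℚ) (Nat.pos_of_ne_zero h))

theorem Atl.not_strongStability {n : ℕ} {M : Type} [TopologicalSpace M] [T2Space M] (𝒜 : Atl n M)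
    {e : ℕ} (he0 : 0 < e) (hee : Even e) (he : 2 * e < n) {z : Ch M} (hz : z ∈ Deg M e)
    (hd : dd z = 0) (hb : ¬ RB e Set.univ ∅ z) : ¬ StrongStability M := by
  rintro ⟨r, -, hs⟩
  have iso : ∀ t i : ℕ, Nonempty (singularCohomologyQ (unorderedConfig M r) i ≃ₗ[ℚ]
      singularCohomologyQ (unorderedConfig M (r + t)) i) := by
    intro t i
    induction t with
    | zero => exact ⟨LinearEquiv.refl ℚ _⟩
    | succ t ih =>
      obtain ⟨f⟩ := ih
      obtain ⟨g⟩ := hs (r + t) (Nat.le_add_right _ _) i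
      exact ⟨f.trans g⟩
  obtain ⟨J, hJ⟩ := HV_unordered 𝒜 r
  have h := (nontrivial_cohomology_iff _ _).2 (exists_cycle_config 𝒜 hee he hz hd hb (r + (J + 1)))
  obtain ⟨f⟩ := iso (J + 1) (e * (r + (J + 1)))
  obtain ⟨c, hc, hdc, hcb⟩ := (nontrivial_cohomology_iff _ _).1 f.toEquiv.nontrivial
  refine hcb (HV_iff_RB.1 (hJ _ ?_) c hc (by simp) (by simp [hdc]))
  have : J < e * (r + (J + 1)) := by nlinarith
  exact_mod_cast this

end

end

end ConfStab

/-- A closed oriented connected manifold of even dimension `2m` with a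
non-zero even Betti number `β_{2i}(M) ≠ 0` in some degree `2i ∉ {0, m, 2m}` does not have
the strong stability property for its unordered configuration spaces.  (Orientability of
the closed connected `2m`-manifold is encoded by `β_{2m}(M) = 1`.) -/
theorem no_strong_stability_of_intermediate_even_betti (m : ℕ) (hm : 1 ≤ m) (M : Type)
    [TopologicalSpace M] [ChartedSpace (EuclideanSpace ℝ (Fin (2 * m))) M]
    [T2Space M] [SecondCountableTopology M] [ConnectedSpace M] [CompactSpace M]
    (horient : bettiQ M (2 * m) = 1)
    (heven : ∃ i : ℕ, 2 * i ≠ 0 ∧ 2 * i ≠ m ∧ 2 * i ≠ 2 * m ∧ bettiQ M (2 * i) ≠ 0) :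
    ¬ StrongStability M := by
  obtain ⟨𝒜⟩ := ConfStab.exists_atl (2 * m) M
  obtain ⟨μ, hμ, hdμ, hμb⟩ := ConfStab.exists_cycle_of_betti_ne_zero (horient ▸ one_ne_zero)
  obtain ⟨i, h0, h1, h2, hi⟩ := heven
  obtain ⟨z, hz, hdz, hzb⟩ := ConfStab.exists_cycle_of_betti_ne_zero hi
  have hle : 2 * i ≤ 2 * m := by
    by_contra hlt
    exact hzb (ConfStab.HV_iff_RB.1 (𝒜.HV_gt (by exact_mod_cast not_le.1 hlt)) z hz (by simp)
      (by simp [hdz]))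
  rcases lt_or_gt_of_ne h1 with hlt | hgt
  · exact 𝒜.not_strongStability (by omega) (even_two_mul i) (by omega) hz hdz hzb
  · obtain ⟨c, hc, hdc, hcb⟩ := ConfStab.exists_dual_cycle 𝒜 hμ hdμ hμb h0 hle hz hdz hzb
    refine 𝒜.not_strongStability (by omega) ?_ (by omega) hc hdc hcb
    exact ⟨m - i, by omega⟩
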